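/- If (C,D,h) ∈ W_n and C has the Disjoint Disks Property, then D has the Disjoint Disks Property. (Corollary 3.4) -/

import Mathlib

noncomputable section

open Metric Set unitInterval

/-- The ambient Euclidean space `ℝ^{n+1}` in which the sphere `S^n` lives. -/
abbrev Amb (n : ℕ) := EuclideanSpace ℝ (Fin (n + 1))

/-- The unit sphere `S^n` inside `ℝ^{n+1}`. -/
def Sph (n : ℕ) : Set (Amb n) := Metric.sphere 0 1

/-- A crumpled `n`-cube: the union of the image `bd` of a topological embedding of the
sphere `S^{n-1}` into `S^n` together with one of the connected components `int` of
`S^n \ bd`. -/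
structure CrumpledCube (n : ℕ) where
  bd : Set (Amb n)
  int : Set (Amb n)
  bd_subset_sphere : bd ⊆ Sph n
  exists_embedding : ∃ e : ↥(Sph (n - 1)) → Amb n,
      Continuous e ∧ Function.Injective e ∧ Set.range e = bd
  int_component : ∃ x, x ∈ Sph n \ bd ∧ int = connectedComponentIn (Sph n \ bd) x

namespace CrumpledCube

/-- The underlying set of a crumpled cube. -/
def carrier {n : ℕ} (C : CrumpledCube n) : Set (Amb n) := C.bd ∪ C.int

lemma bd_subset_carrier {n : ℕ} (C : CrumpledCube n) : C.bd ⊆ C.carrier :=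
  Set.subset_union_left

end CrumpledCube

/-- `f : C → D` is a map associated with the triple `(C, D, h)`: it is continuous,
restricts to `h` on `Bd C`, and satisfies `f⁻¹(Bd D) = Bd C`. -/
def IsAssociatedMap {n : ℕ} (C D : CrumpledCube n) (h : ↥C.bd ≃ₜ ↥D.bd)
    (f : ↥C.carrier → ↥D.carrier) : Prop :=
  Continuous f ∧
    (∀ (x : ↥C.carrier) (hx : (x : Amb n) ∈ C.bd),
      ((f x : ↥D.carrier) : Amb n) = ((h ⟨(x : Amb n), hx⟩ : ↥D.bd) : Amb n)) ∧
    (∀ x : ↥C.carrier, ((f x : ↥D.carrier) : Amb n) ∈ D.bd ↔ (x : Amb n) ∈ C.bd)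

/-- The triple `(C, D, h)` belongs to the collection `𝒲_n`. -/
def MemW {n : ℕ} (C D : CrumpledCube n) (h : ↥C.bd ≃ₜ ↥D.bd) : Prop :=
  ∃ f : ↥C.carrier → ↥D.carrier, IsAssociatedMap C D h f

/-- The image `h(T)` of a subset `T` of `Bd C` under a boundary homeomorphism
`h : Bd C → Bd D`, as a subset of the ambient space. -/
def bdImage {n : ℕ} {C D : CrumpledCube n} (h : ↥C.bd ≃ₜ ↥D.bd) (T : Set (Amb n)) :
    Set (Amb n) :=
  (fun x : ↥C.bd => ((h x : ↥D.bd) : Amb n)) '' {x : ↥C.bd | (x : Amb n) ∈ T}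

/-- `T` is a homotopy taming set for the crumpled cube `C`. -/
def IsHomotopyTamingSet {n : ℕ} (C : CrumpledCube n) (T : Set (Amb n)) : Prop :=
  T ⊆ C.bd ∧
    ∀ (m : C(I × I, ↥C.carrier)) (ε : ℝ), 0 < ε →
      ∃ m' : C(I × I, ↥C.carrier),
        (∀ x, dist (m x) (m' x) < ε) ∧ ∀ x, ((m' x : ↥C.carrier) : Amb n) ∈ T ∪ C.int

/-- `Bd C` is locally collared in `C` at the point `p`. -/
def LocallyCollaredAt {n : ℕ} (C : CrumpledCube n) (p : ↥C.carrier) : Prop :=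
  ∃ N : Set ↥C.carrier, IsOpen N ∧ p ∈ N ∧
    ∃ φ : ↥N ≃ₜ ↥(N ∩ {x : ↥C.carrier | (x : Amb n) ∈ C.bd}) × ↥(Set.Ico (0 : ℝ) 1),
      ∀ (x : ↥N) (hx : ((x : ↥C.carrier) : Amb n) ∈ C.bd),
        φ x = (⟨(x : ↥C.carrier), ⟨x.2, hx⟩⟩, ⟨0, ⟨le_rfl, zero_lt_one⟩⟩)

/-- The wild set of a crumpled cube: the points of `Bd C` at which `Bd C` fails to be
locally collared in `C`. -/
def wildSet {n : ℕ} (C : CrumpledCube n) : Set (Amb n) :=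
  {p | ∃ hp : p ∈ C.bd, ¬ LocallyCollaredAt C ⟨p, C.bd_subset_carrier hp⟩}

/-- `C` is strictly wilder than `D`. -/
def StrictlyWilder {n : ℕ} (C D : CrumpledCube n) : Prop :=
  (∃ h : ↥C.bd ≃ₜ ↥D.bd, MemW C D h) ∧ ∀ H : ↥D.bd ≃ₜ ↥C.bd, ¬ MemW D C H

/-- A crumpled `n`-cube is a closed `n`-cell-complement if the complement of its
interior in `S^n` is an `n`-cell. -/
def IsClosedCellComplement {n : ℕ} (C : CrumpledCube n) : Prop :=
  Nonempty (↥(Sph n \ C.int) ≃ₜ ↥(Metric.closedBall (0 : EuclideanSpace ℝ (Fin n)) 1))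
/-- The Disjoint Disks Property for a metric space. -/
def DisjointDisksProperty (X : Type*) [MetricSpace X] : Prop :=
  ∀ (μ₁ μ₂ : C(I × I, X)) (ε : ℝ), 0 < ε →
    ∃ μ₁' μ₂' : C(I × I, X),
      (∀ x, dist (μ₁ x) (μ₁' x) < ε) ∧ (∀ x, dist (μ₂ x) (μ₂' x) < ε) ∧
        Set.range ⇑μ₁' ∩ Set.range ⇑μ₂' = ∅

set_option autoImplicit false

/-- The `k`-th vertex of the simplex with base vertex `v` and direction order `ρ` in the
standard (Freudenthal) triangulation of the integer lattice. -/
def latticeVertex {n : ℕ} (ρ : Equiv.Perm (Fin n)) (v : Fin n → ℤ) (k : ℕ) : Fin n → ℤ :=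
  fun a => v a + if (ρ a : ℕ) < k then 1 else 0

lemma latticeVertex_swap {n : ℕ} (ρ : Equiv.Perm (Fin n)) (v : Fin n → ℤ) {t : ℕ}
    (ht : t + 1 < n) {k : ℕ} (hk : k ≠ t + 1) :
    latticeVertex (Equiv.swap ⟨t, by omega⟩ ⟨t + 1, ht⟩ * ρ) v k = latticeVertex ρ v k := by
  funext a
  simp only [latticeVertex, Equiv.Perm.mul_apply]
  congr 1
  have : ((Equiv.swap (⟨t, by omega⟩ : Fin n) ⟨t + 1, ht⟩ (ρ a) : Fin n) : ℕ) < k ↔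
      (ρ a : ℕ) < k := by
    rw [Equiv.swap_apply_def]
    split_ifs with h1 h2
    · simp [h1]; omega
    · simp [h2]; omega
    · rfl
  simp only [this]

/-- Sum over all simplices with a given base vertex. -/
def simplexSum {n : ℕ} (Φ : (ℕ → Fin n → ℤ) → ℤ) (v : Fin n → ℤ) : ℤ :=
  ∑ ρ : Equiv.Perm (Fin n), (Equiv.Perm.sign ρ : ℤ) * Φ (latticeVertex ρ v)

lemma simplexSum_eq_zero {n : ℕ} (Φ : (ℕ → Fin n → ℤ) → ℤ) (v : Fin n → ℤ) {t : ℕ}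
    (ht : t + 1 < n) (hΦ : ∀ P Q : ℕ → Fin n → ℤ, (∀ k, k ≠ t + 1 → P k = Q k) → Φ P = Φ Q) :
    simplexSum Φ v = 0 := by
  have h : simplexSum Φ v = - simplexSum Φ v := by
    conv_lhs => rw [simplexSum, ← Equiv.sum_comp (Equiv.mulLeft
      (Equiv.swap (⟨t, by omega⟩ : Fin n) ⟨t + 1, ht⟩))]
    rw [simplexSum, ← Finset.sum_neg_distrib]
    refine Finset.sum_congr rfl fun ρ _ => ?_
    simp only [Equiv.coe_mulLeft]
    rw [hΦ _ (latticeVertex ρ v) (fun k hk => latticeVertex_swap ρ v ht hk)]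
    rw [Equiv.Perm.sign_mul, Equiv.Perm.sign_swap (by simp)]
    simp
  omega

/-- The product in which the factor `F j` occupies the step `q j`, and `H` is evaluated at the
vertex `k`. -/
def slotTerm {n : ℕ} (F : Fin n → (Fin n → ℤ) → ℤ) (H : (Fin n → ℤ) → ℤ) (i : Fin n)
    (q : Fin n → ℕ) (k : ℕ) (P : ℕ → Fin n → ℤ) : ℤ :=
  H (P k) * ∏ j ∈ Finset.univ.erase i, (F j (P (q j + 1)) - F j (P (q j)))

lemma simplexSum_add {n : ℕ} (Φ Ψ : (ℕ → Fin n → ℤ) → ℤ) (v : Fin n → ℤ) :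
    simplexSum (fun P => Φ P + Ψ P) v = simplexSum Φ v + simplexSum Ψ v := by
  simp [simplexSum, mul_add, Finset.sum_add_distrib]

lemma simplexSum_sub {n : ℕ} (Φ Ψ : (ℕ → Fin n → ℤ) → ℤ) (v : Fin n → ℤ) :
    simplexSum (fun P => Φ P - Ψ P) v = simplexSum Φ v - simplexSum Ψ v := by
  simp [simplexSum, mul_sub, Finset.sum_sub_distrib]

lemma simplexSum_slotTerm_add {n : ℕ} (F : Fin n → (Fin n → ℤ) → ℤ) (H : (Fin n → ℤ) → ℤ)
    (i : Fin n) (q q' : Fin n → ℕ) (k t : ℕ) (ht : t + 1 < n) (j₀ : Fin n) (hj₀ : j₀ ≠ i)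
    (h1 : q j₀ = t + 1) (h2 : q' j₀ = t)
    (hq : ∀ j, j ≠ i → j ≠ j₀ → q' j = q j ∧ q j ≠ t ∧ q j ≠ t + 1) (hk : k ≠ t + 1)
    (v : Fin n → ℤ) :
    simplexSum (slotTerm F H i q k) v = - simplexSum (slotTerm F H i q' k) v := by
  rw [eq_neg_iff_add_eq_zero, ← simplexSum_add]
  refine simplexSum_eq_zero _ v ht fun P Q hPQ => ?_
  have key : ∀ P : ℕ → Fin n → ℤ, slotTerm F H i q k P + slotTerm F H i q' k P =
      H (P k) * ((F j₀ (P (t + 2)) - F j₀ (P t)) *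
        ∏ j ∈ (Finset.univ.erase i).erase j₀, (F j (P (q j + 1)) - F j (P (q j)))) := by
    intro P
    have hm : j₀ ∈ Finset.univ.erase i := by simp [hj₀]
    rw [slotTerm, slotTerm, ← Finset.mul_prod_erase _ _ hm,
      ← Finset.mul_prod_erase (Finset.univ.erase i) (fun j => F j (P (q' j + 1)) - F j (P (q' j))) hm,
      h1, h2]
    have : ∏ j ∈ (Finset.univ.erase i).erase j₀, (F j (P (q' j + 1)) - F j (P (q' j))) =
        ∏ j ∈ (Finset.univ.erase i).erase j₀, (F j (P (q j + 1)) - F j (P (q j))) := by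
      refine Finset.prod_congr rfl fun j hj => ?_
      simp only [Finset.mem_erase, Finset.mem_univ, and_true] at hj
      rw [(hq j hj.2 hj.1).1]
    rw [this]
    ring
  rw [key, key, hPQ k hk, hPQ (t + 2) (by omega), hPQ t (by omega)]
  congr 2
  refine Finset.prod_congr rfl fun j hj => ?_
  simp only [Finset.mem_erase, Finset.mem_univ, and_true] at hj
  obtain ⟨_, h3, h4⟩ := hq j hj.2 hj.1
  rw [hPQ (q j + 1) (by omega), hPQ (q j) h4]

/-- Slots after moving the factors `i+1,…,s` one step down. -/
def slotDown {n : ℕ} (i : Fin n) (s : ℕ) (j : Fin n) : ℕ :=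
  if (i : ℕ) < j ∧ (j : ℕ) ≤ s then j - 1 else j

/-- Slots after moving the factors `s,…,i-1` one step up. -/
def slotUp {n : ℕ} (i : Fin n) (s : ℕ) (j : Fin n) : ℕ :=
  if s ≤ (j : ℕ) ∧ (j : ℕ) < i then j + 1 else j

lemma simplexSum_slotDown {n : ℕ} (F : Fin n → (Fin n → ℤ) → ℤ) (H : (Fin n → ℤ) → ℤ)
    (i : Fin n) (v : Fin n → ℤ) (d : ℕ) (hd : (i : ℕ) + d < n) :
    simplexSum (slotTerm F H i (fun j => j) i) v =
      (-1) ^ d * simplexSum (slotTerm F H i (slotDown i (i + d)) i) v := by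
  induction d with
  | zero =>
    have : slotDown i (i + 0) = fun j : Fin n => (j : ℕ) := by
      funext j; simp only [slotDown]; split_ifs <;> omega
    rw [this]; simp
  | succ d ih =>
    rw [ih (by omega), simplexSum_slotTerm_add F H i (slotDown i (i + d))
      (slotDown i (i + (d + 1))) i (i + d) (by omega) ⟨i + d + 1, by omega⟩
      (by simp [Fin.ext_iff]; omega)]
    · ring
    · simp only [slotDown]; split_ifs <;> omega
    · simp only [slotDown]; split_ifs <;> omega
    · intro j h1 h2
      simp only [ne_eq, Fin.ext_iff] at h1 h2
      simp only [slotDown]; split_ifs <;> omega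
    · omega

lemma simplexSum_slotUp {n : ℕ} (F : Fin n → (Fin n → ℤ) → ℤ) (H : (Fin n → ℤ) → ℤ)
    (i : Fin n) (v : Fin n → ℤ) (d : ℕ) (hd : d ≤ (i : ℕ)) :
    simplexSum (slotTerm F H i (fun j => j) (i + 1)) v =
      (-1) ^ d * simplexSum (slotTerm F H i (slotUp i (i - d)) (i + 1)) v := by
  induction d with
  | zero =>
    have : slotUp i (i - 0) = fun j : Fin n => (j : ℕ) := by
      funext j; simp only [slotUp]; split_ifs <;> omega
    rw [this]; simp
  | succ d ih =>
    rw [ih (by omega)]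
    have := simplexSum_slotTerm_add F H i (slotUp i (i - (d + 1)))
      (slotUp i (i - d)) (i + 1) (i - (d + 1)) (by omega) ⟨i - (d + 1), by omega⟩
      (by simp [Fin.ext_iff]; omega)
      (by simp only [slotUp]; split_ifs <;> omega) (by simp only [slotUp]; split_ifs <;> omega)
      (by
        intro j h1 h2
        simp only [ne_eq, Fin.ext_iff] at h1 h2
        simp only [slotUp]; split_ifs <;> omega) (by omega) v
    rw [this]
    ring

lemma finite_support_simplexSum_slotTerm {n : ℕ} (F : Fin n → (Fin n → ℤ) → ℤ)
    (H : (Fin n → ℤ) → ℤ) (hH : (Function.support H).Finite) (i : Fin n) (q : Fin n → ℕ) (k : ℕ)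
    (ρ : Equiv.Perm (Fin n)) :
    (Function.support fun v => (Equiv.Perm.sign ρ : ℤ) *
      slotTerm F H i q k (latticeVertex ρ v)).Finite := by
  refine (hH.preimage (f := fun v => latticeVertex ρ v k) ?_).subset ?_
  · intro v _ w _ h
    funext a
    have := congrFun h a
    simpa [latticeVertex] using this
  · intro v hv
    simp only [mem_preimage, Function.mem_support] at hv ⊢
    intro h0
    apply hv
    simp [slotTerm, h0]

lemma finsum_simplexSum_slotTerm {n : ℕ} (F : Fin n → (Fin n → ℤ) → ℤ)
    (H : (Fin n → ℤ) → ℤ) (hH : (Function.support H).Finite) (i : Fin n) (q : Fin n → ℕ) (k : ℕ) :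
    ∑ᶠ v, simplexSum (slotTerm F H i q k) v = ∑ ρ : Equiv.Perm (Fin n), ∑ᶠ v,
      (Equiv.Perm.sign ρ : ℤ) * slotTerm F H i q k (latticeVertex ρ v) := by
  simp only [simplexSum]
  exact finsum_sum_comm _ _ fun ρ _ => finite_support_simplexSum_slotTerm F H hH i q k ρ

lemma finsum_slot_shift {m : ℕ} (F : Fin (m + 1) → (Fin (m + 1) → ℤ) → ℤ)
    (H : (Fin (m + 1) → ℤ) → ℤ) (hH : (Function.support H).Finite) (i : Fin (m + 1)) :
    ∑ᶠ v, simplexSum (slotTerm F H i (slotUp i 0) (i + 1)) v =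
      (-1) ^ m * ∑ᶠ v, simplexSum (slotTerm F H i (slotDown i m) i) v := by
  rw [finsum_simplexSum_slotTerm F H hH, finsum_simplexSum_slotTerm F H hH, Finset.mul_sum,
    ← Equiv.sum_comp (Equiv.mulLeft (finRotate (m + 1)))]
  refine Finset.sum_congr rfl fun ρ _ => ?_
  simp only [Equiv.coe_mulLeft]
  set a₀ : Fin (m + 1) := ρ.symm (Fin.last m) with ha₀
  rw [← finsum_comp_equiv (Equiv.addRight (Pi.single a₀ (1 : ℤ))) (f := fun v =>
    (Equiv.Perm.sign ρ : ℤ) * slotTerm F H i (slotDown i m) i (latticeVertex ρ v)),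
    ← smul_eq_mul ((-1 : ℤ) ^ m), smul_finsum]
  refine finsum_congr fun v => ?_
  have hP : ∀ k, k ≤ m → latticeVertex (finRotate (m + 1) * ρ) v (k + 1) =
      latticeVertex ρ (v + Pi.single a₀ 1) k := by
    intro k hk
    funext a
    simp only [latticeVertex, Equiv.Perm.mul_apply, Pi.add_apply]
    rcases eq_or_ne a a₀ with rfl | hne
    · have h1 : ρ a₀ = Fin.last m := by simp [ha₀]
      simp only [h1, finRotate_last, Pi.single_eq_same, Fin.val_last]
      rw [if_neg (by omega : ¬ m < k)]
      simp
    · have h1 : ρ a ≠ Fin.last m := fun h => hne (by simp [ha₀, ← h])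
      have h2 : (ρ a : ℕ) < m := by
        have := (ρ a).is_lt
        have h3 : (ρ a : ℕ) ≠ m := fun h => h1 (Fin.ext (by simpa using h))
        omega
      have h4 : ((finRotate (m + 1) (ρ a) : Fin (m + 1)) : ℕ) = ρ a + 1 :=
        coe_finRotate_of_ne_last h1
      simp only [h4, Pi.single_eq_of_ne hne]
      simp
  rw [Equiv.Perm.sign_mul, sign_finRotate]
  simp only [Equiv.coe_addRight, smul_eq_mul, slotTerm]
  rw [hP i (by omega)]
  have : ∏ j ∈ Finset.univ.erase i, (F j (latticeVertex (finRotate (m + 1) * ρ) v (slotUp i 0 j + 1))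
        - F j (latticeVertex (finRotate (m + 1) * ρ) v (slotUp i 0 j))) =
      ∏ j ∈ Finset.univ.erase i, (F j (latticeVertex ρ (v + Pi.single a₀ 1) (slotDown i m j + 1))
        - F j (latticeVertex ρ (v + Pi.single a₀ 1) (slotDown i m j))) := by
    refine Finset.prod_congr rfl fun j hj => ?_
    simp only [Finset.mem_erase, Finset.mem_univ, and_true, ne_eq, Fin.ext_iff] at hj
    have h5 : slotUp i 0 j = slotDown i m j + 1 := by
      simp only [slotUp, slotDown]; split_ifs <;> omega
    have h6 : slotDown i m j + 1 ≤ m := by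
      simp only [slotDown]; split_ifs <;> omega
    rw [h5, hP _ h6, hP _ (by omega)]
  rw [this]
  push_cast
  ring

/-- Changing one factor of the discrete cup product by a finitely supported function does not
change the total sum. -/
lemma finsum_simplexSum_coboundary {n : ℕ} (F : Fin n → (Fin n → ℤ) → ℤ)
    (H : (Fin n → ℤ) → ℤ) (hH : (Function.support H).Finite) (i : Fin n) :
    ∑ᶠ v, simplexSum (fun P => (H (P (i + 1)) - H (P i)) *
      ∏ j ∈ Finset.univ.erase i, (F j (P (j + 1)) - F j (P j))) v = 0 := by
  obtain ⟨m, rfl⟩ : ∃ m, n = m + 1 := ⟨n - 1, by have := i.is_lt; omega⟩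
  have h1 : ∀ v, simplexSum (fun P => (H (P (i + 1)) - H (P i)) *
      ∏ j ∈ Finset.univ.erase i, (F j (P (j + 1)) - F j (P j))) v =
      (-1) ^ (i : ℕ) * simplexSum (slotTerm F H i (slotUp i 0) (i + 1)) v -
      (-1) ^ (m - i : ℕ) * simplexSum (slotTerm F H i (slotDown i m) i) v := by
    intro v
    have h2 := simplexSum_slotUp F H i v i le_rfl
    have h3 := simplexSum_slotDown F H i v (m - i) (by omega)
    rw [Nat.sub_self] at h2
    rw [show (i : ℕ) + (m - i) = m by omega] at h3
    rw [← h2, ← h3, ← simplexSum_sub]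
    simp only [slotTerm, sub_mul]
  simp only [h1]
  have hfin : ∀ q k, (Function.support fun v => simplexSum (slotTerm F H i q k) v).Finite := by
    intro q k
    refine (Set.finite_iUnion (fun ρ : Equiv.Perm (Fin (m + 1)) =>
      finite_support_simplexSum_slotTerm F H hH i q k ρ)).subset ?_
    intro v hv
    by_contra hcon
    simp only [mem_iUnion, Function.mem_support, not_exists, not_not] at hcon
    exact hv (Finset.sum_eq_zero fun ρ _ => hcon ρ)
  rw [finsum_sub_distrib]
  · simp only [← smul_eq_mul]
    rw [← smul_finsum, ← smul_finsum, finsum_slot_shift F H hH]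
    have : (-1 : ℤ) ^ (i : ℕ) * (-1) ^ m = (-1) ^ (m - i : ℕ) := by
      obtain ⟨d, hd⟩ : ∃ d, m = i + d := ⟨m - i, by omega⟩
      have h7 : (-1 : ℤ) ^ m = (-1) ^ (i : ℕ) * (-1) ^ d := by rw [← pow_add, ← hd]
      rw [show m - (i : ℕ) = d by omega, h7, ← mul_assoc, ← mul_pow]
      simp
    simp only [smul_eq_mul]
    rw [← mul_assoc, this, sub_self]
  · exact (hfin _ _).subset (Function.support_const_smul_subset (_ : ℤ) _)
  · exact (hfin _ _).subset (Function.support_const_smul_subset (_ : ℤ) _)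
open Filter Topology

lemma exists_uniform_ball_subset {α ι : Type*} [PseudoMetricSpace α] {K : Set α} (hK : IsCompact K)
    (S : ι → Set α) (hS : ∀ x ∈ K, ∃ i, S i ∈ 𝓝 x) :
    ∃ δ > 0, ∀ x ∈ K, ∃ i, ball x δ ⊆ S i := by
  obtain ⟨δ, hδ, h⟩ := lebesgue_number_lemma_of_metric hK (c := fun i => interior (S i))
    (fun i => isOpen_interior) (fun x hx => by
      obtain ⟨i, hi⟩ := hS x hx
      exact mem_iUnion.2 ⟨i, mem_interior_iff_mem_nhds.2 hi⟩)
  exact ⟨δ, hδ, fun x hx => (h x hx).imp fun i hi => hi.trans interior_subset⟩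

lemma exists_mem_frontier_of_isPreconnected {α : Type*} [TopologicalSpace α] {t s : Set α}
    (ht : IsPreconnected t) (h1 : (t ∩ s).Nonempty) (h2 : (t ∩ sᶜ).Nonempty) :
    (t ∩ frontier s).Nonempty := by
  by_contra hcon
  have hsub : t ⊆ interior s ∪ (closure s)ᶜ := by
    intro z hz
    by_contra hz'
    simp only [mem_union, mem_compl_iff, not_or, not_not] at hz'
    exact hcon ⟨z, hz, hz'.2, hz'.1⟩
  obtain ⟨z, -, h3, h4⟩ := ht _ _ isOpen_interior isClosed_closure.isOpen_compl hsub
    (by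
      obtain ⟨x, hx, hxs⟩ := h1
      refine ⟨x, hx, (hsub hx).resolve_right fun h => h (subset_closure hxs)⟩)
    (by
      obtain ⟨x, hx, hxs⟩ := h2
      refine ⟨x, hx, (hsub hx).resolve_left fun h => hxs (interior_subset h)⟩)
  exact h4 (subset_closure (interior_subset h3))

lemma eq_of_isPreconnected_of_locally {α β : Type*} [TopologicalSpace α] {s : Set α}
    (hs : IsPreconnected s) (f : α → β) (h : ∀ x ∈ s, ∀ᶠ y in 𝓝[s] x, f y = f x)
    {x y : α} (hx : x ∈ s) (hy : y ∈ s) : f x = f y :=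
  hs.induction₂ (fun a b => f a = f b) (fun a ha => (h a ha).mono fun _ hb => hb.symm)
    (fun _ _ _ _ _ _ h1 h2 => h1.trans h2) (fun _ _ _ _ h1 => h1.symm) hx hy

/-- The point `v / N`. -/
def latticePt {n : ℕ} (N : ℕ) (v : Fin n → ℤ) : Fin n → ℝ := fun a => (v a : ℝ) / N

lemma dist_latticePt_latticeVertex {n : ℕ} (N : ℕ) (ρ : Equiv.Perm (Fin n)) (v : Fin n → ℤ)
    (k : ℕ) : dist (latticePt N (latticeVertex ρ v k)) (latticePt N v) ≤ 1 / N := by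
  rw [dist_pi_le_iff (by positivity)]
  intro a
  simp only [latticePt, latticeVertex, Real.dist_eq]
  rw [← sub_div, abs_div, Nat.abs_cast]
  gcongr
  split_ifs <;> simp

/-- The summand at a simplex of the discrete cup product. -/
def cupTerm {n : ℕ} (N : ℕ) (F : Fin n → (Fin n → ℝ) → ℤ) (P : ℕ → Fin n → ℤ) : ℤ :=
  ∏ j : Fin n, (F j (latticePt N (P (j + 1))) - F j (latticePt N (P j)))

open Classical in
/-- The discrete cup product of the functions `F j` at mesh `1 / N`, summed over the simplices
with base vertex in `X`. -/
def cupSum {n : ℕ} (F : Fin n → (Fin n → ℝ) → ℤ) (X : Set (Fin n → ℝ)) (N : ℕ) : ℤ :=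
  ∑ᶠ v : Fin n → ℤ, if latticePt N v ∈ X then simplexSum (cupTerm N F) v else 0

lemma finite_latticePt_mem {n : ℕ} {X : Set (Fin n → ℝ)} (hX : Bornology.IsBounded X) {N : ℕ}
    (hN : N ≠ 0) : {v : Fin n → ℤ | latticePt N v ∈ X}.Finite := by
  obtain ⟨R, hR⟩ := hX.subset_closedBall 0
  obtain ⟨M, hM⟩ := exists_nat_ge R
  refine (Set.finite_Icc (fun _ : Fin n => -((M * N : ℕ) : ℤ)) (fun _ => ((M * N : ℕ) : ℤ))).subset ?_
  intro v hv
  have h1 := hR hv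
  rw [mem_closedBall_zero_iff] at h1
  have hN' : (0 : ℝ) < N := by positivity
  have h2 : ∀ a, |(v a : ℝ)| ≤ M * N := by
    intro a
    have h3 := (norm_le_pi_norm (latticePt N v) a).trans (h1.trans hM)
    rw [Real.norm_eq_abs, latticePt, abs_div, Nat.abs_cast, div_le_iff₀ hN'] at h3
    exact h3
  constructor <;> intro a <;> have h4 := abs_le.1 (h2 a)
  · have : ((-((M * N : ℕ) : ℤ) : ℤ) : ℝ) ≤ v a := by push_cast; linarith [h4.1]
    exact_mod_cast this
  · have : ((v a : ℤ) : ℝ) ≤ (((M * N : ℕ) : ℤ) : ℝ) := by push_cast; linarith [h4.2]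
    exact_mod_cast this

lemma finite_support_cupSum {n : ℕ} {X : Set (Fin n → ℝ)}
    (hX : Bornology.IsBounded X) {N : ℕ} (hN : N ≠ 0) (f : (Fin n → ℤ) → ℤ)
    (hf : ∀ v, latticePt N v ∉ X → f v = 0) : (Function.support f).Finite := by
  refine (finite_latticePt_mem hX hN).subset fun v hv => ?_
  by_contra h
  exact hv (hf v h)

lemma cupTerm_eq_zero {n : ℕ} {N : ℕ} {F : Fin n → (Fin n → ℝ) → ℤ} {P : ℕ → Fin n → ℤ}
    {j : Fin n} {c : ℤ} (h : ∀ k, F j (latticePt N (P k)) = c) : cupTerm N F P = 0 :=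
  Finset.prod_eq_zero (Finset.mem_univ j) (by rw [h, h, sub_self])

lemma simplexSum_congr {n : ℕ} {Φ Ψ : (ℕ → Fin n → ℤ) → ℤ} {v : Fin n → ℤ}
    (h : ∀ ρ, Φ (latticeVertex ρ v) = Ψ (latticeVertex ρ v)) : simplexSum Φ v = simplexSum Ψ v :=
  Finset.sum_congr rfl fun ρ _ => by rw [h]

lemma simplexSum_eq_zero_of_forall {n : ℕ} {Φ : (ℕ → Fin n → ℤ) → ℤ} {v : Fin n → ℤ}
    (h : ∀ ρ, Φ (latticeVertex ρ v) = 0) : simplexSum Φ v = 0 :=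
  Finset.sum_eq_zero fun ρ _ => by rw [h, mul_zero]

lemma exists_one_div_lt_of_pos {δ : ℝ} (hδ : 0 < δ) : ∀ᶠ N : ℕ in atTop, N ≠ 0 ∧ 1 / (N : ℝ) < δ := by
  have h1 := (tendsto_order.1 tendsto_one_div_atTop_nhds_zero_nat).2 δ hδ
  filter_upwards [h1, eventually_ge_atTop 1] with N h2 h3
  exact ⟨by omega, h2⟩

open Classical in
lemma cupSum_update {n : ℕ} (F : Fin n → (Fin n → ℝ) → ℤ) (i : Fin n) (G : (Fin n → ℝ) → ℤ)
    {X : Set (Fin n → ℝ)} (hX : Bornology.IsBounded X)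
    (h : ∀ x ∈ frontier X, ∃ jc : Fin n × ℤ,
      {y | F jc.1 y = jc.2 ∧ Function.update F i G jc.1 y = jc.2} ∈ 𝓝 x) :
    ∀ᶠ N in atTop, cupSum F X N = cupSum (Function.update F i G) X N := by
  have hfc : IsCompact (frontier X) :=
    Metric.isCompact_of_isClosed_isBounded isClosed_frontier
      (hX.closure.subset frontier_subset_closure)
  obtain ⟨δ, hδ, hball⟩ := exists_uniform_ball_subset hfc _ h
  filter_upwards [exists_one_div_lt_of_pos (half_pos hδ)] with N ⟨hN, hNδ⟩
  set F' := Function.update F i G with hF'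
  set H : (Fin n → ℤ) → ℤ := fun p => if latticePt N p ∈ X then
    F' i (latticePt N p) - F i (latticePt N p) else 0 with hH
  have hHfin : (Function.support H).Finite :=
    finite_support_cupSum hX hN H fun v hv => by simp [hH, hv]
  have key := finsum_simplexSum_coboundary (fun j p => F j (latticePt N p)) H hHfin i
  have hterm : ∀ v, simplexSum (fun P => (H (P (i + 1)) - H (P i)) *
      ∏ j ∈ Finset.univ.erase i, (F j (latticePt N (P (j + 1))) - F j (latticePt N (P j)))) v =
      (if latticePt N v ∈ X then simplexSum (cupTerm N F') v else 0) -
      (if latticePt N v ∈ X then simplexSum (cupTerm N F) v else 0) := by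
    intro v
    have h1 : ∀ P : ℕ → Fin n → ℤ, cupTerm N F' P - cupTerm N F P =
        ((F' i (latticePt N (P (i + 1))) - F i (latticePt N (P (i + 1)))) -
          (F' i (latticePt N (P i)) - F i (latticePt N (P i)))) *
        ∏ j ∈ Finset.univ.erase i, (F j (latticePt N (P (j + 1))) - F j (latticePt N (P j))) := by
      intro P
      rw [cupTerm, cupTerm, ← Finset.mul_prod_erase _ _ (Finset.mem_univ i),
        ← Finset.mul_prod_erase Finset.univ
          (fun j => F j (latticePt N (P (j + 1))) - F j (latticePt N (P j))) (Finset.mem_univ i)]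
      have : ∏ j ∈ Finset.univ.erase i, (F' j (latticePt N (P (j + 1))) - F' j (latticePt N (P j)))
          = ∏ j ∈ Finset.univ.erase i,
            (F j (latticePt N (P (j + 1))) - F j (latticePt N (P j))) := by
        refine Finset.prod_congr rfl fun j hj => ?_
        rw [hF', Function.update_of_ne (Finset.ne_of_mem_erase hj)]
      rw [this]
      ring
    have h2 : ∀ ρ, (H (latticeVertex ρ v (i + 1)) - H (latticeVertex ρ v i)) *
        ∏ j ∈ Finset.univ.erase i, (F j (latticePt N (latticeVertex ρ v (j + 1))) -
          F j (latticePt N (latticeVertex ρ v j))) =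
        if latticePt N v ∈ X then cupTerm N F' (latticeVertex ρ v) -
          cupTerm N F (latticeVertex ρ v) else 0 := by
      intro ρ
      by_cases hall : ∀ k, latticePt N (latticeVertex ρ v k) ∈ X ↔ latticePt N v ∈ X
      · by_cases hv : latticePt N v ∈ X
        · simp only [hv, iff_true] at hall
          simp only [hH, hall, hv, if_true, h1]
        · simp only [hv, iff_false] at hall
          simp [hH, hall, hv]
      · push Not at hall
        obtain ⟨k, hk⟩ := hall
        have hz : ∃ z ∈ frontier X, dist z (latticePt N v) ≤ 1 / N := by
          have hconn := (convex_segment (𝕜 := ℝ) (latticePt N v)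
            (latticePt N (latticeVertex ρ v k))).isPreconnected
          have hne : (segment ℝ (latticePt N v) (latticePt N (latticeVertex ρ v k)) ∩
              frontier X).Nonempty := by
            rcases hk with ⟨ha, hb⟩ | ⟨ha, hb⟩
            · exact exists_mem_frontier_of_isPreconnected hconn ⟨_, right_mem_segment _ _ _, ha⟩
                ⟨_, left_mem_segment _ _ _, hb⟩
            · exact exists_mem_frontier_of_isPreconnected hconn ⟨_, left_mem_segment _ _ _, hb⟩
                ⟨_, right_mem_segment _ _ _, ha⟩
          obtain ⟨z, hz1, hz2⟩ := hne
          refine ⟨z, hz2, ?_⟩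
          have := (convex_closedBall (latticePt N v) (1 / (N : ℝ))).segment_subset
            (mem_closedBall_self (by positivity))
            (mem_closedBall.2 (dist_latticePt_latticeVertex N ρ v k)) hz1
          exact mem_closedBall.1 this
        obtain ⟨z, hz1, hz2⟩ := hz
        obtain ⟨⟨j, c⟩, hjc⟩ := hball z hz1
        have hc : ∀ k, F j (latticePt N (latticeVertex ρ v k)) = c ∧
            F' j (latticePt N (latticeVertex ρ v k)) = c := by
          intro k
          refine hjc (mem_ball.2 ?_)
          have := dist_triangle_right (latticePt N (latticeVertex ρ v k)) z (latticePt N v)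
          have := dist_latticePt_latticeVertex N ρ v k
          linarith
        rw [cupTerm_eq_zero fun k => (hc k).1, cupTerm_eq_zero fun k => (hc k).2]
        rw [sub_zero, ite_self]
        by_cases hji : j = i
        · subst hji
          simp only [hH, (hc _).1, (hc _).2]
          simp
        · rw [Finset.prod_eq_zero (Finset.mem_erase.2 ⟨hji, Finset.mem_univ j⟩), mul_zero]
          rw [(hc _).1, (hc _).1, sub_self]
    rw [simplexSum_congr (Ψ := fun P => if latticePt N v ∈ X then cupTerm N F' P -
      cupTerm N F P else 0) h2]
    split_ifs
    · rw [simplexSum_sub]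
    · rw [sub_zero]; exact simplexSum_eq_zero_of_forall fun _ => rfl
  simp only [hterm] at key
  rw [finsum_sub_distrib] at key
  · rw [cupSum, cupSum]; omega
  · exact finite_support_cupSum hX hN _ fun v hv => by simp [hv]
  · exact finite_support_cupSum hX hN _ fun v hv => by simp [hv]

lemma cupSum_eventuallyEq {n : ℕ} (F F' : Fin n → (Fin n → ℝ) → ℤ)
    {X : Set (Fin n → ℝ)} (hX : Bornology.IsBounded X)
    (h : ∀ x ∈ frontier X, ∃ jc : Fin n × ℤ, {y | F jc.1 y = jc.2 ∧ F' jc.1 y = jc.2} ∈ 𝓝 x) :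
    ∀ᶠ N in atTop, cupSum F X N = cupSum F' X N := by
  classical
  have key : ∀ s : Finset (Fin n), ∀ᶠ N in atTop, cupSum F X N = cupSum (s.piecewise F' F) X N := by
    intro s
    induction s using Finset.induction_on with
    | empty => simp
    | insert i s his ih =>
      have h1 := cupSum_update (s.piecewise F' F) i (F' i) hX (fun x hx => by
        obtain ⟨jc, hjc⟩ := h x hx
        refine ⟨jc, ?_⟩
        filter_upwards [hjc] with y hy
        have hp : s.piecewise F' F jc.1 y = jc.2 := by
          by_cases hj : jc.1 ∈ s
          · simp [hj, hy.2]
          · simp [hj, hy.1]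
        refine ⟨hp, ?_⟩
        by_cases hj : jc.1 = i
        · rw [← hj, Function.update_self]; exact hy.2
        · rw [Function.update_of_ne hj]; exact hp)
      filter_upwards [ih, h1] with N h2 h3
      rw [h2, h3, Finset.piecewise_insert]
  simpa using key Finset.univ

open Classical in
/-- The indicators of positivity of the coordinates of `g`. -/
def posInd {n : ℕ} (g : (Fin n → ℝ) → Fin n → ℝ) : Fin n → (Fin n → ℝ) → ℤ :=
  fun j p => if 0 < g p j then 1 else 0

/-- The (combinatorial) degree of `g` on `X` over `0`, with values in germs of integer sequences
indexed by the mesh. -/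
def mdeg {n : ℕ} (g : (Fin n → ℝ) → Fin n → ℝ) (X : Set (Fin n → ℝ)) : Germ (atTop : Filter ℕ) ℤ :=
  ((fun N => cupSum (posInd g) X N : ℕ → ℤ) : Germ (atTop : Filter ℕ) ℤ)

lemma mdeg_eq_of_eventually {n : ℕ} {g : (Fin n → ℝ) → Fin n → ℝ} {X : Set (Fin n → ℝ)}
    {s : ℕ → ℤ} (h : ∀ᶠ N in atTop, cupSum (posInd g) X N = s N) :
    mdeg g X = (s : Germ (atTop : Filter ℕ) ℤ) :=
  Germ.coe_eq.2 h

lemma posInd_eventually {n : ℕ} {g : (Fin n → ℝ) → Fin n → ℝ} (hg : Continuous g) {x : Fin n → ℝ}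
    {j : Fin n} (h : g x j ≠ 0) : {y | posInd g j y = posInd g j x} ∈ 𝓝 x := by
  have hc : Continuous fun y => g y j := (continuous_apply j).comp hg
  rcases lt_or_gt_of_ne h with h | h
  · filter_upwards [hc.continuousAt.eventually_lt continuousAt_const h] with y hy
    simp [posInd, not_lt.2 hy.le, not_lt.2 h.le]
  · filter_upwards [continuousAt_const.eventually_lt hc.continuousAt h] with y hy
    simp [posInd, hy, h]

lemma mdeg_congr_sign {n : ℕ} {g g' : (Fin n → ℝ) → Fin n → ℝ} (hg : Continuous g)
    (hg' : Continuous g') {X : Set (Fin n → ℝ)} (hX : Bornology.IsBounded X)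
    (h : ∀ x ∈ frontier X, ∃ j, 0 < g x j * g' x j) : mdeg g X = mdeg g' X := by
  refine mdeg_eq_of_eventually (cupSum_eventuallyEq _ _ hX fun x hx => ?_)
  obtain ⟨j, hj⟩ := h x hx
  refine ⟨(j, posInd g j x), ?_⟩
  have h1 : g x j ≠ 0 := fun h0 => by simp [h0] at hj
  have h2 : g' x j ≠ 0 := fun h0 => by simp [h0] at hj
  have h3 : posInd g j x = posInd g' j x := by
    rcases lt_or_gt_of_ne h1 with h | h
    · have h4 : g' x j < 0 := by nlinarith
      simp [posInd, not_lt.2 h.le, not_lt.2 h4.le]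
    · have h4 : 0 < g' x j := by nlinarith
      simp [posInd, h, h4]
  filter_upwards [posInd_eventually hg h1, posInd_eventually hg' h2] with y ha hb
  exact ⟨ha, h3 ▸ hb⟩

lemma mdeg_rouche {n : ℕ} {g g' : (Fin n → ℝ) → Fin n → ℝ} (hg : Continuous g)
    (hg' : Continuous g') {X : Set (Fin n → ℝ)} (hX : Bornology.IsBounded X)
    (h : ∀ x ∈ frontier X, ‖g x - g' x‖ < ‖g x‖) : mdeg g X = mdeg g' X := by
  refine mdeg_congr_sign hg hg' hX fun x hx => ?_
  by_contra hcon
  push Not at hcon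
  have h1 := h x hx
  have h0 : 0 < ‖g x‖ := (norm_nonneg _).trans_lt h1
  refine absurd ((pi_norm_lt_iff h0).2 fun j => ?_) (lt_irrefl ‖g x‖)
  have h2 := norm_le_pi_norm (g x - g' x) j
  refine lt_of_le_of_lt ?_ h1
  refine le_trans ?_ h2
  rw [Pi.sub_apply, Real.norm_eq_abs, Real.norm_eq_abs]
  exact sq_le_sq.1 (by nlinarith [hcon j, sq_nonneg (g' x j)])

lemma mdeg_homotopy {n : ℕ} {G : ℝ → (Fin n → ℝ) → Fin n → ℝ}
    (hG : Continuous fun p : ℝ × (Fin n → ℝ) => G p.1 p.2)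
    {X : Set (Fin n → ℝ)} (hX : Bornology.IsBounded X)
    (h : ∀ t ∈ Icc (0 : ℝ) 1, ∀ x ∈ frontier X, G t x ≠ 0) : mdeg (G 0) X = mdeg (G 1) X := by
  have hfc : IsCompact (frontier X) :=
    Metric.isCompact_of_isClosed_isBounded isClosed_frontier
      (hX.closure.subset frontier_subset_closure)
  have hGt : ∀ t, Continuous (G t) := fun t => hG.comp (by fun_prop : Continuous fun x => (t, x))
  have hloc : ∀ t ∈ Icc (0 : ℝ) 1, ∀ᶠ s in 𝓝 t, mdeg (G s) X = mdeg (G t) X := by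
    intro t ht
    have : ∀ᶠ s in 𝓝 t, ∀ x ∈ frontier X, ‖G t x - G s x‖ < ‖G t x‖ := by
      refine hfc.eventually_forall_of_forall_eventually fun x hx => ?_
      have hp : 0 < ‖G t x‖ := norm_pos_iff.2 (h t ht x hx)
      have hc1 : Continuous fun p : ℝ × (Fin n → ℝ) => G t p.2 := (hGt t).comp continuous_snd
      refine ContinuousAt.eventually_lt (f := fun p : ℝ × (Fin n → ℝ) => ‖G t p.2 - G p.1 p.2‖)
        (g := fun p => ‖G t p.2‖) ?_ ?_ ?_
      · exact (hc1.sub hG).norm.continuousAt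
      · exact hc1.norm.continuousAt
      · simpa using hp
    filter_upwards [this] with s hs
    exact (mdeg_rouche (hGt t) (hGt s) hX hs).symm
  exact eq_of_isPreconnected_of_locally isPreconnected_Icc (fun t => mdeg (G t) X)
    (fun t ht => eventually_nhdsWithin_of_eventually_nhds (hloc t ht))
    (left_mem_Icc.2 zero_le_one) (right_mem_Icc.2 zero_le_one)

lemma mdeg_additive {n : ℕ} {ι : Type*} {g : (Fin n → ℝ) → Fin n → ℝ} (hg : Continuous g)
    {X : Set (Fin n → ℝ)} (hX : Bornology.IsBounded X) (s : Finset ι) (Y : ι → Set (Fin n → ℝ))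
    (hY : ∀ a ∈ s, IsOpen (Y a)) (hsub : ∀ a ∈ s, Y a ⊆ X)
    (hdisj : (s : Set ι).PairwiseDisjoint Y)
    (h0 : ∀ x ∈ closure X, (∀ a ∈ s, x ∉ Y a) → g x ≠ 0) :
    mdeg g X = ∑ a ∈ s, mdeg g (Y a) := by
  classical
  have hmd : ∀ Z : Set (Fin n → ℝ), mdeg g Z = Germ.coeRingHom (R := ℤ) (atTop : Filter ℕ)
    (fun N => cupSum (posInd g) Z N) := fun Z => rfl
  simp only [hmd]
  rw [← map_sum]
  refine Germ.coe_eq.2 ?_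
  have hK : IsCompact (closure X \ ⋃ a ∈ s, Y a) :=
    (Metric.isCompact_of_isClosed_isBounded isClosed_closure hX.closure).diff
      (isOpen_biUnion hY)
  obtain ⟨δ, hδ, hball⟩ := exists_uniform_ball_subset hK
    (fun jc : Fin n × ℤ => {y | posInd g jc.1 y = jc.2}) (fun x hx => by
      have h1 : g x ≠ 0 := h0 x hx.1 fun a ha hxa => hx.2 (mem_biUnion ha hxa)
      obtain ⟨j, hj⟩ := Function.ne_iff.1 h1
      exact ⟨(j, _), posInd_eventually hg hj⟩)
  filter_upwards [exists_one_div_lt_of_pos hδ] with N ⟨hN, hNδ⟩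
  rw [Finset.sum_apply]
  simp only [cupSum]
  rw [← finsum_sum_comm]
  swap
  · intro a ha
    exact finite_support_cupSum (hX.subset (hsub a ha)) hN _ fun v hv => by simp [hv]
  refine finsum_congr fun v => ?_
  by_cases hv : latticePt N v ∈ X
  · by_cases hva : ∃ a ∈ s, latticePt N v ∈ Y a
    · obtain ⟨a, ha, hva⟩ := hva
      rw [if_pos hv, Finset.sum_eq_single_of_mem a ha, if_pos hva]
      intro b hb hba
      refine if_neg fun hvb => ?_
      exact Set.disjoint_left.1 (hdisj hb ha hba) hvb hva
    · push Not at hva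
      rw [if_pos hv, Finset.sum_eq_zero fun a ha => if_neg (hva a ha)]
      obtain ⟨⟨j, c⟩, hjc⟩ := hball (latticePt N v) ⟨subset_closure hv, by simpa using hva⟩
      refine simplexSum_eq_zero_of_forall fun ρ => cupTerm_eq_zero (j := j) (c := c) fun k => ?_
      exact hjc (mem_ball.2 ((dist_latticePt_latticeVertex N ρ v k).trans_lt hNδ))
  · rw [if_neg hv, Finset.sum_eq_zero fun a ha => if_neg fun h => hv (hsub a ha h)]

lemma mdeg_eq_zero {n : ℕ} {g : (Fin n → ℝ) → Fin n → ℝ} (hg : Continuous g)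
    {X : Set (Fin n → ℝ)} (hX : Bornology.IsBounded X) (h0 : ∀ x ∈ closure X, g x ≠ 0) :
    mdeg g X = 0 := by
  simpa using mdeg_additive hg hX (∅ : Finset ℕ) (fun _ => ∅) (by simp) (by simp) (by simp)
    (fun x hx _ => h0 x hx)

lemma mdeg_excision {n : ℕ} {g : (Fin n → ℝ) → Fin n → ℝ} (hg : Continuous g)
    {X Y : Set (Fin n → ℝ)} (hX : Bornology.IsBounded X) (hY : IsOpen Y) (hYX : Y ⊆ X)
    (h0 : ∀ x ∈ closure X, x ∉ Y → g x ≠ 0) : mdeg g X = mdeg g Y := by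
  simpa using mdeg_additive hg hX ({0} : Finset ℕ) (fun _ => Y) (by simp [hY]) (by simp [hYX])
    (by simp) (fun x hx h => h0 x hx (by simpa using h))

lemma mdeg_id_sub {n : ℕ} {X : Set (Fin n → ℝ)} (hX : IsOpen X) {y : Fin n → ℝ} (hy : y ∈ X) :
    mdeg (fun x => x - y) X = 1 := by
  classical
  change _ = ((fun _ => 1 : ℕ → ℤ) : Germ (atTop : Filter ℕ) ℤ)
  refine mdeg_eq_of_eventually ?_
  obtain ⟨δ, hδ, hball⟩ := Metric.isOpen_iff.1 hX y hy
  filter_upwards [exists_one_div_lt_of_pos hδ] with N ⟨hN, hNδ⟩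
  have hN0 : (0 : ℝ) < N := by positivity
  set w : Fin n → ℤ := fun a => ⌊N * y a⌋ with hw
  have hwX : latticePt N w ∈ X := by
    refine hball (mem_ball.2 (lt_of_le_of_lt ?_ hNδ))
    rw [dist_pi_le_iff (by positivity)]
    intro a
    rw [latticePt, Real.dist_eq, hw]
    have h1 := Int.floor_le (N * y a)
    have h2 := Int.lt_floor_add_one (N * y a)
    rw [show (⌊N * y a⌋ : ℝ) / N - y a = (⌊N * y a⌋ - N * y a) / N by field_simp, abs_div,
      Nat.abs_cast]
    gcongr
    rw [abs_le]; constructor <;> linarith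
  have hs : ∀ v, simplexSum (cupTerm N (posInd fun x => x - y)) v = if v = w then 1 else 0 := by
    intro v
    rw [simplexSum, Finset.sum_eq_single_of_mem 1 (Finset.mem_univ _)]
    · simp only [Equiv.Perm.sign_one, Units.val_one, one_mul, cupTerm]
      have h1 : ∀ j : Fin n, posInd (fun x => x - y) j (latticePt N (latticeVertex 1 v (j + 1))) -
          posInd (fun x => x - y) j (latticePt N (latticeVertex 1 v j)) =
          if v j = w j then 1 else 0 := by
        intro j
        simp only [posInd, Pi.sub_apply, latticePt, latticeVertex, Equiv.Perm.one_apply, hw]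
        simp only [lt_add_iff_pos_right, zero_lt_one, if_true, lt_irrefl, if_false, sub_pos,
          lt_div_iff₀ hN0, mul_comm (y j)]
        have hf := Int.floor_le (N * y j)
        have hf2 := Int.lt_floor_add_one (N * y j)
        rcases lt_trichotomy (v j) ⌊N * y j⌋ with h | h | h
        · have h3 : (v j : ℝ) + 1 ≤ ⌊N * y j⌋ := by exact_mod_cast h
          rw [if_neg, if_neg, if_neg h.ne]
          · simp
          · push_cast; linarith
          · push_cast; linarith
        · rw [if_pos, if_neg, if_pos h]
          · simp
          · rw [h]; push_cast; linarith
          · rw [h]; push_cast; linarith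
        · have h3 : (⌊N * y j⌋ : ℝ) + 1 ≤ v j := by exact_mod_cast h
          rw [if_pos, if_pos, if_neg h.ne']
          · simp
          · push_cast; linarith
          · push_cast; linarith
      rw [Finset.prod_congr rfl fun j _ => h1 j]
      by_cases hvw : v = w
      · simp [hvw]
      · obtain ⟨j, hj⟩ := Function.ne_iff.1 hvw
        rw [if_neg hvw]
        exact Finset.prod_eq_zero (Finset.mem_univ j) (if_neg hj)
    · intro ρ _ hρ
      obtain ⟨j, hj⟩ : ∃ j, ρ j ≠ j := by
        by_contra hcon
        push Not at hcon
        exact hρ (Equiv.ext hcon)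
      have hj' : (ρ j : ℕ) ≠ j := fun h => hj (Fin.ext h)
      rw [cupTerm, Finset.prod_eq_zero (Finset.mem_univ j), mul_zero]
      have : ((ρ j : ℕ) < j + 1) = ((ρ j : ℕ) < j) := by
        rw [eq_iff_iff]; omega
      simp [posInd, latticePt, latticeVertex, this]
  simp only [cupSum, hs]
  rw [finsum_eq_single _ w]
  · simp [hwX]
  · intro v hv
    simp [hv]

lemma cupTerm_flip {n : ℕ} (N : ℕ) (F F' : Fin n → (Fin n → ℝ) → ℤ) (e : Fin n → ℤ)
    (h : ∀ j x x', F' j x - F' j x' = e j * (F j x - F j x')) (P : ℕ → Fin n → ℤ) :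
    cupTerm N F' P = (∏ j, e j) * cupTerm N F P := by
  simp only [cupTerm, h, Finset.prod_mul_distrib]

lemma cupSum_flip {n : ℕ} (N : ℕ) (F F' : Fin n → (Fin n → ℝ) → ℤ) (e : Fin n → ℤ)
    (h : ∀ j x x', F' j x - F' j x' = e j * (F j x - F j x')) (X : Set (Fin n → ℝ)) :
    cupSum F' X N = (∏ j, e j) * cupSum F X N := by
  rw [cupSum, cupSum, ← smul_eq_mul, smul_finsum]
  refine finsum_congr fun v => ?_
  split_ifs
  · rw [simplexSum, simplexSum, smul_eq_mul, Finset.mul_sum]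
    refine Finset.sum_congr rfl fun ρ _ => ?_
    rw [cupTerm_flip N F F' e h]; ring
  · simp

lemma mdeg_diagonal {n : ℕ} (d : Fin n → ℝ) (hd : ∀ j, d j ≠ 0) :
    ∃ ε : ℤˣ, ∀ (g : (Fin n → ℝ) → Fin n → ℝ) (X : Set (Fin n → ℝ)), Continuous g →
      Bornology.IsBounded X → (∀ x ∈ frontier X, g x ≠ 0) →
      mdeg (fun x j => d j * g x j) X = ((ε : ℤ) : Germ (atTop : Filter ℕ) ℤ) * mdeg g X := by
  classical
  refine ⟨∏ j, if 0 < d j then 1 else -1, fun g X hg hX h0 => ?_⟩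
  set F' : Fin n → (Fin n → ℝ) → ℤ := fun j x => if 0 < d j then posInd g j x else
    1 - posInd g j x with hF'
  have h1 := cupSum_eventuallyEq (posInd fun x j => d j * g x j) F' hX (fun x hx => by
    obtain ⟨j, hj⟩ := Function.ne_iff.1 (h0 x hx)
    refine ⟨(j, F' j x), ?_⟩
    have hc : Continuous fun x (j : Fin n) => d j * g x j := by fun_prop
    have h2 := posInd_eventually hc (x := x) (j := j) (mul_ne_zero (hd j) hj)
    filter_upwards [h2, posInd_eventually hg hj] with y ha hb
    refine ⟨?_, by simp only [hF', hb]⟩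
    rw [ha]
    simp only [hF', posInd]
    rcases lt_or_gt_of_ne (hd j) with h3 | h3 <;> rcases lt_or_gt_of_ne hj with h4 | h4 <;>
      simp only [Pi.zero_apply] at h4
    · simp [mul_pos_of_neg_of_neg h3 h4, not_lt.2 h3.le, not_lt.2 h4.le]
    · simp [not_lt.2 (mul_neg_of_neg_of_pos h3 h4).le, not_lt.2 h3.le, h4]
    · simp [not_lt.2 (mul_neg_of_pos_of_neg h3 h4).le, h3, not_lt.2 h4.le]
    · simp [h3, h4])
  refine Germ.coe_eq.2 ?_
  filter_upwards [h1] with N hN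
  rw [hN, cupSum_flip N (posInd g) F' (fun j => if 0 < d j then 1 else -1)]
  · simp [apply_ite]
  · intro j x x'
    simp only [hF']
    split_ifs <;> ring

lemma mdeg_matrix {n : ℕ} (A : Matrix (Fin n) (Fin n) ℝ) (hA : A.det ≠ 0) :
    ∃ ε : ℤˣ, ∀ (g : (Fin n → ℝ) → Fin n → ℝ) (X : Set (Fin n → ℝ)), Continuous g →
      Bornology.IsBounded X → (∀ x ∈ frontier X, g x ≠ 0) →
      mdeg (fun x => A.mulVec (g x)) X = ((ε : ℤ) : Germ (atTop : Filter ℕ) ℤ) * mdeg g X := by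
  refine Matrix.diagonal_transvection_induction_of_det_ne_zero (fun A => ∃ ε : ℤˣ,
    ∀ (g : (Fin n → ℝ) → Fin n → ℝ) (X : Set (Fin n → ℝ)), Continuous g →
      Bornology.IsBounded X → (∀ x ∈ frontier X, g x ≠ 0) →
      mdeg (fun x => A.mulVec (g x)) X = ((ε : ℤ) : Germ (atTop : Filter ℕ) ℤ) * mdeg g X)
    A hA ?_ ?_ ?_
  · intro D hD
    have hD' : ∀ j, D j ≠ 0 := by
      rw [Matrix.det_diagonal] at hD
      exact fun j hj => hD (Finset.prod_eq_zero (Finset.mem_univ j) hj)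
    obtain ⟨ε, h⟩ := mdeg_diagonal D hD'
    refine ⟨ε, fun g X hg hX h0 => ?_⟩
    rw [← h g X hg hX h0]
    congr 1
    funext x j
    rw [Matrix.mulVec_diagonal]
  · intro t
    refine ⟨1, fun g X hg hX h0 => ?_⟩
    have h1 := mdeg_homotopy (G := fun s x => (Matrix.transvection t.i t.j (s * t.c)).mulVec (g x))
      (by
        have : ∀ s : ℝ, Matrix.transvection t.i t.j (s * t.c) =
            1 + s • Matrix.single t.i t.j t.c := fun s => by
          rw [Matrix.transvection, Matrix.smul_single, smul_eq_mul]
        simp only [this]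
        fun_prop) hX (fun s _ x hx h2 => h0 x hx (by
          by_contra h3
          have h4 := Matrix.exists_mulVec_eq_zero_iff.1 ⟨g x, h3, h2⟩
          rw [Matrix.det_transvection_of_ne _ _ t.hij] at h4
          exact one_ne_zero h4))
    simp only [zero_mul, Matrix.transvection_zero, Matrix.one_mulVec, one_mul] at h1
    simp only [Units.val_one, Int.cast_one, one_mul]
    exact h1.symm
  · intro A B _ hB' ihA ihB
    obtain ⟨ε₁, h1⟩ := ihA
    obtain ⟨ε₂, h2⟩ := ihB
    refine ⟨ε₁ * ε₂, fun g X hg hX h0 => ?_⟩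
    have h3 := h1 (fun x => B.mulVec (g x)) X (by fun_prop) hX (fun x hx h4 => h0 x hx (by
      by_contra h5
      exact hB' (Matrix.exists_mulVec_eq_zero_iff.1 ⟨g x, h5, h4⟩)))
    simp only [Matrix.mulVec_mulVec] at h3
    rw [h3, h2 g X hg hX h0]
    push_cast
    ring

lemma eventually_norm_sub_lt_of_det_ne_zero {n : ℕ} {k : (Fin n → ℝ) → Fin n → ℝ} {w : Fin n → ℝ}
    (hk : DifferentiableAt ℝ k w) (hdet : (fderiv ℝ k w).det ≠ 0) :
    ∃ A : Matrix (Fin n) (Fin n) ℝ, A.det ≠ 0 ∧ ∀ᶠ z in 𝓝 w, z ≠ w →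
      ‖A.mulVec (z - w) - (k z - k w)‖ < ‖A.mulVec (z - w)‖ := by
  set L := fderiv ℝ k w with hL
  set A := LinearMap.toMatrix' (L : (Fin n → ℝ) →ₗ[ℝ] (Fin n → ℝ)) with hA
  have hAdet : A.det ≠ 0 := by
    rw [hA, LinearMap.det_toMatrix']; exact hdet
  have hAv : ∀ u, A.mulVec u = L u := fun u => by
    rw [hA, LinearMap.toMatrix'_mulVec]; rfl
  refine ⟨A, hAdet, ?_⟩
  set B := LinearMap.toContinuousLinearMap (Matrix.mulVecLin A⁻¹) with hB
  have hBA : ∀ u, B (A.mulVec u) = u := fun u => by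
    change A⁻¹.mulVec (A.mulVec u) = u
    rw [Matrix.mulVec_mulVec, Matrix.nonsing_inv_mul _ (Ne.isUnit hAdet), Matrix.one_mulVec]
  have hbound : ∀ u, ‖u‖ ≤ (‖B‖ + 1) * ‖A.mulVec u‖ := fun u => by
    have h1 := B.le_opNorm (A.mulVec u)
    rw [hBA] at h1
    nlinarith [norm_nonneg (A.mulVec u)]
  have hpos : 0 < 1 / (2 * (‖B‖ + 1)) := by positivity
  have ho := (hk.hasFDerivAt.isLittleO).def hpos
  filter_upwards [ho] with z hz hzw
  rw [hAv, norm_sub_rev]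
  rw [← hL] at hz
  refine lt_of_le_of_lt hz ?_
  have h1 := hbound (z - w)
  rw [hAv] at h1
  have h2 : 0 < ‖z - w‖ := norm_pos_iff.2 (sub_ne_zero.2 hzw)
  have h3 : 0 < ‖L (z - w)‖ := by
    by_contra h4
    have h5 : ‖L (z - w)‖ = 0 := le_antisymm (not_lt.1 h4) (norm_nonneg _)
    rw [h5] at h1; linarith
  rw [div_mul_eq_mul_div, one_mul, div_lt_iff₀ (by positivity)]
  nlinarith [norm_nonneg B]

/-- A consequence of the product formula for the degree: if `k` is a left inverse of `f` on the
frontier of `X`, then `1` is a signed sum of degrees of `f` over points outside of the image of the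
frontier. -/
lemma one_eq_sum_mdeg {n : ℕ} {X : Set (Fin n → ℝ)} (hXo : IsOpen X)
    (hX : Bornology.IsBounded X) {f k : (Fin n → ℝ) → Fin n → ℝ} (hf : Continuous f)
    (hk : Continuous k) (hkf : ∀ x ∈ frontier X, k (f x) = x) (hne : X.Nonempty) :
    ∃ (s : Finset (Fin n → ℝ)) (ε : (Fin n → ℝ) → ℤˣ),
      (∀ w ∈ s, w ∈ f '' X ∧ w ∉ f '' frontier X) ∧
      1 = ∑ w ∈ s, (((ε w : ℤˣ) : ℤ) : Germ (atTop : Filter ℕ) ℤ) * mdeg (fun x => f x - w) X := by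
  classical
  obtain ⟨y₀, hy₀⟩ := hne
  obtain ⟨η, hη, hball⟩ := Metric.isOpen_iff.1 hXo y₀ hy₀
  obtain ⟨k', hk's, hk'a, -⟩ := hk.exists_contDiff_approx (n := 1) (ε := fun _ => η / 2)
    continuous_const (fun _ => half_pos hη)
  have hk'c : Continuous k' := hk's.continuous
  have hk'd : Differentiable ℝ k' := hk's.differentiable (by simp)
  set crit := {w | (fderiv ℝ k' w).det = 0} with hcrit
  have hnull : MeasureTheory.volume (k' '' crit) = 0 :=
    MeasureTheory.addHaar_image_eq_zero_of_det_fderivWithin_eq_zero MeasureTheory.volume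
      (fun x _ => (hk'd x).hasFDerivAt.hasFDerivWithinAt) (fun x hx => hx)
  obtain ⟨y₁, hy₁b, hy₁⟩ : ∃ y₁ ∈ ball y₀ (η / 2), y₁ ∉ k' '' crit := by
    by_contra hcon
    push Not at hcon
    have h1 := MeasureTheory.measure_mono_null hcon hnull
    exact (Metric.measure_ball_pos MeasureTheory.volume y₀ (half_pos hη)).ne' h1
  have hfr : ∀ x ∈ frontier X, η ≤ dist x y₀ := by
    intro x hx
    by_contra h
    rw [hXo.frontier_eq] at hx
    exact hx.2 (hball (mem_ball.2 (not_le.1 h)))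
  have hlt : ∀ x ∈ frontier X, ‖(x - y₁) - (k' (f x) - y₁)‖ < ‖x - y₁‖ := by
    intro x hx
    have h1 := hk'a (f x)
    rw [hkf x hx, dist_comm, dist_eq_norm] at h1
    rw [sub_sub_sub_cancel_right]
    have h2 := hfr x hx
    have h3 := dist_triangle x y₁ y₀
    rw [← dist_eq_norm x y₁]
    have := mem_ball.1 hy₁b
    linarith
  have hfr0 : ∀ x ∈ frontier X, k' (f x) ≠ y₁ := by
    intro x hx h
    have := hlt x hx
    simp [h] at this
  have hone : mdeg (fun x => k' (f x) - y₁) X = 1 := by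
    rw [← mdeg_rouche (g := fun x => x - y₁) (by fun_prop) (by fun_prop) hX hlt]
    exact mdeg_id_sub hXo (hball (ball_subset_ball (by linarith) hy₁b))
  have hcX : IsCompact (closure X) :=
    Metric.isCompact_of_isClosed_isBounded isClosed_closure hX.closure
  set Z := f '' closure X ∩ k' ⁻¹' {y₁} with hZ
  have hZc : IsCompact Z := (hcX.image hf).inter_right (isClosed_singleton.preimage hk'c)
  have hloc : ∀ w ∈ Z, ∃ A : Matrix (Fin n) (Fin n) ℝ, A.det ≠ 0 ∧ ∀ᶠ z in 𝓝 w, z ≠ w →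
      ‖A.mulVec (z - w) - (k' z - k' w)‖ < ‖A.mulVec (z - w)‖ := fun w hw =>
    eventually_norm_sub_lt_of_det_ne_zero (hk'd w) fun h => hy₁ ⟨w, h, hw.2⟩
  choose! A hA1 hA2 using hloc
  have hZfin : Z.Finite := by
    refine hZc.finite (isDiscrete_iff_forall_mem_exists_isOpen.2 fun w hw => ?_)
    obtain ⟨V, hV, hVo, hwV⟩ := _root_.eventually_nhds_iff.1 (hA2 w hw)
    refine ⟨V, hVo, ?_⟩
    ext z
    simp only [mem_inter_iff, mem_singleton_iff]
    refine ⟨fun ⟨hzV, hzZ⟩ => ?_, fun h => h ▸ ⟨hwV, hw⟩⟩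
    by_contra hzw
    have h1 := hV z hzV hzw
    rw [show k' z = y₁ from hzZ.2, show k' w = y₁ from hw.2, sub_self, sub_zero] at h1
    exact lt_irrefl _ h1
  set s := hZfin.toFinset with hs
  have hmem : ∀ w, w ∈ s ↔ w ∈ Z := fun w => hZfin.mem_toFinset
  have hZfr : ∀ w ∈ Z, w ∉ f '' frontier X := by
    rintro w hw ⟨x, hx, rfl⟩
    exact hfr0 x hx hw.2
  have hfrc : IsClosed (f '' frontier X) :=
    ((hcX.of_isClosed_subset isClosed_frontier frontier_subset_closure).image hf).isClosed
  have hZX : ∀ x ∈ closure X, f x ∈ Z → x ∈ X := by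
    intro x hx hxZ
    by_contra hxX
    exact hZfr _ hxZ ⟨x, by rw [hXo.frontier_eq]; exact ⟨hx, hxX⟩, rfl⟩
  obtain ⟨r₁, hr₁, hdisj⟩ : ∃ r > 0, (s : Set (Fin n → ℝ)).PairwiseDisjoint fun w => ball w r := by
    obtain ⟨V, hV, hVd⟩ := hZfin.t2_separation
    have h1 : ∀ w ∈ s, ∃ r > 0, ball w r ⊆ V w := fun w _ =>
      Metric.isOpen_iff.1 (hV w).2 w (hV w).1
    choose! r hr hrV using h1
    obtain ⟨r₀, hr₀, hr₀'⟩ : ∃ r₀ > 0, ∀ w ∈ s, r₀ ≤ r w := by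
      rcases s.eq_empty_or_nonempty with h | h
      · exact ⟨1, one_pos, by simp [h]⟩
      · obtain ⟨w, hw, hmin⟩ := s.exists_min_image r h
        exact ⟨r w, hr w hw, hmin⟩
    refine ⟨r₀, hr₀, fun a ha b hb hab => ?_⟩
    have := hVd ((hmem a).1 ha) ((hmem b).1 hb) hab
    exact this.mono ((ball_subset_ball (hr₀' a ha)).trans (hrV a ha))
      ((ball_subset_ball (hr₀' b hb)).trans (hrV b hb))
  have hr2 : ∃ r > 0, r ≤ r₁ ∧ ∀ w ∈ s, ∀ z ∈ closedBall w r, z ≠ w →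
      ‖(A w).mulVec (z - w) - (k' z - k' w)‖ < ‖(A w).mulVec (z - w)‖ := by
    have h1 : ∀ w ∈ s, ∃ r > 0, ∀ z ∈ ball w r, z ≠ w →
        ‖(A w).mulVec (z - w) - (k' z - k' w)‖ < ‖(A w).mulVec (z - w)‖ := fun w hw =>
      Metric.eventually_nhds_iff_ball.1 (hA2 w ((hmem w).1 hw))
    choose! r hr hrV using h1
    obtain ⟨r₀, hr₀, hr₀'⟩ : ∃ r₀ > 0, ∀ w ∈ s, r₀ ≤ r w := by
      rcases s.eq_empty_or_nonempty with h | h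
      · exact ⟨1, one_pos, by simp [h]⟩
      · obtain ⟨w, hw, hmin⟩ := s.exists_min_image r h
        exact ⟨r w, hr w hw, hmin⟩
    refine ⟨min (r₀ / 2) r₁, by positivity, min_le_right _ _, fun w hw z hz => hrV w hw z ?_⟩
    have h2 := min_le_left (r₀ / 2) r₁
    have h3 := hr₀' w hw
    rw [mem_closedBall] at hz
    rw [mem_ball]
    linarith
  obtain ⟨r, hr, hrr, hrA⟩ := hr2
  set Y : (Fin n → ℝ) → Set (Fin n → ℝ) := fun w => X ∩ f ⁻¹' ball w r with hY
  have hYo : ∀ w, IsOpen (Y w) := fun w => hXo.inter (isOpen_ball.preimage hf)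
  have hadd := mdeg_additive (g := fun x => k' (f x) - y₁) (by fun_prop) hX s Y (fun w _ => hYo w)
    (fun w _ => inter_subset_left) (fun a ha b hb hab => by
      refine Set.disjoint_left.2 fun x hxa hxb => ?_
      exact Set.disjoint_left.1 (hdisj ha hb hab) (ball_subset_ball hrr hxa.2)
        (ball_subset_ball hrr hxb.2))
    (fun x hx hxY h0 => by
      have hxZ : f x ∈ Z := ⟨⟨x, hx, rfl⟩, sub_eq_zero.1 h0⟩
      exact hxY (f x) ((hmem _).2 hxZ) ⟨hZX x hx hxZ, mem_ball_self hr⟩)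
  have hsgn := fun w (hw : w ∈ s) => mdeg_matrix (A w) (hA1 w ((hmem w).1 hw))
  choose! ε hε using hsgn
  refine ⟨s, ε, fun w hw => ⟨?_, hZfr w ((hmem w).1 hw)⟩, ?_⟩
  · obtain ⟨x, hx, rfl⟩ := ((hmem w).1 hw).1
    exact ⟨x, hZX x hx ((hmem _).1 hw), rfl⟩
  rw [← hone, hadd]
  refine Finset.sum_congr rfl fun w hw => ?_
  have hYb : Bornology.IsBounded (Y w) := hX.subset inter_subset_left
  have hfrY : ∀ x ∈ frontier (Y w), f x ≠ w ∧ f x ∈ closedBall w r := by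
    intro x hx
    rw [(hYo w).frontier_eq] at hx
    refine ⟨fun h => hx.2 ⟨?_, by simp [h, hr]⟩, ?_⟩
    · exact hZX x (closure_mono inter_subset_left hx.1) (h ▸ (hmem w).1 hw)
    · have h1 : closure (Y w) ⊆ f ⁻¹' closedBall w r :=
        closure_minimal (fun z hz => ball_subset_closedBall hz.2) (isClosed_closedBall.preimage hf)
      exact h1 hx.1
  have hkw : k' w = y₁ := ((hmem w).1 hw).2
  have e1 : mdeg (fun x => (A w).mulVec (f x - w)) (Y w) = mdeg (fun x => k' (f x) - y₁) (Y w) :=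
    mdeg_rouche (by fun_prop) (by fun_prop) hYb (fun x hx => by
      have := hrA w hw (f x) (hfrY x hx).2 (hfrY x hx).1
      rwa [hkw] at this)
  rw [← e1, hε w hw _ _ (by fun_prop) hYb (fun x hx => sub_ne_zero.2 (hfrY x hx).1)]
  congr 1
  refine (mdeg_excision (by fun_prop) hX (hYo w) inter_subset_left fun x hx hxY h => hxY ?_).symm
  have hfw : f x = w := sub_eq_zero.1 h
  exact ⟨hZX x hx (hfw ▸ (hmem w).1 hw), by simp [hfw, hr]⟩

lemma mdeg_congr_frontier {n : ℕ} {g g' : (Fin n → ℝ) → Fin n → ℝ} (hg : Continuous g)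
    (hg' : Continuous g') {X : Set (Fin n → ℝ)} (hX : Bornology.IsBounded X)
    (h : ∀ x ∈ frontier X, g x = g' x) (h0 : ∀ x ∈ frontier X, g x ≠ 0) :
    mdeg g X = mdeg g' X :=
  mdeg_rouche hg hg' hX fun x hx => by
    rw [h x hx, sub_self, norm_zero, norm_pos_iff, ← h x hx]; exact h0 x hx

lemma mdeg_sub_eq_of_joinedIn {n : ℕ} {f : (Fin n → ℝ) → Fin n → ℝ} (hf : Continuous f)
    {X : Set (Fin n → ℝ)} (hX : Bornology.IsBounded X) {O : Set (Fin n → ℝ)} {w w' : Fin n → ℝ}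
    (hO : ∀ x ∈ frontier X, f x ∉ O) (h : JoinedIn O w w') :
    mdeg (fun x => f x - w) X = mdeg (fun x => f x - w') X := by
  obtain ⟨γ, hγ⟩ := h
  have := mdeg_homotopy (G := fun t x => f x - γ.extend t)
    ((hf.comp continuous_snd).sub (γ.continuous_extend.comp continuous_fst)) hX
    (fun t ht x hx h => hO x hx (by
      rw [sub_eq_zero.1 h, γ.extend_apply ht]; exact hγ _))
  simpa using this

/-- A bounded complementary domain of a topologically embedded sphere in `ℝ^n`. -/
structure PlanarCube (n : ℕ) where
  e : sphere (0 : EuclideanSpace ℝ (Fin n)) 1 → Fin n → ℝ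
  U : Set (Fin n → ℝ)
  e_cont : Continuous e
  e_inj : Function.Injective e
  U_open : IsOpen U
  U_bdd : Bornology.IsBounded U
  U_conn : IsConnected U
  U_disj : Disjoint U (range e)
  U_frontier : frontier U ⊆ range e

instance {n : ℕ} : CompactSpace (sphere (0 : EuclideanSpace ℝ (Fin n)) 1) :=
  isCompact_iff_compactSpace.1 (isCompact_sphere _ _)

lemma exists_ext_sphere {n : ℕ} (e : sphere (0 : EuclideanSpace ℝ (Fin n)) 1 → Fin n → ℝ)
    (he : Continuous e) : ∃ l : EuclideanSpace ℝ (Fin n) → Fin n → ℝ, Continuous l ∧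
      ∀ x : sphere (0 : EuclideanSpace ℝ (Fin n)) 1, l x = e x := by
  obtain ⟨g, hg⟩ := ContinuousMap.exists_restrict_eq (isClosed_sphere (x := (0 : EuclideanSpace ℝ (Fin n))) (ε := 1)) ⟨e, he⟩
  exact ⟨g, g.continuous, fun x => by rw [← ContinuousMap.coe_mk e he, ← hg]; rfl⟩

lemma exists_left_inverse_ext {α β : Type*} [TopologicalSpace α] [CompactSpace α]
    [TopologicalSpace β] [T2Space β] [NormalSpace β] {n : ℕ} {e : α → β} (he : Continuous e)
    (hinj : Function.Injective e) {φ : α → Fin n → ℝ} (hφ : Continuous φ) :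
    ∃ k : β → Fin n → ℝ, Continuous k ∧ ∀ x, k (e x) = φ x := by
  obtain ⟨g, hg⟩ := ContinuousMap.exists_extension (he.isClosedEmbedding hinj)
    (⟨φ, hφ⟩ : C(α, Fin n → ℝ))
  exact ⟨g, g.continuous, fun x => congrArg (fun h => h x) hg⟩

/-- The complement of an embedded sphere has a point that cannot be joined to infinity. -/
lemma exists_not_joinedIn_far {n : ℕ} (e : sphere (0 : EuclideanSpace ℝ (Fin n)) 1 → Fin n → ℝ)
    (he : Continuous e) (hinj : Function.Injective e) :
    ∃ w ∉ range e, ∃ R : ℝ, ∀ w', R < ‖w'‖ → ¬ JoinedIn (range e)ᶜ w w' := by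
  obtain ⟨l, hl, hle⟩ := exists_ext_sphere e he
  set τ : (Fin n → ℝ) ≃ₜ EuclideanSpace ℝ (Fin n) :=
    (EuclideanSpace.equiv (Fin n) ℝ).symm.toHomeomorph with hτ
  obtain ⟨k, hk, hke⟩ := exists_left_inverse_ext he hinj
    (φ := fun x => τ.symm x) (by fun_prop)
  set B : Set (Fin n → ℝ) := τ ⁻¹' ball 0 1 with hB
  have hBo : IsOpen B := isOpen_ball.preimage τ.continuous
  have hBc : closure B = τ ⁻¹' closedBall 0 1 := by
    rw [hB, ← τ.preimage_closure, closure_ball _ one_ne_zero]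
  have hBcc : IsCompact (closure B) := by
    rw [hBc, ← τ.image_symm]
    exact (isCompact_closedBall _ _).image τ.symm.continuous
  have hBb : Bornology.IsBounded B := hBcc.isBounded.subset subset_closure
  have hBf : frontier B = τ ⁻¹' sphere 0 1 := by
    rw [hB, ← τ.preimage_frontier, frontier_ball _ one_ne_zero]
  have hne : B.Nonempty := ⟨τ.symm 0, by simp [hB]⟩
  set f : (Fin n → ℝ) → Fin n → ℝ := fun x => l (τ x) with hf
  have hfc : Continuous f := hl.comp τ.continuous
  have hfe : ∀ x ∈ frontier B, ∃ s, f x = e s ∧ τ.symm s = x := by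
    intro x hx
    rw [hBf] at hx
    exact ⟨⟨τ x, hx⟩, hle ⟨τ x, hx⟩, τ.symm_apply_apply x⟩
  have himg : f '' frontier B = range e := by
    ext y
    constructor
    · rintro ⟨x, hx, rfl⟩
      obtain ⟨s, hs, -⟩ := hfe x hx
      exact ⟨s, hs.symm⟩
    · rintro ⟨s, rfl⟩
      exact ⟨τ.symm s, by rw [hBf]; simp, by simp [hf, hle]⟩
  obtain ⟨s, ε, hs, hsum⟩ := one_eq_sum_mdeg hBo hBb hfc hk (fun x hx => by
    obtain ⟨s, h1, h2⟩ := hfe x hx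
    rw [h1, hke, h2]) hne
  obtain ⟨w, hw, hw0⟩ : ∃ w ∈ s, mdeg (fun x => f x - w) B ≠ 0 := by
    by_contra hcon
    push Not at hcon
    rw [Finset.sum_eq_zero fun w hw => by rw [hcon w hw, mul_zero]] at hsum
    exact one_ne_zero hsum
  obtain ⟨R, hR⟩ := (hBcc.image hfc).isBounded.exists_norm_le
  refine ⟨w, himg ▸ (hs w hw).2, R, fun w' hw' hj => hw0 ?_⟩
  rw [mdeg_sub_eq_of_joinedIn (O := (range e)ᶜ) hfc hBb
    (fun x hx h => h (by rw [← himg]; exact ⟨x, hx, rfl⟩)) hj]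
  refine mdeg_eq_zero (by fun_prop) hBb fun x hx h => ?_
  have := hR (f x) ⟨x, hx, rfl⟩
  rw [sub_eq_zero.1 h] at this
  linarith

namespace PlanarCube

variable {n : ℕ} (C : PlanarCube n)

lemma isCompact_range : IsCompact (range C.e) := _root_.isCompact_range C.e_cont

lemma closure_U_subset : closure C.U ⊆ range C.e ∪ C.U := by
  intro x hx
  by_cases h : x ∈ C.U
  · exact Or.inr h
  · exact Or.inl (C.U_frontier (by rw [C.U_open.frontier_eq]; exact ⟨hx, h⟩))

lemma not_mem_U {x : Fin n → ℝ} (hx : x ∈ range C.e) : x ∉ C.U :=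
  fun h => Set.disjoint_left.1 C.U_disj h hx

/-- The closed domain. -/
def K : Set (Fin n → ℝ) := range C.e ∪ C.U

lemma isCompact_K : IsCompact C.K := by
  have : C.K = range C.e ∪ closure C.U := by
    refine subset_antisymm (union_subset_union_right _ subset_closure) ?_
    exact union_subset subset_union_left C.closure_U_subset
  rw [this]
  exact C.isCompact_range.union
    (Metric.isCompact_of_isClosed_isBounded isClosed_closure C.U_bdd.closure)

lemma joinedIn_U {y y' : Fin n → ℝ} (hy : y ∈ C.U) (hy' : y' ∈ C.U) : JoinedIn C.U y y' :=
  (C.U_open.isConnected_iff_isPathConnected.1 C.U_conn).joinedIn y hy y' hy'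

end PlanarCube

/-- A relative map between planar cubes that is injective over the boundary. -/
structure IsRelMap {n : ℕ} (C D : PlanarCube n) (f : (Fin n → ℝ) → Fin n → ℝ) : Prop where
  cont : Continuous f
  mapsTo_U : ∀ x ∈ C.U, f x ∈ D.U
  image_bd : f '' range C.e = range D.e
  injOn_bd : InjOn f (range C.e)

namespace IsRelMap

variable {n : ℕ} {C D : PlanarCube n} {f : (Fin n → ℝ) → Fin n → ℝ}

lemma mapsTo_bd (hf : IsRelMap C D f) {x : Fin n → ℝ} (hx : x ∈ range C.e) : f x ∈ range D.e :=
  hf.image_bd ▸ ⟨x, hx, rfl⟩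

lemma not_mem_U_of_frontier (hf : IsRelMap C D f) : ∀ x ∈ frontier C.U, f x ∉ D.U :=
  fun _ hx => D.not_mem_U (hf.mapsTo_bd (C.U_frontier hx))

lemma mdeg_const (hf : IsRelMap C D f) {y y' : Fin n → ℝ} (hy : y ∈ D.U) (hy' : y' ∈ D.U) :
    mdeg (fun x => f x - y) C.U = mdeg (fun x => f x - y') C.U :=
  mdeg_sub_eq_of_joinedIn hf.cont C.U_bdd hf.not_mem_U_of_frontier (D.joinedIn_U hy hy')

lemma exists_mul_mdeg_eq_one (hf : IsRelMap C D f) {y : Fin n → ℝ} (hy : y ∈ D.U) :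
    ∃ s, s * mdeg (fun x => f x - y) C.U = 1 := by
  obtain ⟨k, hk, hke⟩ := exists_left_inverse_ext (hf.cont.comp C.e_cont)
    (fun a b h => C.e_inj (hf.injOn_bd ⟨a, rfl⟩ ⟨b, rfl⟩ h)) C.e_cont
  obtain ⟨s, ε, hs, hsum⟩ := one_eq_sum_mdeg C.U_open C.U_bdd hf.cont hk (fun x hx => by
    obtain ⟨a, rfl⟩ := C.U_frontier hx
    exact hke a) C.U_conn.nonempty
  refine ⟨∑ w ∈ s, (((ε w : ℤˣ) : ℤ) : Germ (atTop : Filter ℕ) ℤ), ?_⟩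
  rw [hsum, Finset.sum_mul]
  refine Finset.sum_congr rfl fun w hw => ?_
  obtain ⟨x, hx, rfl⟩ := (hs w hw).1
  rw [hf.mdeg_const hy (hf.mapsTo_U x hx)]

lemma exists_preimage (hf : IsRelMap C D f) {y : Fin n → ℝ} (hy : y ∈ D.U) :
    ∃ x ∈ C.U, f x = y := by
  by_contra hcon
  push Not at hcon
  obtain ⟨s, hs⟩ := hf.exists_mul_mdeg_eq_one hy
  rw [mdeg_eq_zero (by have := hf.cont; fun_prop) C.U_bdd, mul_zero] at hs
  · exact zero_ne_one hs
  · intro x hx h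
    have h1 : f x = y := sub_eq_zero.1 h
    by_cases hxU : x ∈ C.U
    · exact hcon x hxU h1
    · refine hf.not_mem_U_of_frontier x ?_ (h1 ▸ hy)
      rw [C.U_open.frontier_eq]; exact ⟨hx, hxU⟩

/-- Points mapped near a boundary point are near its preimage. -/
lemma exists_ball_preimage (hf : IsRelMap C D f) {x : Fin n → ℝ} (hx : x ∈ range C.e) {ε : ℝ}
    (hε : 0 < ε) : ∃ δ > 0, ∀ c ∈ C.K, f c ∈ ball (f x) δ → c ∈ ball x ε := by
  have hc : IsCompact (f '' (C.K \ ball x ε)) := (C.isCompact_K.diff isOpen_ball).image hf.cont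
  have hnot : f x ∉ f '' (C.K \ ball x ε) := by
    rintro ⟨c, ⟨hcK, hcb⟩, hcx⟩
    rcases hcK with hcK | hcK
    · have := hf.injOn_bd hcK hx hcx
      exact hcb (by rw [this]; exact mem_ball_self hε)
    · exact D.not_mem_U (hf.mapsTo_bd hx) (hcx ▸ hf.mapsTo_U c hcK)
  obtain ⟨δ, hδ, hb⟩ := Metric.isOpen_iff.1 hc.isClosed.isOpen_compl _ hnot
  refine ⟨δ, hδ, fun c hcK hcf => ?_⟩
  by_contra h
  exact hb hcf ⟨c, ⟨hcK, h⟩, rfl⟩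

end IsRelMap

lemma eq_of_smul_add_smul_neg {F : Type*} [NormedAddCommGroup F] [NormedSpace ℝ F] {x a : F}
    (hx : ‖x‖ = 1) (ha : ‖a‖ = 1) {u s : ℝ} (hu : u ∈ Icc (0 : ℝ) 1) (hs : 0 ≤ s)
    (h : u • x + (1 - u) • -a = s • a) : x = a := by
  have h1 : u • x = (s + (1 - u)) • a := by
    rw [add_smul, ← h, smul_neg]; abel
  have h2 : u = s + (1 - u) := by
    have := congrArg norm h1
    rwa [norm_smul, norm_smul, hx, ha, mul_one, mul_one, Real.norm_of_nonneg hu.1,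
      Real.norm_of_nonneg (by linarith [hu.2])] at this
  rw [← h2] at h1
  have h3 : u ≠ 0 := by
    rintro rfl
    linarith
  exact smul_right_injective F h3 h1

namespace PlanarCube

variable {n : ℕ}

/-- Off a small cap around `z`, the boundary sphere contracts inside itself away from `z`. -/
lemma exists_cap (C : PlanarCube n) {z : Fin n → ℝ} (hz : z ∈ range C.e) {R : ℝ} (hR : 0 < R) :
    ∃ (Δ Δ' : Set (Fin n → ℝ)) (c : ℝ × (Fin n → ℝ) → Fin n → ℝ) (a : Fin n → ℝ) (r : ℝ),
      IsCompact Δ ∧ IsCompact Δ' ∧ range C.e ⊆ Δ ∪ Δ' ∧ Δ ⊆ ball z R ∧ Δ' ⊆ range C.e ∧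
      Continuous c ∧ a ∈ range C.e ∧ 0 < r ∧ a ∉ ball z r ∧ (∀ x, c (1, x) = x) ∧
      (∀ x ∈ Δ', c (0, x) = a) ∧
      ∀ u ∈ Icc (0 : ℝ) 1, ∀ x ∈ Δ', c (u, x) ∈ range C.e ∧ c (u, x) ∉ ball z r := by
  obtain ⟨a₀, rfl⟩ := hz
  obtain ⟨l, hl, hle⟩ := exists_ext_sphere C.e C.e_cont
  obtain ⟨ρ, hρ, hρR⟩ := Metric.continuous_iff.1 C.e_cont a₀ R hR
  set T : Set (sphere (0 : EuclideanSpace ℝ (Fin n)) 1) := {x | ρ / 2 ≤ dist x a₀} with hT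
  have hTc : IsClosed T := isClosed_le continuous_const (by fun_prop)
  have hTc' : CompactSpace T := isCompact_iff_compactSpace.1 hTc.isCompact
  have hn1 : ∀ x : sphere (0 : EuclideanSpace ℝ (Fin n)) 1,
      ‖(x : EuclideanSpace ℝ (Fin n))‖ = 1 := fun x => by simp
  have hTa : ∀ x : T, (x : sphere (0 : EuclideanSpace ℝ (Fin n)) 1) ≠ a₀ := by
    rintro ⟨x, hx⟩ h
    have : ρ / 2 ≤ dist x a₀ := hx
    rw [show x = a₀ from h, dist_self] at this; linarith
  set p : I × T → EuclideanSpace ℝ (Fin n) :=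
    fun q => (q.1 : ℝ) • ((q.2 : sphere (0 : EuclideanSpace ℝ (Fin n)) 1) : EuclideanSpace ℝ (Fin n))
      + (1 - (q.1 : ℝ)) • -(a₀ : EuclideanSpace ℝ (Fin n)) with hp
  have hpc : Continuous p := by fun_prop
  have hps : ∀ q, ∀ s : ℝ, 0 ≤ s → p q ≠ s • (a₀ : EuclideanSpace ℝ (Fin n)) := fun q s hs h =>
    hTa q.2 (Subtype.ext (eq_of_smul_add_smul_neg (hn1 _) (hn1 _) q.1.2 hs h))
  have hp0 : ∀ q, p q ≠ 0 := fun q h => hps q 0 le_rfl (by rw [h, zero_smul])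
  have hN : ∀ q, ‖(‖p q‖⁻¹ • p q)‖ = 1 := fun q => by
    rw [norm_smul, norm_inv, norm_norm, inv_mul_cancel₀ (norm_ne_zero_iff.2 (hp0 q))]
  set N : I × T → sphere (0 : EuclideanSpace ℝ (Fin n)) 1 :=
    fun q => ⟨‖p q‖⁻¹ • p q, by rw [mem_sphere_zero_iff_norm]; exact hN q⟩ with hNd
  have hNc : Continuous N := by
    refine Continuous.subtype_mk ((hpc.norm.inv₀ fun q => norm_ne_zero_iff.2 (hp0 q)).smul hpc) _
  have hNa : ∀ q, N q ≠ a₀ := fun q h => by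
    refine hps q ‖p q‖ (norm_nonneg _) ?_
    have : ‖p q‖⁻¹ • p q = a₀ := congrArg Subtype.val h
    rw [← this, smul_smul, mul_inv_cancel₀ (norm_ne_zero_iff.2 (hp0 q)), one_smul]
  have hN1 : ∀ x : T, N (1, x) = x := fun x => by
    apply Subtype.ext
    simp [hNd, hp]
  set na : sphere (0 : EuclideanSpace ℝ (Fin n)) 1 := ⟨-a₀, by simp⟩ with hna
  have hN0 : ∀ x : T, N (0, x) = na := fun x => by
    apply Subtype.ext
    simp [hNd, hp, hna]
  have hnaa : na ≠ a₀ := fun h => by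
    have h1 : -(a₀ : EuclideanSpace ℝ (Fin n)) = a₀ := congrArg Subtype.val h
    have h2 := hn1 a₀
    have h3 : (a₀ : EuclideanSpace ℝ (Fin n)) = 0 := by
      have h4 : (2 : ℝ) • (a₀ : EuclideanSpace ℝ (Fin n)) = 0 := by
        rw [two_smul]; nth_rewrite 1 [← h1]; exact neg_add_cancel _
      exact (smul_eq_zero.1 h4).resolve_left two_ne_zero
    rw [h3, norm_zero] at h2
    exact zero_ne_one h2
  obtain ⟨k, hk, hke⟩ := exists_left_inverse_ext (α := I × T) (β := ℝ × (Fin n → ℝ))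
    (e := fun q => ((q.1 : ℝ), C.e q.2)) (by have := C.e_cont; fun_prop)
    (fun q q' h => by
      simp only [Prod.mk.injEq] at h
      exact Prod.ext (Subtype.ext h.1) (Subtype.ext (C.e_inj h.2)))
    (φ := fun q => C.e (N q) - C.e q.2) (by have := C.e_cont; fun_prop)
  have hce : ∀ (u : I) (x : T), C.e x + k (u, C.e x) - k (1, C.e x) = C.e (N (u, x)) := by
    intro u x
    have h1 := hke (u, x)
    have h2 := hke (1, x)
    simp only [Icc.coe_one] at h1 h2
    rw [h1, h2, hN1]
    abel
  have hcomp : IsCompact (insert (C.e na) (range fun q => C.e (N q))) :=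
    (_root_.isCompact_range (C.e_cont.comp hNc)).insert _
  have hznot : C.e a₀ ∉ insert (C.e na) (range fun q => C.e (N q)) := by
    rintro (h | ⟨q, h⟩)
    · exact hnaa (C.e_inj h).symm
    · exact hNa q (C.e_inj h)
  obtain ⟨r, hr, hrb⟩ := Metric.isOpen_iff.1 hcomp.isClosed.isOpen_compl _ hznot
  refine ⟨C.e '' {x | dist x a₀ ≤ ρ / 2}, C.e '' T, fun q => q.2 + k q - k (1, q.2), C.e na, r,
    ?_, hTc.isCompact.image C.e_cont, ?_, ?_, image_subset_range _ _, by fun_prop, ⟨_, rfl⟩, hr,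
    fun h => hrb h (mem_insert _ _), fun x => by simp, ?_, ?_⟩
  · exact (IsClosed.isCompact (isClosed_le (by fun_prop) continuous_const)).image C.e_cont
  · rintro _ ⟨x, rfl⟩
    rcases le_total (dist x a₀) (ρ / 2) with h | h
    · exact Or.inl ⟨x, h, rfl⟩
    · exact Or.inr ⟨x, h, rfl⟩
  · rintro _ ⟨x, hx, rfl⟩
    exact hρR x (by have : dist x a₀ ≤ ρ / 2 := hx; linarith)
  · rintro _ ⟨x, hx, rfl⟩
    have := hce 0 ⟨x, hx⟩
    rw [hN0] at this
    simpa using this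
  · rintro u hu _ ⟨x, hx, rfl⟩
    have := hce ⟨u, hu⟩ ⟨x, hx⟩
    simp only at this ⊢
    rw [this]
    exact ⟨⟨_, rfl⟩, fun h => hrb h (Or.inr ⟨_, rfl⟩)⟩

end PlanarCube

lemma JoinedIn.exists_contDiff {n : ℕ} {O : Set (Fin n → ℝ)} (hO : IsOpen O) {y y' : Fin n → ℝ}
    (h : JoinedIn O y y') : ∃ γ : ℝ → Fin n → ℝ, ContDiff ℝ 1 γ ∧ γ 0 = y ∧ γ 1 = y' ∧
      ∀ t ∈ Icc (0 : ℝ) 1, γ t ∈ O := by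
  obtain ⟨γ, hγ⟩ := h
  obtain ⟨ε, hε, hb⟩ := (isCompact_range γ.continuous).exists_thickening_subset_open hO
    (by rintro _ ⟨t, rfl⟩; exact hγ t)
  obtain ⟨g, hg, hga, -⟩ := γ.continuous_extend.exists_contDiff_approx 1 (ε := fun _ => ε / 3)
    continuous_const (fun _ => by positivity)
  refine ⟨fun t => g t + ((1 - t) • (y - g 0) + t • (y' - g 1)), ?_, by simp, by simp, ?_⟩
  · have : ContDiff ℝ 1 g := by exact_mod_cast hg
    fun_prop
  · intro t ht
    refine hb (Metric.mem_thickening_iff.2 ⟨γ ⟨t, ht⟩, ⟨_, rfl⟩, ?_⟩)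
    have h0 := hga 0
    have h1 := hga 1
    have ht' := hga t
    rw [γ.extend_zero, dist_comm, dist_eq_norm] at h0
    rw [γ.extend_one, dist_comm, dist_eq_norm] at h1
    rw [γ.extend_apply ht, dist_eq_norm] at ht'
    rw [dist_eq_norm]
    calc ‖g t + ((1 - t) • (y - g 0) + t • (y' - g 1)) - γ ⟨t, ht⟩‖
        = ‖(g t - γ ⟨t, ht⟩) + ((1 - t) • (y - g 0) + t • (y' - g 1))‖ := by congr 1; abel
      _ ≤ ‖g t - γ ⟨t, ht⟩‖ + (‖(1 - t) • (y - g 0)‖ + ‖t • (y' - g 1)‖) :=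
        (norm_add_le _ _).trans (by gcongr; exact norm_add_le _ _)
      _ < ε := by
        rw [norm_smul, norm_smul, Real.norm_of_nonneg ht.1,
          Real.norm_of_nonneg (by linarith [ht.2])]
        nlinarith [ht.1, ht.2, norm_nonneg (y - g 0), norm_nonneg (y' - g 1)]

/-- A ray direction avoiding the convex combinations of two smooth paths. -/
lemma exists_ray_avoiding {n : ℕ} (hn : 3 < n) {γ₁ γ₂ : ℝ → Fin n → ℝ} (h₁ : ContDiff ℝ 1 γ₁)
    (h₂ : ContDiff ℝ 1 γ₂) (a : Fin n → ℝ) :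
    ∃ v : Fin n → ℝ, ∀ s : ℝ, 0 < s → ∀ t w : ℝ, a + s • v ≠ (1 - w) • γ₁ t + w • γ₂ t := by
  have hg : ContDiff ℝ 1 (fun p : ℝ × ℝ × ℝ =>
      p.1 • ((1 - p.2.2) • γ₁ p.2.1 + p.2.2 • γ₂ p.2.1 - a)) := by fun_prop
  obtain ⟨v, hv⟩ := (hg.dense_compl_range_of_finrank_lt_finrank (by simp; omega)).nonempty
  refine ⟨v, fun s hs t w h => hv ⟨(s⁻¹, t, w), ?_⟩⟩
  simp only
  rw [← h, add_sub_cancel_left, smul_smul, inv_mul_cancel₀ hs.ne', one_smul]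

namespace PlanarCube

variable {n : ℕ}

lemma subset_closure_U (C : PlanarCube n) : range C.e ⊆ closure C.U := by
  intro z hz
  by_contra hcl
  obtain ⟨R, hR, hRb⟩ := Metric.isOpen_iff.1 isClosed_closure.isOpen_compl z hcl
  obtain ⟨Δ, Δ', c, a, r, -, -, hΔ, hΔR, hΔ', hc, ha, hr, -, hc1, hc0, hcu⟩ := C.exists_cap hz hR
  obtain ⟨u₀, hu₀⟩ := C.U_conn.nonempty
  have hfr : ∀ x ∈ frontier C.U, x ∈ Δ' := fun x hx =>
    (hΔ (C.U_frontier hx)).resolve_left fun h => hRb (hΔR h) (frontier_subset_closure hx)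
  have h1 := mdeg_homotopy (G := fun t x => c (t, x) - u₀) (by fun_prop) C.U_bdd
    (fun t ht x hx h => C.not_mem_U (hcu t ht x (hfr x hx)).1 (by rwa [sub_eq_zero.1 h]))
  have hau : a - u₀ ≠ 0 := fun h => C.not_mem_U ha (by rwa [sub_eq_zero.1 h])
  rw [mdeg_congr_frontier (g' := fun _ => a - u₀) (by fun_prop) (by fun_prop) C.U_bdd
    (fun x hx => by rw [hc0 x (hfr x hx)]) (fun x hx => by rwa [hc0 x (hfr x hx)]),
    mdeg_eq_zero (by fun_prop) C.U_bdd (fun _ _ => hau)] at h1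
  simp only [hc1] at h1
  rw [mdeg_id_sub C.U_open hu₀] at h1
  exact zero_ne_one h1

end PlanarCube

/-- A continuous clamp of the real line to `[0,1]`. -/
def clamp (x : ℝ) : ℝ := max 0 (min 1 x)

lemma continuous_clamp : Continuous clamp := by unfold clamp; fun_prop

@[fun_prop] lemma Continuous.clamp {α : Type*} [TopologicalSpace α] {f : α → ℝ}
    (hf : Continuous f) : Continuous fun x => _root_.clamp (f x) := continuous_clamp.comp hf

lemma clamp_mem (x : ℝ) : clamp x ∈ Icc (0 : ℝ) 1 :=
  ⟨le_max_left _ _, max_le zero_le_one (min_le_left _ _)⟩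

lemma clamp_of_le {x : ℝ} (h : x ≤ 0) : clamp x = 0 := by
  unfold clamp; rw [min_eq_right (by linarith), max_eq_left h]

lemma clamp_of_ge {x : ℝ} (h : 1 ≤ x) : clamp x = 1 := by
  unfold clamp; rw [min_eq_left h, max_eq_right zero_le_one]

lemma clamp_of_mem {x : ℝ} (h : x ∈ Icc (0 : ℝ) 1) : clamp x = x := by
  unfold clamp; rw [min_eq_right h.2, max_eq_right h.1]

lemma frontier_connectedComponentIn_subset {α : Type*} [TopologicalSpace α]
    [LocallyConnectedSpace α] {F : Set α} (hF : IsOpen F) (y : α) :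
    frontier (connectedComponentIn F y) ⊆ closure F \ F := by
  intro x hx
  rw [hF.connectedComponentIn.frontier_eq] at hx
  refine ⟨closure_mono (connectedComponentIn_subset F y) hx.1, fun hxF => hx.2 ?_⟩
  obtain ⟨w, hw1, hw2⟩ := mem_closure_iff.1 hx.1 _ (hF.connectedComponentIn (x := x))
    (mem_connectedComponentIn hxF)
  rw [connectedComponentIn_eq hw2, ← connectedComponentIn_eq hw1]
  exact mem_connectedComponentIn hxF

namespace PlanarCube

variable {n : ℕ}

lemma locallyConnected_aux (C : PlanarCube n) (hn : 3 < n) {z : Fin n → ℝ} (hz : z ∈ range C.e)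
    {R : ℝ} (hR : 0 < R) :
    ∃ r > 0, ∀ y₁ ∈ C.U ∩ ball z r, ∀ y₂ ∈ C.U ∩ ball z r,
      y₂ ∈ connectedComponentIn (C.U ∩ ball z R) y₁ := by
  obtain ⟨Δ, Δ', c, a, r₀, hΔc, hΔ'c, hΔ, hΔR, hΔ', hc, ha, hr, har, hc1, hc0, hcu⟩ :=
    C.exists_cap hz hR
  refine ⟨min r₀ R, lt_min hr hR, fun y₁ hy₁ y₂ hy₂ => ?_⟩
  set r := min r₀ R with hrd
  have hcu' : ∀ u ∈ Icc (0 : ℝ) 1, ∀ x ∈ Δ', c (u, x) ∉ ball z r := fun u hu x hx h =>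
    (hcu u hu x hx).2 (ball_subset_ball (min_le_left _ _) h)
  have hrR : ball z r ⊆ ball z R := ball_subset_ball (min_le_right _ _)
  by_contra hnot
  set V := connectedComponentIn (C.U ∩ ball z R) y₁ with hV
  have hUo : IsOpen (C.U ∩ ball z R) := C.U_open.inter isOpen_ball
  have hVo : IsOpen V := hUo.connectedComponentIn
  have hVb : Bornology.IsBounded V :=
    C.U_bdd.subset ((connectedComponentIn_subset _ _).trans inter_subset_left)
  have hy₁V : y₁ ∈ V := mem_connectedComponentIn ⟨hy₁.1, hrR hy₁.2⟩
  have hfr0 : ∀ x ∈ frontier V, x ∉ C.U ∩ ball z R :=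
    fun x hx => (frontier_connectedComponentIn_subset hUo y₁ hx).2
  have hfr : ∀ x ∈ frontier V, x ∈ range C.e ∨ x ∈ sphere z R := by
    intro x hx
    obtain ⟨h1, h2⟩ := frontier_connectedComponentIn_subset hUo y₁ hx
    rcases C.closure_U_subset (closure_mono inter_subset_left h1) with h | h
    · exact Or.inl h
    · right
      have h3 : x ∈ closedBall z R := closure_ball_subset_closedBall
        (closure_mono inter_subset_right h1)
      have h4 : x ∉ ball z R := fun h4 => h2 ⟨h, h4⟩
      rw [mem_closedBall] at h3
      rw [mem_ball, not_lt] at h4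
      exact le_antisymm h3 h4
  have hy₁f : ∀ x ∈ frontier V, x - y₁ ≠ 0 := fun x hx h =>
    hfr0 x hx (by rw [sub_eq_zero.1 h]; exact ⟨hy₁.1, hrR hy₁.2⟩)
  have hy₂f : ∀ x ∈ frontier V, x - y₂ ≠ 0 := fun x hx h =>
    hfr0 x hx (by rw [sub_eq_zero.1 h]; exact ⟨hy₂.1, hrR hy₂.2⟩)
  obtain ⟨γ₁, hγ₁, hγ₁0, hγ₁1, hγ₁U⟩ := (C.joinedIn_U hy₁.1 hy₂.1).exists_contDiff C.U_open
  set γ₂ : ℝ → Fin n → ℝ := fun t => y₁ + t • (y₂ - y₁) with hγ₂d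
  have hγ₂ : ContDiff ℝ 1 γ₂ := by fun_prop
  have hγ₂0 : γ₂ 0 = y₁ := by simp [hγ₂d]
  have hγ₂1 : γ₂ 1 = y₂ := by simp [hγ₂d]
  have hγ₂b : ∀ t ∈ Icc (0 : ℝ) 1, γ₂ t ∈ ball z r := fun t ht =>
    (convex_ball z r).add_smul_sub_mem hy₁.2 hy₂.2 ht
  obtain ⟨v, hv⟩ := exists_ray_avoiding hn hγ₁ hγ₂ a
  have hγ₁c := hγ₁.continuous
  have hγ₂c := hγ₂.continuous
  obtain ⟨θ, hθ0, hθ1, hθ⟩ := exists_continuous_zero_one_of_isClosed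
    (isClosed_sphere (x := z) (ε := R)) hΔc.isClosed
    (Set.disjoint_left.2 fun x hx hxΔ => by
      have := hΔR hxΔ
      rw [mem_sphere] at hx
      rw [mem_ball] at this
      linarith)
  have hθc := θ.continuous
  set q : (Fin n → ℝ) → ℝ := fun x => clamp (3 * θ x - 1) with hq
  have hqc : Continuous q := by fun_prop
  set u : ℝ → (Fin n → ℝ) → ℝ := fun w x => max w (max (1 - 6 * θ x) (6 * θ x - 5)) with hu
  set c' : ℝ × (Fin n → ℝ) → Fin n → ℝ := fun p => c (max p.1 0, p.2) + max (-p.1) 0 • v with hc'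
  have hc'c : Continuous c' := by fun_prop
  have hc'pos : ∀ s x, 0 ≤ s → c' (s, x) = c (s, x) := fun s x hs => by
    simp only [hc']
    rw [max_eq_left hs, max_eq_right (by linarith), zero_smul, add_zero]
  have hq0 : ∀ x, θ x ≤ 1 / 3 → q x = 0 := fun x hx => clamp_of_le (by linarith)
  have hq1 : ∀ x, 2 / 3 ≤ θ x → q x = 1 := fun x hx => clamp_of_ge (by linarith)
  have hqm : ∀ x, q x ∈ Icc (0 : ℝ) 1 := fun x => clamp_mem _
  have hu1 : ∀ x, u 1 x = 1 := fun x =>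
    max_eq_left (max_le (by linarith [(hθ x).1]) (by linarith [(hθ x).2]))
  have hule : ∀ w ≤ 1, ∀ x, u w x ≤ 1 := fun w hw x =>
    max_le hw (max_le (by linarith [(hθ x).1]) (by linarith [(hθ x).2]))
  have hcase : ∀ x ∈ frontier V, (θ x = 0) ∨ (θ x = 1 ∧ x ∈ range C.e) ∨
      (0 < θ x ∧ x ∈ Δ' ∧ x ∈ range C.e) := by
    intro x hx
    rcases hfr x hx with h | h
    · rcases hΔ h with h2 | h2
      · exact Or.inr (Or.inl ⟨hθ1 h2, h⟩)
      · rcases (hθ x).1.eq_or_lt with h3 | h3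
        · exact Or.inl h3.symm
        · exact Or.inr (Or.inr ⟨h3, h2, h⟩)
    · exact Or.inl (hθ0 h)
  have key : ∀ w ∈ Icc (-1 : ℝ) 1, ∀ μ ∈ Icc (0 : ℝ) 1, (μ = 0 ∨ μ = 1 ∨ w = -1) →
      ∀ x ∈ frontier V, c' (u w x, x) - ((1 - μ) • γ₁ (q x) + μ • γ₂ (q x)) ≠ 0 := by
    intro w hw μ hμ hcond x hx h
    rw [sub_eq_zero] at h
    have hend1 : q x = 0 → (1 - μ) • γ₁ (q x) + μ • γ₂ (q x) = y₁ := fun h0 => by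
      rw [h0, hγ₁0, hγ₂0, ← add_smul]; simp
    have hend2 : q x = 1 → (1 - μ) • γ₁ (q x) + μ • γ₂ (q x) = y₂ := fun h0 => by
      rw [h0, hγ₁1, hγ₂1, ← add_smul]; simp
    rcases hcase x hx with h0 | ⟨h0, hxe⟩ | ⟨h0, hxΔ, hxe⟩
    · have hu0 : u w x = 1 := by
        simp only [hu, h0]
        norm_num
        exact hw.2
      rw [hu0, hc'pos _ _ zero_le_one, hc1, hend1 (hq0 x (by rw [h0]; norm_num))] at h
      exact hy₁f x hx (sub_eq_zero.2 h)
    · have hu0 : u w x = 1 := by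
        simp only [hu, h0]
        norm_num
        exact hw.2
      rw [hu0, hc'pos _ _ zero_le_one, hc1, hend2 (hq1 x (by rw [h0]; norm_num))] at h
      exact hy₂f x hx (sub_eq_zero.2 h)
    · rcases lt_or_ge (u w x) 0 with hneg | hpos
      · have : c' (u w x, x) = a + (-(u w x)) • v := by
          simp only [hc']
          rw [max_eq_right hneg.le, max_eq_left (by linarith), hc0 x hxΔ]
        rw [this] at h
        exact hv _ (by linarith) _ _ h
      · rw [hc'pos _ _ hpos] at h
        have hum : u w x ∈ Icc (0 : ℝ) 1 := ⟨hpos, hule w hw.2 x⟩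
        have hce := (hcu _ hum x hxΔ).1
        rw [h] at hce
        have hcb := hcu' _ hum x hxΔ
        rw [h] at hcb
        rcases hcond with rfl | rfl | rfl
        · refine C.not_mem_U hce ?_
          simpa using hγ₁U _ (hqm x)
        · refine hcb ?_
          simpa using hγ₂b _ (hqm x)
        · have : 0 ≤ 1 - 6 * θ x ∨ 0 ≤ 6 * θ x - 5 := by
            by_contra hcon
            push Not at hcon
            have : u (-1) x < 0 := max_lt (by norm_num) (max_lt hcon.1 hcon.2)
            linarith
          rcases this with h1 | h1
          · rw [hend1 (hq0 x (by linarith))] at hce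
            exact C.not_mem_U hce hy₁.1
          · rw [hend2 (hq1 x (by linarith))] at hce
            exact C.not_mem_U hce hy₂.1
  have e0 := mdeg_homotopy (G := fun s x => x - γ₁ (s * q x)) (by fun_prop) hVb
    (fun s hs x hx h => by
      have hsq : s * q x ∈ Icc (0 : ℝ) 1 :=
        ⟨mul_nonneg hs.1 (hqm x).1, mul_le_one₀ hs.2 (hqm x).1 (hqm x).2⟩
      rcases hcase x hx with h0 | ⟨h0, hxe⟩ | ⟨h0, hxΔ, hxe⟩
      · rw [hq0 x (by rw [h0]; norm_num), mul_zero, hγ₁0] at h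
        exact hy₁f x hx h
      · exact C.not_mem_U hxe (by rw [sub_eq_zero.1 h]; exact hγ₁U _ hsq)
      · exact C.not_mem_U hxe (by rw [sub_eq_zero.1 h]; exact hγ₁U _ hsq))
  have e2 := mdeg_homotopy (G := fun s x => c' (u (1 - 2 * s) x, x) -
      ((1 - (0 : ℝ)) • γ₁ (q x) + (0 : ℝ) • γ₂ (q x))) (by fun_prop) hVb
    (fun s hs x hx => key _ ⟨by linarith [hs.2], by linarith [hs.1]⟩ 0 (by simp) (Or.inl rfl) x hx)
  have e3 := mdeg_homotopy (G := fun s x => c' (u (-1) x, x) -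
      ((1 - s) • γ₁ (q x) + s • γ₂ (q x))) (by fun_prop) hVb
    (fun s hs x hx => key _ (by norm_num) s hs (Or.inr (Or.inr rfl)) x hx)
  have e4 := mdeg_homotopy (G := fun s x => c' (u (-1 + 2 * s) x, x) -
      ((1 - (1 : ℝ)) • γ₁ (q x) + (1 : ℝ) • γ₂ (q x))) (by fun_prop) hVb
    (fun s hs x hx => key _ ⟨by linarith [hs.1], by linarith [hs.2]⟩ 1 (by simp)
      (Or.inr (Or.inl rfl)) x hx)
  have e5 := mdeg_homotopy (G := fun s x => x - γ₂ (q x + s * (1 - q x))) (by fun_prop) hVb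
    (fun s hs x hx h => by
      have hsq : q x + s * (1 - q x) ∈ Icc (0 : ℝ) 1 := by
        have := hqm x
        constructor <;> nlinarith [hs.1, hs.2, this.1, this.2]
      rcases hcase x hx with h0 | ⟨h0, hxe⟩ | ⟨h0, hxΔ, hxe⟩
      · rcases hfr x hx with hxe | hxs
        · rcases hΔ hxe with h2 | h2
          · have h3 := hθ1 h2
            simp only [Pi.one_apply] at h3
            rw [h0] at h3
            exact zero_ne_one h3
          · have := hcu' 1 (by simp) x h2
            rw [hc1, sub_eq_zero.1 h] at this
            exact this (hγ₂b _ hsq)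
        · have := hrR (hγ₂b _ hsq)
          rw [← sub_eq_zero.1 h, mem_ball, mem_sphere.1 hxs] at this
          exact lt_irrefl _ this
      · rw [hq1 x (by rw [h0]; norm_num)] at h
        simp only [sub_self, mul_zero, add_zero, hγ₂1] at h
        exact hy₂f x hx h
      · have := hcu' 1 (by simp) x hxΔ
        rw [hc1, sub_eq_zero.1 h] at this
        exact this (hγ₂b _ hsq))
  simp only [zero_mul, one_mul, hγ₁0, mul_zero, sub_zero, mul_one, one_smul, zero_smul, add_zero,
    sub_self, zero_add, hu1, hc'pos 1 _ zero_le_one, hc1, add_sub_cancel, hγ₂1] at e0 e2 e3 e4 e5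
  norm_num at e2 e4
  simp only [hu1, hc'pos 1 _ zero_le_one, hc1] at e4
  have e : mdeg (fun x => x - y₁) V = mdeg (fun x => x - y₂) V :=
    e0.trans (e2.trans (e3.trans (e4.trans e5)))
  rw [mdeg_id_sub hVo hy₁V, mdeg_eq_zero (by fun_prop) hVb] at e
  · exact one_ne_zero e
  · intro x hx h
    by_cases hxV : x ∈ V
    · exact hnot (sub_eq_zero.1 h ▸ hxV)
    · exact hy₂f x (by rw [hVo.frontier_eq]; exact ⟨hx, hxV⟩) h

/-- The domain is locally `0`-connected at its boundary points. -/
lemma exists_joinedIn_ball (C : PlanarCube n) (hn : 3 < n) {z : Fin n → ℝ} (hz : z ∈ range C.e)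
    {R : ℝ} (hR : 0 < R) :
    ∃ r > 0, ∀ y₁ ∈ C.U ∩ ball z r, ∀ y₂ ∈ C.U ∩ ball z r,
      JoinedIn (C.U ∩ ball z R) y₁ y₂ := by
  obtain ⟨r, hr, h⟩ := C.locallyConnected_aux hn hz hR
  refine ⟨min r R, lt_min hr hR, fun y₁ hy₁ y₂ hy₂ => ?_⟩
  have hUo : IsOpen (C.U ∩ ball z R) := C.U_open.inter isOpen_ball
  have hy₁' : y₁ ∈ C.U ∩ ball z R := ⟨hy₁.1, ball_subset_ball (min_le_right _ _) hy₁.2⟩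
  have h2 := h y₁ ⟨hy₁.1, ball_subset_ball (min_le_left _ _) hy₁.2⟩ y₂
    ⟨hy₂.1, ball_subset_ball (min_le_left _ _) hy₂.2⟩
  have hconn : IsConnected (connectedComponentIn (C.U ∩ ball z R) y₁) :=
    isConnected_connectedComponentIn_iff.2 hy₁'
  exact ((hUo.connectedComponentIn.isConnected_iff_isPathConnected.1 hconn).joinedIn y₁
    (mem_connectedComponentIn hy₁') y₂ h2).mono (connectedComponentIn_subset _ _)

end PlanarCube

/-- `X` isolates `A` from `B` inside `O`. -/
structure Isolates {α : Type*} [TopologicalSpace α] (O A B X : Set α) : Prop where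
  isOpen : IsOpen X
  closure_subset : closure X ⊆ O
  subset : A ⊆ X
  disjoint : Disjoint (closure X) B

lemma exists_isolates {α : Type*} [TopologicalSpace α] [LocallyCompactSpace α] [T2Space α]
    {O A B : Set α} (hO : IsOpen O) (hA : IsCompact A) (hB : IsClosed B) (hAO : A ⊆ O)
    (hAB : Disjoint A B) : ∃ X, Isolates O A B X := by
  obtain ⟨V, hV, hAV, hVO, -⟩ := exists_open_between_and_isCompact_closure hA
    (hO.inter hB.isOpen_compl) (fun x hx => ⟨hAO hx, Set.disjoint_left.1 hAB hx⟩)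
  exact ⟨V, hV, fun x hx => (hVO hx).1, hAV, Set.disjoint_left.2 fun x hx => (hVO hx).2⟩

lemma Isolates.mdeg_eq {n : ℕ} {f : (Fin n → ℝ) → Fin n → ℝ} (hf : Continuous f)
    {O A B X X' : Set (Fin n → ℝ)} (hO : Bornology.IsBounded O) (hX : Isolates O A B X)
    (hX' : Isolates O A B X') {w : Fin n → ℝ} (hw : ∀ x ∈ O, f x = w → x ∈ A ∪ B) :
    mdeg (fun x => f x - w) X = mdeg (fun x => f x - w) X' := by
  have key : ∀ Z, Isolates O A B Z → ∀ Z', Isolates O A B Z' →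
      mdeg (fun x => f x - w) Z = mdeg (fun x => f x - w) (Z ∩ Z') := by
    intro Z hZ Z' hZ'
    refine mdeg_excision (by fun_prop) (hO.subset (subset_closure.trans hZ.closure_subset))
      (hZ.isOpen.inter hZ'.isOpen) inter_subset_left fun x hx hxn h => ?_
    rcases hw x (hZ.closure_subset hx) (sub_eq_zero.1 h) with h1 | h1
    · exact hxn ⟨hZ.subset h1, hZ'.subset h1⟩
    · exact Set.disjoint_left.1 hZ.disjoint hx h1
  rw [key X hX X' hX', key X' hX' X hX, inter_comm]

lemma exists_mdeg_slice {n : ℕ} {f : (Fin n → ℝ) → Fin n → ℝ} (hf : Continuous f)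
    {O : Set (Fin n → ℝ)} (hOo : IsOpen O) (hO : Bornology.IsBounded O)
    {A B : Set ((Fin n → ℝ) × I)} (hA : IsCompact A) (hB : IsCompact B) (hAB : Disjoint A B)
    (hAO : ∀ q ∈ A, q.1 ∈ O) {p : I → Fin n → ℝ} (hp : Continuous p)
    (hw : ∀ s, ∀ x ∈ O, f x = p s → (x, s) ∈ A ∪ B) :
    ∃ d, ∀ s X, Isolates O {x | (x, s) ∈ A} {x | (x, s) ∈ B} X →
      mdeg (fun x => f x - p s) X = d := by
  have hemb : ∀ s : I, Topology.IsClosedEmbedding (fun x : Fin n → ℝ => (x, s)) := fun s =>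
    ⟨Topology.IsEmbedding.of_leftInverse (f := Prod.fst) (fun x => rfl) continuous_fst
      (by fun_prop), by
      rw [show range (fun x : Fin n → ℝ => (x, s)) = Prod.snd ⁻¹' {s} by
        ext ⟨x, t⟩; simp [eq_comm]]
      exact isClosed_singleton.preimage continuous_snd⟩
  have hex : ∀ s, ∃ X, Isolates O {x | (x, s) ∈ A} {x | (x, s) ∈ B} X := fun s =>
    exists_isolates hOo ((hemb s).isCompact_preimage hA)
      (((hemb s).isCompact_preimage hB).isClosed) (fun x hx => hAO _ hx)
      (hAB.preimage _)
  choose X hX using hex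
  have hloc : ∀ s₀ ∈ (univ : Set I), ∀ᶠ s in 𝓝[univ] s₀,
      mdeg (fun x => f x - p s) (X s) = mdeg (fun x => f x - p s₀) (X s₀) := by
    intro s₀ _
    rw [nhdsWithin_univ]
    have hb : Bornology.IsBounded (X s₀) :=
      hO.subset (subset_closure.trans (hX s₀).closure_subset)
    have h1 : ∀ᶠ s in 𝓝 s₀, ∀ x, (x, s) ∈ A → x ∈ X s₀ := by
      have hc : IsClosed (Prod.snd '' (A \ (Prod.fst ⁻¹' X s₀))) :=
        ((hA.diff ((hX s₀).isOpen.preimage continuous_fst)).image continuous_snd).isClosed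
      filter_upwards [hc.isOpen_compl.mem_nhds (x := s₀) (by
        rintro ⟨⟨x, s⟩, ⟨h1, h2⟩, rfl⟩
        exact h2 ((hX s).subset h1))] with s hs x hx
      by_contra hcon
      exact hs ⟨(x, s), ⟨hx, hcon⟩, rfl⟩
    have h2 : ∀ᶠ s in 𝓝 s₀, ∀ x, (x, s) ∈ B → x ∉ closure (X s₀) := by
      have hc : IsClosed (Prod.snd '' (B ∩ (Prod.fst ⁻¹' closure (X s₀)))) :=
        ((hB.inter_right (isClosed_closure.preimage continuous_fst)).image
          continuous_snd).isClosed
      filter_upwards [hc.isOpen_compl.mem_nhds (x := s₀) (by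
        rintro ⟨⟨x, s⟩, ⟨h3, h4⟩, rfl⟩
        exact Set.disjoint_left.1 (hX s).disjoint h4 h3)] with s hs x hx h
      exact hs ⟨(x, s), ⟨hx, h⟩, rfl⟩
    have h3 : ∀ᶠ s in 𝓝 s₀, ∀ x ∈ frontier (X s₀), ‖p s - p s₀‖ < ‖f x - p s₀‖ := by
      have hfc : IsClosed (f '' frontier (X s₀)) :=
        ((Metric.isCompact_of_isClosed_isBounded isClosed_frontier
          (hb.closure.subset frontier_subset_closure)).image hf).isClosed
      have hnot : p s₀ ∉ f '' frontier (X s₀) := by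
        rintro ⟨x, hx, hxe⟩
        have hxc := frontier_subset_closure hx
        rcases hw s₀ x ((hX s₀).closure_subset hxc) hxe with h | h
        · rw [(hX s₀).isOpen.frontier_eq] at hx
          exact hx.2 ((hX s₀).subset h)
        · exact Set.disjoint_left.1 (hX s₀).disjoint hxc h
      obtain ⟨ρ, hρ, hb⟩ := Metric.isOpen_iff.1 hfc.isOpen_compl _ hnot
      filter_upwards [hp.continuousAt.eventually (ball_mem_nhds _ hρ)] with s hs x hx
      have h4 : f x ∉ ball (p s₀) ρ := fun h => hb h ⟨x, hx, rfl⟩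
      rw [mem_ball] at h4
      rw [dist_eq_norm] at hs h4
      linarith
    filter_upwards [h1, h2, h3] with s hs1 hs2 hs3
    have hiso : Isolates O {x | (x, s) ∈ A} {x | (x, s) ∈ B} (X s₀) :=
      ⟨(hX s₀).isOpen, (hX s₀).closure_subset, hs1,
        Set.disjoint_left.2 fun x hx hxB => hs2 x hxB hx⟩
    rw [(hX s).mdeg_eq hf hO hiso (hw s)]
    refine (mdeg_rouche (by fun_prop) (by fun_prop) hb fun x hx => ?_).symm
    have := hs3 x hx
    simpa using this
  refine ⟨mdeg (fun x => f x - p 0) (X 0), fun s Y hY => ?_⟩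
  rw [hY.mdeg_eq hf hO (hX s) (hw s)]
  exact eq_of_isPreconnected_of_locally isPreconnected_univ
    (fun s => mdeg (fun x => f x - p s) (X s)) hloc (mem_univ s) (mem_univ 0)

section Lifts

variable {A B : Type*} [TopologicalSpace A] [TopologicalSpace B]

/-- Some path from `c₀` to `c` maps under `F` into the homotopy class of `p`. -/
def Lifts (F : C(A, B)) (c₀ : A) {x : B} (p : Path (F c₀) x) (c : A) : Prop :=
  ∃ (γ : Path c₀ c) (h : F c = x), Path.Homotopic (γ.map F.continuous) (p.cast rfl h)

lemma Lifts.apply_eq {F : C(A, B)} {c₀ : A} {x : B} {p : Path (F c₀) x} {c : A}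
    (h : Lifts F c₀ p c) : F c = x := h.choose_spec.choose

/-- The initial segment of a path. -/
def Path.initial {x y : B} (p : Path x y) (s : I) : Path x (p s) :=
  (p.subpath 0 s).cast p.source.symm rfl

lemma Lifts.step {F : C(A, B)} {c₀ : A} {x : B} {p : Path (F c₀) x} {s s' : I} {c c' : A}
    (h : Lifts F c₀ (p.initial s) c) (hs : F c = p s) (hs' : F c' = p s') (σ' : Path c c')
    (hσ : Path.Homotopic (σ'.map F.continuous) ((p.subpath s s').cast hs hs')) :
    Lifts F c₀ (p.initial s') c' := by
  obtain ⟨γ, h1, hom⟩ := h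
  refine ⟨γ.trans σ', hs', ?_⟩
  rw [Path.map_trans]
  refine (hom.hcomp hσ).trans ?_
  exact Path.Homotopic.pathCast ⟨Path.Homotopy.subpathTransSubpath p 0 s s'⟩ p.source.symm hs'

lemma lifts_initial_one {F : C(A, B)} {c₀ : A} {x : B} {p : Path (F c₀) x} {c : A} :
    Lifts F c₀ (p.initial 1) c ↔ Lifts F c₀ p c := by
  constructor
  · rintro ⟨γ, h, hom⟩
    refine ⟨γ, h.trans p.target, hom.trans ?_⟩
    have : (p.initial 1).cast rfl h = p.cast rfl (h.trans p.target) := by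
      ext t; simp [Path.initial, Path.subpath_zero_one]
    rw [this]
  · rintro ⟨γ, h, hom⟩
    refine ⟨γ, h.trans p.target.symm, hom.trans ?_⟩
    have : (p.initial 1).cast rfl (h.trans p.target.symm) = p.cast rfl h := by
      ext t; simp [Path.initial, Path.subpath_zero_one]
    rw [this]

lemma lifts_initial_zero {F : C(A, B)} {c₀ : A} {x : B} {p : Path (F c₀) x} {c : A} :
    Lifts F c₀ (p.initial 0) c ↔ Lifts F c₀ (Path.refl (F c₀)) c := by
  constructor
  · rintro ⟨γ, h, hom⟩
    refine ⟨γ, h.trans p.source, hom.trans ?_⟩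
    have : (p.initial 0).cast rfl h = (Path.refl (F c₀)).cast rfl (h.trans p.source) := by
      ext t; simp [Path.initial]
    rw [this]
  · rintro ⟨γ, h, hom⟩
    refine ⟨γ, h.trans p.source.symm, hom.trans ?_⟩
    have : (p.initial 0).cast rfl (h.trans p.source.symm) = (Path.refl (F c₀)).cast rfl h := by
      ext t; simp [Path.initial]
    rw [this]

/-- Lifting classes that meet coincide. -/
lemma Lifts.of_common {F : C(A, B)} {c₀ : A} {x : B} {p q : Path (F c₀) x} {c c' : A}
    (h1 : Lifts F c₀ p c) (h2 : Lifts F c₀ q c) (h : Lifts F c₀ p c') : Lifts F c₀ q c' := by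
  obtain ⟨γ₁, e1, k1⟩ := h1
  obtain ⟨γ₂, e2, k2⟩ := h2
  obtain ⟨γ, e, k⟩ := h
  subst e1
  refine ⟨(γ₂.trans γ₁.symm).trans γ, e, ?_⟩
  rw [Path.map_trans, Path.map_trans]
  have k1' : Path.Homotopic (γ₁.map F.continuous) p := k1
  have k2' : Path.Homotopic (γ₂.map F.continuous) q := k2
  have k1s : Path.Homotopic (γ₁.symm.map F.continuous) p.symm := by
    rw [← Path.map_symm]; exact k1'.symm₂
  refine ((k2'.hcomp k1s).hcomp k).trans ?_
  have : Path.Homotopic ((q.trans p.symm).trans p) q := by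
    rw [← Path.Homotopic.Quotient.eq]
    simp only [Path.Homotopic.Quotient.mk_trans, Path.Homotopic.Quotient.mk_symm,
      Path.Homotopic.Quotient.trans_assoc, Path.Homotopic.Quotient.symm_trans,
      Path.Homotopic.Quotient.trans_refl]
  exact this.pathCast rfl e

end Lifts

section Convex

variable {V : Type*} [NormedAddCommGroup V] [NormedSpace ℝ V]

lemma homotopic_of_convex {Y S : Set V} (hS : Convex ℝ S) (hSY : S ⊆ Y) {a b : Y}
    (p q : Path a b) (hp : ∀ t, (p t : V) ∈ S) (hq : ∀ t, (q t : V) ∈ S) : p.Homotopic q := by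
  refine ⟨⟨⟨⟨fun r => ⟨(1 - (r.1 : ℝ)) • (p r.2 : V) + (r.1 : ℝ) • (q r.2 : V), hSY
    (hS (hp _) (hq _) (by linarith [r.1.2.2]) r.1.2.1 (by ring))⟩, by fun_prop⟩, ?_, ?_⟩, ?_⟩⟩
  · intro t; apply Subtype.ext; simp
  · intro t; apply Subtype.ext; simp
  · intro r t ht
    have ht' : t = 0 ∨ t = 1 := ht
    rcases ht' with rfl | rfl
    · apply Subtype.ext
      simp [← add_smul]
    · apply Subtype.ext
      simp [← add_smul]

/-- The straight path between two points of a convex subset. -/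
def segPath {O S : Set V} (hS : Convex ℝ S) (hSO : S ⊆ O) {c c' : O} (hc : (c : V) ∈ S)
    (hc' : (c' : V) ∈ S) : Path c c' where
  toFun t := ⟨(1 - (t : ℝ)) • (c : V) + (t : ℝ) • (c' : V),
    hSO (hS hc hc' (by linarith [t.2.2]) t.2.1 (by ring))⟩
  continuous_toFun := by fun_prop
  source' := by apply Subtype.ext; simp
  target' := by apply Subtype.ext; simp

lemma segPath_mem {O S : Set V} (hS : Convex ℝ S) (hSO : S ⊆ O) {c c' : O} (hc : (c : V) ∈ S)
    (hc' : (c' : V) ∈ S) (t : I) : (segPath hS hSO hc hc' t : V) ∈ S :=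
  hS hc hc' (by linarith [t.2.2]) t.2.1 (by ring)

end Convex

section PathLift

variable {n : ℕ} {f : (Fin n → ℝ) → Fin n → ℝ} {O Y : Set (Fin n → ℝ)}

/-- The set of points of `O` that are endpoints of lifts of `p`. -/
def liftSet (F : C(↥O, ↥Y)) (c₀ : O) {x : Y} (p : Path (F c₀) x) : Set (Fin n → ℝ) :=
  {c | ∃ h : c ∈ O, Lifts F c₀ p ⟨c, h⟩}

lemma lifts_near (hf : Continuous f) (hO : IsOpen O) (hY : IsOpen Y) {F : C(↥O, ↥Y)}
    (hF : ∀ c : O, (F c : Fin n → ℝ) = f c) {c₀ : O} {x : Y} (p : Path (F c₀) x)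
    {q : (Fin n → ℝ) × I} (hqO : q.1 ∈ O) (hq : f q.1 = p q.2) :
    ∀ᶠ q₁ in 𝓝 q, ∀ᶠ q₂ in 𝓝 q, ∀ (h₁ : q₁.1 ∈ O) (h₂ : q₂.1 ∈ O), f q₁.1 = p q₁.2 →
      f q₂.1 = p q₂.2 → Lifts F c₀ (p.initial q₁.2) ⟨q₁.1, h₁⟩ →
      Lifts F c₀ (p.initial q₂.2) ⟨q₂.1, h₂⟩ := by
  obtain ⟨ρ, hρ, hρY⟩ := Metric.isOpen_iff.1 hY (p q.2 : Fin n → ℝ) (p q.2).2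
  obtain ⟨η, hη, hηO⟩ := Metric.isOpen_iff.1 (hO.inter (isOpen_ball.preimage hf)) q.1
    ⟨hqO, by rw [mem_preimage, hq]; exact mem_ball_self hρ⟩
  have hpc : Continuous fun s => (p s : Fin n → ℝ) := by fun_prop
  obtain ⟨ι, hι, hιp⟩ := Metric.continuous_iff.1 hpc q.2 ρ hρ
  have hev : ∀ᶠ q₁ in 𝓝 q, q₁.1 ∈ ball q.1 η ∧ dist q₁.2 q.2 < ι := by
    refine (continuous_fst.continuousAt.eventually (ball_mem_nhds _ hη)).and ?_
    exact continuous_snd.continuousAt.eventually (ball_mem_nhds _ hι)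
  filter_upwards [hev] with q₁ ⟨hq₁, hs₁⟩
  filter_upwards [hev] with q₂ ⟨hq₂, hs₂⟩ h₁ h₂ he₁ he₂ hl
  have e₁ : F ⟨q₁.1, h₁⟩ = p q₁.2 := Subtype.ext ((hF _).trans he₁)
  have e₂ : F ⟨q₂.1, h₂⟩ = p q₂.2 := Subtype.ext ((hF _).trans he₂)
  refine hl.step e₁ e₂ (segPath (convex_ball q.1 η) (fun y hy => (hηO hy).1) hq₁ hq₂) ?_
  refine homotopic_of_convex (convex_ball _ ρ) hρY _ _ (fun t => ?_) fun t => ?_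
  · rw [Path.map_coe, Function.comp_apply, hF]
    exact (hηO (segPath_mem (convex_ball q.1 η) _ hq₁ hq₂ t)).2
  · have ht : (p.subpath q₁.2 q₂.2) t ∈ range (p.subpath q₁.2 q₂.2) := ⟨t, rfl⟩
    rw [Path.range_subpath] at ht
    obtain ⟨s, hs, hst⟩ := ht
    rw [Path.cast_coe, ← hst]
    refine hιp s ?_
    rw [Subtype.dist_eq, Real.dist_eq, abs_lt] at hs₁ hs₂ ⊢
    rcases le_total q₁.2 q₂.2 with h | h
    · rw [uIcc_of_le h] at hs
      have k1 : (q₁.2 : ℝ) ≤ s := hs.1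
      have k2 : (s : ℝ) ≤ q₂.2 := hs.2
      constructor <;> linarith
    · rw [uIcc_of_ge h] at hs
      have k1 : (q₂.2 : ℝ) ≤ s := hs.1
      have k2 : (s : ℝ) ≤ q₁.2 := hs.2
      constructor <;> linarith

lemma exists_mdeg_liftSet (hf : Continuous f) (hO : IsOpen O) (hY : IsOpen Y)
    (hOb : Bornology.IsBounded O) {F : C(↥O, ↥Y)}
    (hF : ∀ c : O, (F c : Fin n → ℝ) = f c)
    (hprop : ∀ Q ⊆ Y, IsCompact Q → IsCompact (O ∩ f ⁻¹' Q)) {c₀ : O} {x : Y}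
    (p : Path (F c₀) x) :
    IsCompact (liftSet F c₀ p) ∧ IsCompact ((O ∩ f ⁻¹' {(x : Fin n → ℝ)}) \ liftSet F c₀ p) ∧
    ∃ d, (∀ X, Isolates O (liftSet F c₀ p) ((O ∩ f ⁻¹' {(x : Fin n → ℝ)}) \ liftSet F c₀ p) X →
        mdeg (fun c => f c - x) X = d) ∧
      ∀ X, Isolates O (liftSet F c₀ (Path.refl (F c₀)))
        ((O ∩ f ⁻¹' {(F c₀ : Fin n → ℝ)}) \ liftSet F c₀ (Path.refl (F c₀))) X →
        mdeg (fun c => f c - F c₀) X = d := by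
  have hpc : Continuous fun s => (p s : Fin n → ℝ) := by fun_prop
  set P : Set ((Fin n → ℝ) × I) := {q | q.1 ∈ O ∧ f q.1 = p q.2} with hP
  have hPc : IsCompact P := by
    have h1 : IsCompact ((O ∩ f ⁻¹' range fun s => (p s : Fin n → ℝ)) ×ˢ (univ : Set I)) :=
      (hprop _ (by rintro _ ⟨s, rfl⟩; exact (p s).2) (isCompact_range hpc)).prod isCompact_univ
    have h2 : IsClosed {q : (Fin n → ℝ) × I | f q.1 = p q.2} :=
      isClosed_eq (by fun_prop) (by fun_prop)
    convert h1.inter_right h2 using 1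
    ext q
    simp only [hP, mem_ofPred_eq, mem_inter_iff, mem_prod, mem_preimage, mem_range, mem_univ,
      and_true]
    exact ⟨fun h => ⟨⟨h.1, q.2, h.2.symm⟩, h.2⟩, fun h => ⟨h.1.1, h.2⟩⟩
  set A : Set ((Fin n → ℝ) × I) :=
    {q | ∃ h : q.1 ∈ O, Lifts F c₀ (p.initial q.2) ⟨q.1, h⟩} with hA
  have hAP : A ⊆ P := by
    rintro q ⟨h, hl⟩
    refine ⟨h, ?_⟩
    rw [← hF ⟨q.1, h⟩, hl.apply_eq]
  have hnear : ∀ q ∈ P, ∀ᶠ q₁ in 𝓝 q, q₁ ∈ P → (q₁ ∈ A ↔ q ∈ A) := by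
    intro q hq
    have h1 := (lifts_near hf hO hY hF p hq.1 hq.2).self_of_nhds
    have h2 : ∀ᶠ q₁ in 𝓝 q, ∀ (h₁ : q₁.1 ∈ O) (h₂ : q.1 ∈ O), f q₁.1 = p q₁.2 →
      f q.1 = p q.2 → Lifts F c₀ (p.initial q₁.2) ⟨q₁.1, h₁⟩ →
      Lifts F c₀ (p.initial q.2) ⟨q.1, h₂⟩ :=
      (lifts_near hf hO hY hF p hq.1 hq.2).mono fun q₁ h => h.self_of_nhds
    filter_upwards [h1, h2] with q₁ h1 h2 hq₁
    exact ⟨fun ⟨h, hl⟩ => ⟨hq.1, h2 h hq.1 hq₁.2 hq.2 hl⟩,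
      fun ⟨h, hl⟩ => ⟨hq₁.1, h1 h hq₁.1 hq.2 hq₁.2 hl⟩⟩
  have hAc : IsCompact A := by
    refine hPc.of_isClosed_subset (isClosed_of_closure_subset fun q hq => ?_) hAP
    have hqP : q ∈ P := hPc.isClosed.closure_subset_iff.2 hAP hq
    obtain ⟨q₁, hq₁, h⟩ := ((mem_closure_iff_frequently.1 hq).and_eventually (hnear q hqP)).exists
    exact (h (hAP hq₁)).1 hq₁
  have hBc : IsCompact (P \ A) := by
    refine hPc.of_isClosed_subset (isClosed_of_closure_subset fun q hq => ?_) sdiff_subset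
    have hqP : q ∈ P := hPc.isClosed.closure_subset_iff.2 sdiff_subset hq
    obtain ⟨q₁, hq₁, h⟩ := ((mem_closure_iff_frequently.1 hq).and_eventually (hnear q hqP)).exists
    exact ⟨hqP, fun hqA => hq₁.2 ((h hq₁.1).2 hqA)⟩
  have hA1 : {c | (c, (1 : I)) ∈ A} = liftSet F c₀ p := by
    ext c
    simp only [hA, mem_ofPred_eq, liftSet, lifts_initial_one]
  have hA0 : {c | (c, (0 : I)) ∈ A} = liftSet F c₀ (Path.refl (F c₀)) := by
    ext c
    simp only [hA, mem_ofPred_eq, liftSet, lifts_initial_zero]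
  have hB1 : {c | (c, (1 : I)) ∈ P \ A} =
      (O ∩ f ⁻¹' {(x : Fin n → ℝ)}) \ liftSet F c₀ p := by
    ext c
    rw [← hA1]
    simp [hP]
  have hB0 : {c | (c, (0 : I)) ∈ P \ A} =
      (O ∩ f ⁻¹' {(F c₀ : Fin n → ℝ)}) \ liftSet F c₀ (Path.refl (F c₀)) := by
    ext c
    rw [← hA0]
    simp [hP]
  obtain ⟨d, hd⟩ := exists_mdeg_slice hf hO hOb hAc hBc disjoint_sdiff_right
    (fun q hq => (hAP hq).1) hpc (fun s x hx hxs => by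
      by_cases h : (x, s) ∈ A
      · exact Or.inl h
      · exact Or.inr ⟨⟨hx, hxs⟩, h⟩)
  have hslice : ∀ {S : Set ((Fin n → ℝ) × I)}, IsCompact S → ∀ s,
      IsCompact {c | (c, s) ∈ S} := by
    intro S hS s
    convert (hS.inter_right (isClosed_singleton.preimage continuous_snd :
      IsClosed (Prod.snd ⁻¹' {s}))).image continuous_fst using 1
    ext c
    simp
  refine ⟨hA1 ▸ hslice hAc 1, hB1 ▸ hslice hBc 1, d, fun X hX => ?_, fun X hX => ?_⟩
  · rw [← hB1, ← hA1] at hX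
    simpa using hd 1 X hX
  · rw [← hB0, ← hA0] at hX
    simpa using hd 0 X hX

end PathLift

lemma eq_one_of_germ_mul {s d : Germ (atTop : Filter ℕ) ℤ} {m : ℕ}
    (h : s * ((m : Germ (atTop : Filter ℕ) ℤ) * d) = 1) : m = 1 := by
  induction s using Germ.inductionOn with
  | h s =>
    induction d using Germ.inductionOn with
    | h d =>
      have h2 : ((fun N => s N * ((m : ℤ) * d N) : ℕ → ℤ) : Germ (atTop : Filter ℕ) ℤ) =
        ((fun _ => 1 : ℕ → ℤ) : Germ (atTop : Filter ℕ) ℤ) := h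
      obtain ⟨N, hN⟩ := (Germ.coe_eq.1 h2).exists
      have h3 : (m : ℤ) ∣ 1 := ⟨s N * d N, by simp only at hN; rw [← hN]; ring⟩
      exact Nat.dvd_one.1 (by exact_mod_cast h3)

lemma exists_disjoint_open_nhds {α : Type*} [TopologicalSpace α] [T2Space α]
    {t : Set (Set α)} (ht : t.Finite) (hc : ∀ A ∈ t, IsCompact A)
    (hd : t.PairwiseDisjoint id) :
    ∃ V : Set α → Set α, (∀ A, IsOpen (V A)) ∧ (∀ A, A ⊆ V A) ∧ t.PairwiseDisjoint V := by
  have h : t.PairwiseDisjoint (fun A : Set α => 𝓝ˢ A) := fun A hA B hB hAB => by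
    exact separatedNhds_iff_disjoint.1
      (SeparatedNhds.of_isCompact_isCompact (hc A hA) (hc B hB) (hd hA hB hAB))
  obtain ⟨V, hV, hVd⟩ := h.exists_mem_filter ht
  refine ⟨fun A => interior (V A), fun A => isOpen_interior, fun A =>
    subset_interior_iff_mem_nhdsSet.2 (hV A), fun A hA B hB hAB =>
    (hVd hA hB hAB).mono interior_subset interior_subset⟩

section LoopLift

variable {n : ℕ} {f : (Fin n → ℝ) → Fin n → ℝ} {O Y U : Set (Fin n → ℝ)}

lemma exists_loop_lift (hf : Continuous f) (hO : IsOpen O) (hY : IsOpen Y)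
    (hOb : Bornology.IsBounded O) {F : C(↥O, ↥Y)}
    (hF : ∀ c : O, (F c : Fin n → ℝ) = f c)
    (hprop : ∀ Q ⊆ Y, IsCompact Q → IsCompact (O ∩ f ⁻¹' Q)) (hU : Bornology.IsBounded U)
    (hOU : O ⊆ U) {c₀ : O}
    (hfib : ∀ c ∈ closure U, f c = F c₀ → c ∈ O)
    (hdeg : ∃ s, s * mdeg (fun c => f c - F c₀) U = 1)
    (hjoin : ∀ c ∈ O, f c = F c₀ → JoinedIn O c₀ c) (L : Path (F c₀) (F c₀)) :
    ∃ γ : Path c₀ c₀, (γ.map F.continuous).Homotopic L := by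
  classical
  set Φ : Set (Fin n → ℝ) := O ∩ f ⁻¹' {(F c₀ : Fin n → ℝ)} with hΦ
  have hΦc : IsCompact Φ := hprop _ (by simp) isCompact_singleton
  set S : Path (F c₀) (F c₀) → Set (Fin n → ℝ) := fun p => liftSet F c₀ p with hS
  have hSΦ : ∀ p, S p ⊆ Φ := by
    rintro p c ⟨hc, hl⟩
    exact ⟨hc, by rw [mem_preimage, mem_singleton_iff, ← hF ⟨c, hc⟩, hl.apply_eq]⟩
  have hSc : ∀ p, IsCompact (S p) := fun p =>
    (exists_mdeg_liftSet hf hO hY hOb hF hprop p).1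
  have hTc : ∀ p, IsCompact (Φ \ S p) := fun p =>
    (exists_mdeg_liftSet hf hO hY hOb hF hprop p).2.1
  have hmeet : ∀ p q c, c ∈ S p → c ∈ S q → S p = S q := by
    rintro p q c ⟨hc, h1⟩ ⟨_, h2⟩
    ext c'
    exact ⟨fun ⟨h, hl⟩ => ⟨h, h1.of_common h2 hl⟩, fun ⟨h, hl⟩ => ⟨h, h2.of_common h1 hl⟩⟩
  have hrefl : (c₀ : Fin n → ℝ) ∈ S (Path.refl (F c₀)) :=
    ⟨c₀.2, Path.refl c₀, rfl, Path.Homotopic.refl _⟩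
  have hcover : ∀ c ∈ Φ, ∃ p, c ∈ S p := by
    rintro c ⟨hc, hfc⟩
    obtain ⟨γ, hγ⟩ := hjoin c hc hfc
    have hFc : F ⟨c, hc⟩ = F c₀ := Subtype.ext ((hF _).trans hfc)
    let γ' : Path c₀ (⟨c, hc⟩ : O) :=
      { toFun := fun t => ⟨γ t, hγ t⟩
        continuous_toFun := by fun_prop
        source' := Subtype.ext γ.source
        target' := Subtype.ext γ.target }
    exact ⟨(γ'.map F.continuous).cast rfl hFc.symm, hc, γ', hFc, Path.Homotopic.refl _⟩
  obtain ⟨t, ht⟩ := hΦc.elim_finite_subcover (fun p => (Φ \ S p)ᶜ)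
    (fun p => (hTc p).isClosed.isOpen_compl) (fun c hc => by
      obtain ⟨p, hp⟩ := hcover c hc
      exact mem_iUnion.2 ⟨p, fun h => h.2 hp⟩)
  have hcov : ∀ c ∈ Φ, ∃ p ∈ t, c ∈ S p := by
    intro c hc
    obtain ⟨p, hp, h⟩ := mem_iUnion₂.1 (ht hc)
    exact ⟨p, hp, by by_contra hn; exact h ⟨hc, hn⟩⟩
  set t' : Finset (Set (Fin n → ℝ)) := t.image S with ht'
  have hd' : (t' : Set (Set (Fin n → ℝ))).PairwiseDisjoint id := by
    intro A hA B hB hAB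
    obtain ⟨p, -, rfl⟩ := Finset.mem_image.1 (Finset.mem_coe.1 hA)
    obtain ⟨q, -, rfl⟩ := Finset.mem_image.1 (Finset.mem_coe.1 hB)
    exact Set.disjoint_left.2 fun c h1 h2 => hAB (hmeet p q c h1 h2)
  obtain ⟨V, hVo, hAV, hVd⟩ := exists_disjoint_open_nhds t'.finite_toSet (fun A hA => by
    obtain ⟨p, -, rfl⟩ := Finset.mem_image.1 (Finset.mem_coe.1 hA)
    exact hSc p) hd'
  obtain ⟨X₀, hX₀⟩ := exists_isolates hO (hSc (Path.refl (F c₀)))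
    (hTc (Path.refl (F c₀))).isClosed ((hSΦ _).trans inter_subset_left) disjoint_sdiff_right
  set d := mdeg (fun c => f c - F c₀) X₀ with hd
  have hdS : ∀ p X, Isolates O (S p) (Φ \ S p) X → mdeg (fun c => f c - F c₀) X = d := by
    intro p X hX
    obtain ⟨d', h1, h2⟩ := (exists_mdeg_liftSet hf hO hY hOb hF hprop p).2.2
    rw [h1 X hX, hd, h2 X₀ hX₀]
  have hXex : ∀ A : Set (Fin n → ℝ), ∃ X, A ∈ t' → IsOpen X ∧ A ⊆ X ∧ X ⊆ V A ∧ X ⊆ O ∧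
      mdeg (fun c => f c - F c₀) X = d := by
    intro A
    by_cases hA : A ∈ t'
    · obtain ⟨p, -, rfl⟩ := Finset.mem_image.1 hA
      obtain ⟨X, hX⟩ := exists_isolates (hO.inter (hVo (S p))) (hSc p) (hTc p).isClosed
        (fun c hc => ⟨(hSΦ p hc).1, hAV _ hc⟩) disjoint_sdiff_right
      exact ⟨X, fun _ => ⟨hX.isOpen, hX.subset,
        fun x hx => (hX.closure_subset (subset_closure hx)).2,
        fun x hx => (hX.closure_subset (subset_closure hx)).1,
        hdS p X ⟨hX.isOpen, hX.closure_subset.trans inter_subset_left, hX.subset, hX.disjoint⟩⟩⟩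
    · exact ⟨∅, fun h => absurd h hA⟩
  choose X hX using hXex
  have hsum : mdeg (fun c => f c - F c₀) U = ∑ A ∈ t', mdeg (fun c => f c - F c₀) (X A) := by
    refine mdeg_additive (by fun_prop) hU t' X (fun A hA => (hX A hA).1)
      (fun A hA => (hX A hA).2.2.2.1.trans hOU)
      (fun A hA B hB hAB => (hVd hA hB hAB).mono (hX A hA).2.2.1 (hX B hB).2.2.1) ?_
    intro c hc hcn h0
    have hfc : f c = F c₀ := sub_eq_zero.1 h0
    obtain ⟨p, hp, hcp⟩ := hcov c ⟨hfib c hc hfc, hfc⟩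
    have hA : S p ∈ t' := Finset.mem_image_of_mem S hp
    exact hcn _ hA ((hX _ hA).2.1 hcp)
  rw [Finset.sum_congr rfl fun A hA => (hX A hA).2.2.2.2, Finset.sum_const, nsmul_eq_mul] at hsum
  obtain ⟨s, hs⟩ := hdeg
  rw [hsum] at hs
  have hcard : t'.card = 1 := eq_one_of_germ_mul hs
  obtain ⟨A, hA⟩ := Finset.card_eq_one.1 hcard
  have hSA : ∀ p, (S p).Nonempty → S p = A := by
    rintro p ⟨c, hc⟩
    obtain ⟨q, hq, hcq⟩ := hcov c (hSΦ p hc)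
    have : S q ∈ t' := Finset.mem_image_of_mem S hq
    rw [hA, Finset.mem_singleton] at this
    rw [hmeet p q c hc hcq, this]
  have hL : (S L).Nonempty := by
    by_contra hne
    rw [not_nonempty_iff_eq_empty] at hne
    have h0 := hdS L ∅ ⟨isOpen_empty, by simp, by rw [hne], by simp⟩
    rw [mdeg_eq_zero (by fun_prop) (by simp) (by simp)] at h0
    rw [← h0, mul_zero, mul_zero] at hs
    exact zero_ne_one hs
  have hc₀ : (c₀ : Fin n → ℝ) ∈ S L := by
    rw [hSA L hL, ← hSA _ ⟨_, hrefl⟩]; exact hrefl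
  obtain ⟨_, γ, _, hγ⟩ := hc₀
  exact ⟨γ, hγ⟩

end LoopLift

namespace IsRelMap

variable {n : ℕ} {C D : PlanarCube n} {f : (Fin n → ℝ) → Fin n → ℝ}

/-- Small loops near the boundary lift up to homotopy. -/
lemma exists_loop_homotopy (hf : IsRelMap C D f) (hn : 3 < n) {x₀ : Fin n → ℝ}
    (hx₀ : x₀ ∈ range C.e) {ε : ℝ} (hε : 0 < ε) :
    ∃ δ > 0, ∀ L : C(I, Fin n → ℝ), L 0 = L 1 → (∀ t, L t ∈ D.U ∩ ball (f x₀) δ) →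
      ∃ (γ : C(I, Fin n → ℝ)) (H : C(I × I, Fin n → ℝ)), γ 0 = γ 1 ∧
        (∀ t, γ t ∈ C.U ∩ ball x₀ ε) ∧ (∀ r, H r ∈ D.U ∩ ball (f x₀) ε) ∧
        (∀ t, H (0, t) = L t) ∧ (∀ t, H (1, t) = f (γ t)) ∧
        ∀ s, H (s, 0) = L 0 ∧ H (s, 1) = L 0 := by
  have hfc := hf.cont
  obtain ⟨ε₂, hε₂, hpre⟩ := hf.exists_ball_preimage hx₀ hε
  set ε₁ := min ε ε₂ with hε₁d
  have hε₁ : 0 < ε₁ := lt_min hε hε₂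
  set O : Set (Fin n → ℝ) := C.U ∩ f ⁻¹' ball (f x₀) ε₁ with hOd
  set Y : Set (Fin n → ℝ) := D.U ∩ ball (f x₀) ε₁ with hYd
  have hO : IsOpen O := C.U_open.inter (isOpen_ball.preimage hfc)
  have hY : IsOpen Y := D.U_open.inter isOpen_ball
  obtain ⟨R₀, hR₀, hR₀b⟩ := Metric.isOpen_iff.1 ((isOpen_ball (x := f x₀) (ε := ε₁)).preimage hfc)
    x₀ (mem_ball_self hε₁)
  obtain ⟨r₁, hr₁, hjoin⟩ := C.exists_joinedIn_ball hn hx₀ hR₀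
  obtain ⟨δ₁, hδ₁, hpre₁⟩ := hf.exists_ball_preimage hx₀ hr₁
  refine ⟨min δ₁ ε₁, lt_min hδ₁ hε₁, fun L hL01 hL => ?_⟩
  have hLY : ∀ t, L t ∈ Y := fun t => ⟨(hL t).1, ball_subset_ball (min_le_right _ _) (hL t).2⟩
  let F : C(↥O, ↥Y) := ⟨fun c => ⟨f c, hf.mapsTo_U _ c.2.1, c.2.2⟩, by fun_prop⟩
  have hF : ∀ c : O, (F c : Fin n → ℝ) = f c := fun c => rfl
  have hprop : ∀ Q ⊆ Y, IsCompact Q → IsCompact (O ∩ f ⁻¹' Q) := by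
    intro Q hQ hQc
    convert C.isCompact_K.inter_right (hQc.isClosed.preimage hfc) using 1
    ext c
    constructor
    · rintro ⟨h1, h2⟩
      exact ⟨Or.inr h1.1, h2⟩
    · rintro ⟨h1 | h1, h2⟩
      · exact absurd (hQ h2).1 (D.not_mem_U (hf.mapsTo_bd h1))
      · exact ⟨⟨h1, (hQ h2).2⟩, h2⟩
  obtain ⟨c₀, hc₀U, hc₀⟩ := hf.exists_preimage (hL 0).1
  have hnear : ∀ c ∈ C.U, f c = L 0 → c ∈ ball x₀ r₁ := fun c hc hfc =>
    hpre₁ c (Or.inr hc) (by rw [hfc]; exact ball_subset_ball (min_le_left _ _) (hL 0).2)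
  have hc₀O : c₀ ∈ O := ⟨hc₀U, by rw [mem_preimage, hc₀]; exact (hLY 0).2⟩
  let c₁ : O := ⟨c₀, hc₀O⟩
  have hFc₁ : (F c₁ : Fin n → ℝ) = L 0 := hc₀
  let L' : Path (F c₁) (F c₁) :=
    { toFun := fun t => ⟨L t, hLY t⟩
      continuous_toFun := by fun_prop
      source' := Subtype.ext hFc₁.symm
      target' := Subtype.ext (by rw [hFc₁, hL01]) }
  obtain ⟨γ, ⟨H⟩⟩ := exists_loop_lift (U := C.U) (c₀ := c₁) hfc hO hY
    (C.U_bdd.subset inter_subset_left) hF hprop C.U_bdd inter_subset_left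
    (fun c hc hfc => by
      rw [hFc₁] at hfc
      by_cases hcU : c ∈ C.U
      · exact ⟨hcU, by rw [mem_preimage, hfc]; exact (hLY 0).2⟩
      · refine absurd (hL 0).1 (hfc ▸ hf.not_mem_U_of_frontier c ?_)
        rw [C.U_open.frontier_eq]; exact ⟨hc, hcU⟩)
    (by rw [hFc₁]; exact hf.exists_mul_mdeg_eq_one (hL 0).1)
    (fun c hc hfc => (hjoin c₀ ⟨hc₀U, hnear _ hc₀U hc₀⟩ c ⟨hc.1, hnear c hc.1 (hfc.trans hFc₁)⟩).mono
      fun y hy => ⟨hy.1, hR₀b hy.2⟩) L'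
  refine ⟨⟨fun t => (γ t : Fin n → ℝ), by fun_prop⟩,
    ⟨fun r => (H (σ r.1, r.2) : Fin n → ℝ), by fun_prop⟩, ?_, ?_, ?_, ?_, ?_, ?_⟩
  · simp
  · intro t
    refine ⟨(γ t).2.1, hpre _ (Or.inr (γ t).2.1) ?_⟩
    exact ball_subset_ball (min_le_right _ _) (γ t).2.2
  · intro r
    exact ⟨(H _).2.1, ball_subset_ball (min_le_left _ _) (H _).2.2⟩
  · intro t
    simp [L']
  · intro t
    simp [F]
  · intro s
    simp [hFc₁]

end IsRelMap

namespace PlanarCube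

variable {n : ℕ} (C : PlanarCube n)

/-- A retraction onto the closed domain, defined near its boundary. -/
lemma exists_retraction : ∃ (r : (Fin n → ℝ) → Fin n → ℝ) (W : Set (Fin n → ℝ)), IsOpen W ∧
    range C.e ⊆ W ∧ ContinuousOn r W ∧ MapsTo r W C.K ∧ ∀ x ∈ C.K, r x = x := by
  classical
  obtain ⟨l, hl, hle⟩ := exists_ext_sphere C.e C.e_cont
  set τ : (Fin n → ℝ) ≃ₜ EuclideanSpace ℝ (Fin n) :=
    (EuclideanSpace.equiv (Fin n) ℝ).symm.toHomeomorph with hτ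
  obtain ⟨k, hk, hke⟩ := exists_left_inverse_ext C.e_cont C.e_inj
    (φ := fun x => τ.symm x) (by fun_prop)
  set κ : (Fin n → ℝ) → EuclideanSpace ℝ (Fin n) := fun x => τ (k x) with hκ
  have hκc : Continuous κ := by fun_prop
  have hκe : ∀ a, κ (C.e a) = a := fun a => by simp [hκ, hke]
  set g : (Fin n → ℝ) → Fin n → ℝ := fun x => l (‖κ x‖⁻¹ • κ x) with hg
  have hge : ∀ x ∈ range C.e, g x = x := by
    rintro _ ⟨a, rfl⟩
    have : ‖(a : EuclideanSpace ℝ (Fin n))‖ = 1 := mem_sphere_zero_iff_norm.1 a.2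
    simp only [hg, hκe, this, inv_one, one_smul]
    exact hle a
  have hgc : ContinuousOn g {x | κ x ≠ 0} := by
    refine hl.comp_continuousOn (ContinuousOn.smul (ContinuousOn.inv₀ hκc.norm.continuousOn ?_)
      hκc.continuousOn)
    intro x hx
    exact norm_ne_zero_iff.2 hx
  refine ⟨C.K.piecewise id g, {x | κ x ≠ 0}, isOpen_ne_fun hκc continuous_const, ?_, ?_, ?_, ?_⟩
  · rintro _ ⟨a, rfl⟩
    rw [mem_ofPred_eq, hκe]
    exact ne_zero_of_mem_unit_sphere a
  · refine ContinuousOn.piecewise ?_ continuousOn_id (hgc.mono inter_subset_left)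
    rintro x ⟨-, hx⟩
    rw [C.isCompact_K.isClosed.frontier_eq] at hx
    rcases hx.1 with h | h
    · exact (hge x h).symm
    · exact absurd (interior_maximal (subset_union_right : C.U ⊆ C.K) C.U_open h) hx.2
  · intro x hx
    by_cases hxK : x ∈ C.K
    · rw [Set.piecewise_eq_of_mem _ _ _ hxK]; exact hxK
    · rw [Set.piecewise_eq_of_notMem _ _ _ hxK]
      have h1 : ‖‖κ x‖⁻¹ • κ x‖ = 1 := by
        rw [norm_smul, norm_inv, norm_norm, inv_mul_cancel₀ (norm_ne_zero_iff.2 hx)]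
      exact Or.inl ⟨⟨_, mem_sphere_zero_iff_norm.2 h1⟩, (hle _).symm⟩
  · intro x hx
    exact Set.piecewise_eq_of_mem _ _ _ hx

lemma mem_U_of_dist {x y : Fin n → ℝ} (hx : x ∈ C.U) (h : dist x y < infDist x (range C.e)) :
    y ∈ C.U := by
  have hb : ball x (infDist x (range C.e)) ⊆ (range C.e)ᶜ := fun w hw hwr => by
    have := infDist_le_dist_of_mem (x := x) hwr
    rw [mem_ball, dist_comm] at hw
    linarith
  by_contra hy
  have hpre : IsPreconnected (ball x (infDist x (range C.e))) :=
    (convex_ball _ _).isPreconnected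
  obtain ⟨w, hw, hwf⟩ := exists_mem_frontier_of_isPreconnected hpre
    ⟨x, mem_ball_self (dist_nonneg.trans_lt h), hx⟩ ⟨y, by rwa [mem_ball, dist_comm], hy⟩
  exact hb hw (C.U_frontier hwf)

/-- Perturbations can be corrected to agree with the original near the interior. -/
lemma exists_correction {P : Type*} [TopologicalSpace P] [CompactSpace P] (N : C(P, ↥C.K))
    {B : Set P} (hB : IsClosed B) (hN : ∀ p ∈ B, (N p : Fin n → ℝ) ∈ C.U)
    (hne : (range C.e).Nonempty) :
    ∃ η > 0, ∀ N' : C(P, ↥C.K), (∀ p, dist (N p) (N' p) < η) →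
      ∃ N'' : C(P, ↥C.K), (∀ p ∈ B, N'' p = N p) ∧ (∀ p, dist (N p) (N'' p) ≤ dist (N p) (N' p)) ∧
        ∀ p, (N'' p : Fin n → ℝ) ∈ range C.e → N'' p = N' p := by
  set d : P → ℝ := fun p => infDist (N p : Fin n → ℝ) (range C.e) with hd
  have hdc : Continuous d := (continuous_infDist_pt _).comp (by fun_prop)
  have hU : ∀ p, 0 < d p → (N p : Fin n → ℝ) ∈ C.U := fun p hp =>
    (N p).2.resolve_left fun h => hp.ne' (infDist_zero_of_mem h)
  obtain ⟨η, hη, hηB⟩ : ∃ η > 0, ∀ p ∈ B, 2 * η ≤ d p := by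
    rcases B.eq_empty_or_nonempty with h | h
    · exact ⟨1, one_pos, by simp [h]⟩
    · obtain ⟨p, hp, hmin⟩ := hB.isCompact.exists_isMinOn h hdc.continuousOn
      have h0 : 0 < d p := (C.isCompact_range.isClosed.notMem_iff_infDist_pos hne).1
        fun hr => C.not_mem_U hr (hN p hp)
      exact ⟨d p / 2, half_pos h0, fun q hq => by
        have : d p ≤ d q := hmin hq
        linarith⟩
  refine ⟨η, hη, fun N' hN' => ?_⟩
  set χ : P → ℝ := fun p => clamp (2 - d p / η) with hχ
  have hχm : ∀ p, χ p ∈ Icc (0 : ℝ) 1 := fun p => clamp_mem _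
  set g : P → Fin n → ℝ := fun p => (N p : Fin n → ℝ) + χ p • ((N' p : Fin n → ℝ) - N p) with hg
  have hgc : Continuous g := by fun_prop
  have hgd : ∀ p, dist (N p : Fin n → ℝ) (g p) ≤ dist (N p) (N' p) := by
    intro p
    rw [Subtype.dist_eq, dist_eq_norm, dist_eq_norm, hg]
    simp only [sub_add_cancel_left, norm_neg, norm_smul, Real.norm_eq_abs, abs_of_nonneg (hχm p).1]
    rw [norm_sub_rev]
    exact mul_le_of_le_one_left (norm_nonneg _) (hχm p).2
  have h1 : ∀ p, d p ≤ η → g p = N' p := by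
    intro p hp
    have : χ p = 1 := clamp_of_ge (by
      have := (div_le_one hη).2 hp
      linarith)
    simp [hg, this]
  have h2 : ∀ p, η < d p → g p ∈ C.U := fun p hp =>
    C.mem_U_of_dist (hU p (hη.trans hp)) ((hgd p).trans_lt ((hN' p).trans hp))
  have hgK : ∀ p, g p ∈ C.K := by
    intro p
    rcases le_or_gt (d p) η with h | h
    · rw [h1 p h]; exact (N' p).2
    · exact Or.inr (h2 p h)
  refine ⟨⟨fun p => ⟨g p, hgK p⟩, by fun_prop⟩, fun p hp => ?_, hgd, fun p hp => ?_⟩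
  · have : χ p = 0 := clamp_of_le (by
      have := (le_div_iff₀ hη).2 (hηB p hp)
      linarith)
    apply Subtype.ext
    simp [hg, this]
  · rcases le_or_gt (d p) η with h | h
    · exact Subtype.ext (h1 p h)
    · exact absurd (h2 p h) (C.not_mem_U hp)

end PlanarCube

/-- The boundary of the square. -/
def sqBd : Set (I × I) := {r | r.1 = 0 ∨ r.1 = 1 ∨ r.2 = 0 ∨ r.2 = 1}

lemma isClosed_sqBd : IsClosed sqBd := by
  refine ((isClosed_eq continuous_fst continuous_const).union
    ((isClosed_eq continuous_fst continuous_const).union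
    ((isClosed_eq continuous_snd continuous_const).union
    (isClosed_eq continuous_snd continuous_const))))

section Good

variable {n : ℕ} (C D : PlanarCube n) (f : (Fin n → ℝ) → Fin n → ℝ)

/-- A map of a square into `D` whose boundary behaviour is controlled by maps into `C`:
small perturbations relative to `B` only meet the boundary of `D` in the image of a prescribed
perturbation of the family `ν`. -/
def Good {ι : Type*} (B : Set (I × I)) (m : C(I × I, ↥D.K)) (ν : ι → C(I × I, ↥C.K)) : Prop :=
  ∀ ε > 0, ∃ δ > 0, ∀ ν' : ι → C(I × I, ↥C.K), (∀ i p, dist (ν i p) (ν' i p) < δ) →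
    ∃ m' : C(I × I, ↥D.K), (∀ p, dist (m p) (m' p) < ε) ∧ (∀ p ∈ B, m' p = m p) ∧
      ∀ p, (m' p : Fin n → ℝ) ∈ range D.e → ∃ i q, (m' p : Fin n → ℝ) = f (ν' i q)

end Good

namespace IsRelMap

variable {n : ℕ} {C D : PlanarCube n} {f : (Fin n → ℝ) → Fin n → ℝ}

lemma mapsTo_K (hf : IsRelMap C D f) {x : Fin n → ℝ} (hx : x ∈ C.K) : f x ∈ D.K :=
  hx.imp (fun h => hf.mapsTo_bd h) fun h => hf.mapsTo_U x h

/-- Small loops near a boundary point bound good maps of small size. -/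
lemma exists_fill (hf : IsRelMap C D f) (hn : 3 < n) {x₀ : Fin n → ℝ}
    (hx₀ : x₀ ∈ range C.e) {ε : ℝ} (hε : 0 < ε) :
    ∃ δ > 0, ∀ L : C(I, Fin n → ℝ), L 0 = L 1 → (∀ t, L t ∈ D.U ∩ ball (f x₀) δ) →
      ∃ (G : C(I × I, ↥D.K)) (ν : Unit → C(I × I, ↥C.K)), Good C D f sqBd G ν ∧
        (∀ r, (G r : Fin n → ℝ) ∈ ball (f x₀) ε) ∧ (∀ t, (G (0, t) : Fin n → ℝ) = L t) ∧
        (∀ t, (G (1, t) : Fin n → ℝ) = L 0) ∧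
        ∀ s, (G (s, 0) : Fin n → ℝ) = L 0 ∧ (G (s, 1) : Fin n → ℝ) = L 0 := by
  have hfc := hf.cont
  obtain ⟨r, W, hWo, hW, hrc, hrK, hr⟩ := C.exists_retraction
  have hV : IsOpen (W ∩ r ⁻¹' (f ⁻¹' ball (f x₀) ε)) :=
    hrc.isOpen_inter_preimage hWo (isOpen_ball.preimage hfc)
  obtain ⟨ε₂, hε₂, hb⟩ := Metric.isOpen_iff.1 hV x₀
    ⟨hW hx₀, by rw [mem_preimage, hr x₀ (Or.inl hx₀)]; exact mem_ball_self hε⟩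
  obtain ⟨δ, hδ, hlift⟩ := hf.exists_loop_homotopy hn hx₀ (lt_min hε hε₂)
  refine ⟨δ, hδ, fun L hL01 hL => ?_⟩
  obtain ⟨γ, H, hγ01, hγ, hH, hH0, hH1, hHs⟩ := hlift L hL01 hL
  set a : I × I → Fin n → ℝ := fun p => (1 - (p.1 : ℝ)) • γ p.2 + (p.1 : ℝ) • γ 0 with ha
  have hac : Continuous a := by fun_prop
  have haB : ∀ p, a p ∈ ball x₀ ε₂ := fun p =>
    convex_ball x₀ ε₂ (ball_subset_ball (min_le_right _ _) (hγ p.2).2)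
      (ball_subset_ball (min_le_right _ _) (hγ 0).2) (by linarith [p.1.2.2]) p.1.2.1 (by ring)
  have hrac : Continuous fun p => r (a p) := by
    rw [← continuousOn_univ]
    exact hrc.comp hac.continuousOn fun p _ => (hb (haB p)).1
  let N : C(I × I, ↥C.K) := ⟨fun p => ⟨r (a p), hrK (hb (haB p)).1⟩, hrac.subtype_mk _⟩
  have hN0 : ∀ t, (N (0, t) : Fin n → ℝ) = γ t := fun t => by
    simp only [N, ContinuousMap.coe_mk, ha]
    simpa using hr _ (Or.inr (hγ t).1)
  have hNγ : ∀ p, a p = γ 0 → (N p : Fin n → ℝ) = γ 0 := fun p hp => by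
    simp only [N, ContinuousMap.coe_mk, hp]
    exact hr _ (Or.inr (hγ 0).1)
  have hN1 : ∀ t, (N (1, t) : Fin n → ℝ) = γ 0 := fun t => hNγ _ (by simp [ha])
  have hNs : ∀ s, (N (s, 0) : Fin n → ℝ) = γ 0 := fun s => hNγ _ (by simp [ha, ← add_smul])
  have hNs' : ∀ s, (N (s, 1) : Fin n → ℝ) = γ 0 := fun s =>
    hNγ _ (by simp [ha, ← hγ01, ← add_smul])
  have hNB : ∀ p ∈ sqBd, (N p : Fin n → ℝ) ∈ C.U := by
    rintro ⟨s, t⟩ (h | h | h | h) <;> simp only at h <;> subst h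
    · rw [hN0]; exact (hγ t).1
    · rw [hN1]; exact (hγ 0).1
    · rw [hNs]; exact (hγ 0).1
    · rw [hNs']; exact (hγ 0).1
  -- gluing the homotopy with the image of a null-homotopy
  have hglue : ∀ N' : C(I × I, ↥C.K), (∀ p ∈ sqBd, N' p = N p) →
      ∃ G : C(I × I, ↥D.K), (∀ p : I × I, (p.1 : ℝ) ≤ 1 / 2 →
          (G p : Fin n → ℝ) = H (projIcc 0 1 zero_le_one (2 * (p.1 : ℝ)), p.2)) ∧
        ∀ p : I × I, 1 / 2 ≤ (p.1 : ℝ) →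
          (G p : Fin n → ℝ) = f (N' (projIcc 0 1 zero_le_one (2 * (p.1 : ℝ) - 1), p.2)) := by
    intro N' hN'
    have hmid : ∀ p : I × I, (p.1 : ℝ) = 1 / 2 →
        H (projIcc 0 1 zero_le_one (2 * (p.1 : ℝ)), p.2) =
        f (N' (projIcc 0 1 zero_le_one (2 * (p.1 : ℝ) - 1), p.2)) := by
      intro p hp
      have e1 : projIcc (0 : ℝ) 1 zero_le_one (2 * (p.1 : ℝ)) = 1 := by
        rw [hp]; exact projIcc_of_right_le _ (by norm_num)
      have e2 : projIcc (0 : ℝ) 1 zero_le_one (2 * (p.1 : ℝ) - 1) = 0 := by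
        rw [hp]; exact projIcc_of_le_left _ (by norm_num)
      rw [e1, e2, hH1, hN' _ (Or.inl rfl), hN0]
    set g : I × I → Fin n → ℝ := fun p => if (p.1 : ℝ) ≤ 1 / 2 then
      H (projIcc 0 1 zero_le_one (2 * (p.1 : ℝ)), p.2) else
      f (N' (projIcc 0 1 zero_le_one (2 * (p.1 : ℝ) - 1), p.2)) with hg
    have hgc : Continuous g :=
      Continuous.if_le (by fun_prop) (by fun_prop) (by fun_prop) (by fun_prop) hmid
    have hgK : ∀ p, g p ∈ D.K := by
      intro p
      by_cases h : (p.1 : ℝ) ≤ 1 / 2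
      · simp only [hg, h, if_true]; exact Or.inr (hH _).1
      · simp only [hg, h, if_false]; exact hf.mapsTo_K (N' _).2
    refine ⟨⟨fun p => ⟨g p, hgK p⟩, by fun_prop⟩, fun p hp => ?_, fun p hp => ?_⟩
    · simp only [ContinuousMap.coe_mk, hg, hp, if_true]
    · rcases hp.eq_or_lt with h | h
      · simp only [ContinuousMap.coe_mk, hg, ← h, le_refl, if_true]
        simpa [← h] using hmid p h.symm
      · simp only [ContinuousMap.coe_mk, hg, not_le.2 h, if_false]
  obtain ⟨G, hG1, hG2⟩ := hglue N fun _ _ => rfl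
  have hp0 : projIcc (0 : ℝ) 1 zero_le_one (2 * ((0 : I) : ℝ)) = 0 :=
    projIcc_of_le_left _ (by simp)
  have hp1 : projIcc (0 : ℝ) 1 zero_le_one (2 * ((1 : I) : ℝ) - 1) = 1 :=
    projIcc_of_right_le _ (by simp; norm_num)
  have hfγ : f (γ 0) = L 0 := by rw [← hH1, (hHs 1).1]
  have hbd : ∀ (N' : C(I × I, ↥C.K)) (G' : C(I × I, ↥D.K)), (∀ p ∈ sqBd, N' p = N p) →
      (∀ p : I × I, (p.1 : ℝ) ≤ 1 / 2 →
          (G' p : Fin n → ℝ) = H (projIcc 0 1 zero_le_one (2 * (p.1 : ℝ)), p.2)) →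
      (∀ p : I × I, 1 / 2 ≤ (p.1 : ℝ) →
          (G' p : Fin n → ℝ) = f (N' (projIcc 0 1 zero_le_one (2 * (p.1 : ℝ) - 1), p.2))) →
      (∀ t, (G' (0, t) : Fin n → ℝ) = L t) ∧ (∀ t, (G' (1, t) : Fin n → ℝ) = L 0) ∧
        ∀ s, (G' (s, 0) : Fin n → ℝ) = L 0 ∧ (G' (s, 1) : Fin n → ℝ) = L 0 := by
    intro N' G' hN' h1 h2
    refine ⟨fun t => ?_, fun t => ?_, fun s => ⟨?_, ?_⟩⟩
    · rw [h1 _ (by simp), hp0, hH0]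
    · rw [h2 _ (by norm_num), hp1, hN' _ (Or.inr (Or.inl rfl)), hN1, hfγ]
    · rcases le_total (s : ℝ) (1 / 2) with h | h
      · rw [h1 _ h, (hHs _).1]
      · rw [h2 _ h, hN' _ (Or.inr (Or.inr (Or.inl rfl))), hNs, hfγ]
    · rcases le_total (s : ℝ) (1 / 2) with h | h
      · rw [h1 _ h, (hHs _).2]
      · rw [h2 _ h, hN' _ (Or.inr (Or.inr (Or.inr rfl))), hNs', hfγ]
  have hGbd := hbd N G (fun _ _ => rfl) hG1 hG2
  refine ⟨G, fun _ => N, ?_, fun p => ?_, hGbd.1, hGbd.2.1, hGbd.2.2⟩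
  · intro ε' hε'
    obtain ⟨η, hη, hcorr⟩ := C.exists_correction N isClosed_sqBd hNB ⟨x₀, hx₀⟩
    have : CompactSpace ↥C.K := isCompact_iff_compactSpace.1 C.isCompact_K
    have hfu : UniformContinuous fun x : ↥C.K => f x :=
      CompactSpace.uniformContinuous_of_continuous (by fun_prop)
    obtain ⟨δ', hδ', hu⟩ := Metric.uniformContinuous_iff.1 hfu ε' hε'
    refine ⟨min η δ', lt_min hη hδ', fun ν' hν' => ?_⟩
    obtain ⟨N'', hNB'', hNd, hNr⟩ := hcorr (ν' ()) fun p => (hν' () p).trans_le (min_le_left _ _)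
    obtain ⟨G', hG1', hG2'⟩ := hglue N'' hNB''
    have hGbd' := hbd N'' G' hNB'' hG1' hG2'
    refine ⟨G', fun p => ?_, ?_, fun p hp => ?_⟩
    · rw [Subtype.dist_eq]
      rcases le_total (p.1 : ℝ) (1 / 2) with h | h
      · rw [hG1 p h, hG1' p h, dist_self]; exact hε'
      · rw [hG2 p h, hG2' p h]
        exact hu ((hNd _).trans_lt ((hν' () _).trans_le (min_le_right _ _)))
    · rintro ⟨s, t⟩ (h | h | h | h) <;> simp only at h <;> subst h <;> apply Subtype.ext
      · rw [hGbd.1, hGbd'.1]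
      · rw [hGbd.2.1, hGbd'.2.1]
      · rw [(hGbd.2.2 s).1, (hGbd'.2.2 s).1]
      · rw [(hGbd.2.2 s).2, (hGbd'.2.2 s).2]
    · rcases le_total (p.1 : ℝ) (1 / 2) with h | h
      · rw [hG1' p h] at hp
        exact absurd (hH _).1 (D.not_mem_U hp)
      · rw [hG2' p h] at hp ⊢
        refine ⟨(), _, congrArg (fun x : ↥C.K => f x) (hNr _ ?_)⟩
        exact (N'' _).2.resolve_right fun hU => D.not_mem_U hp (hf.mapsTo_U _ hU)
  · rcases le_total (p.1 : ℝ) (1 / 2) with h | h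
    · rw [hG1 p h]; exact ball_subset_ball (min_le_left _ _) (hH _).2
    · rw [hG2 p h]; exact (hb (haB _)).2

end IsRelMap

lemma exists_uniform_radius {X : Type*} [PseudoMetricSpace X] {K : Set X} (hK : IsCompact K)
    {P : X → ℝ → Prop} (hP : ∀ w ∈ K, ∃ d > 0, P w d) {ε : ℝ} (hε : 0 < ε) :
    ∃ δ > 0, ∀ y ∈ K, ∃ w ∈ K, ∃ d > 0, P w d ∧ ball y δ ⊆ ball w d ∧ dist y w < ε := by
  choose! d hd hPd using hP
  obtain ⟨δ, hδ, h⟩ := lebesgue_number_lemma_of_metric (c := fun w : K => ball (w : X)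
    (min (d w) ε)) hK (fun w => isOpen_ball) (fun w hw => mem_iUnion.2
      ⟨⟨w, hw⟩, mem_ball_self (lt_min (hd w hw) hε)⟩)
  refine ⟨δ, hδ, fun y hy => ?_⟩
  obtain ⟨w, hw⟩ := h y hy
  exact ⟨w, w.2, d w, hd w w.2, hPd w w.2, hw.trans (ball_subset_ball (min_le_left _ _)),
    (hw (mem_ball_self hδ)).trans_le (min_le_right _ _)⟩

section Loop

/-- First coordinate of the boundary loop of the square. -/
def loopX (t : ℝ) : ℝ := clamp (4 * t) - clamp (4 * t - 2)

/-- Second coordinate of the boundary loop of the square. -/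
def loopY (t : ℝ) : ℝ := clamp (4 * t - 1) - clamp (4 * t - 3)

@[fun_prop] lemma continuous_loopX : Continuous loopX := by unfold loopX; fun_prop

@[fun_prop] lemma continuous_loopY : Continuous loopY := by unfold loopY; fun_prop

lemma loop_cases {t : ℝ} (h0 : 0 ≤ t) (h1 : t ≤ 1) :
    (4 * t ≤ 1 ∧ loopX t = 4 * t ∧ loopY t = 0) ∨
    (1 ≤ 4 * t ∧ 4 * t ≤ 2 ∧ loopX t = 1 ∧ loopY t = 4 * t - 1) ∨
    (2 ≤ 4 * t ∧ 4 * t ≤ 3 ∧ loopX t = 3 - 4 * t ∧ loopY t = 1) ∨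
    (3 ≤ 4 * t ∧ loopX t = 0 ∧ loopY t = 4 - 4 * t) := by
  unfold loopX loopY
  rcases le_total (4 * t) 1 with h | h
  · left
    rw [clamp_of_mem ⟨by linarith, h⟩, clamp_of_le (by linarith), clamp_of_le (by linarith),
      clamp_of_le (by linarith)]
    refine ⟨h, by ring, by ring⟩
  · rcases le_total (4 * t) 2 with h' | h'
    · right; left
      rw [clamp_of_ge h, clamp_of_le (by linarith), clamp_of_mem ⟨by linarith, by linarith⟩,
        clamp_of_le (by linarith)]
      refine ⟨h, h', by ring, by ring⟩
    · rcases le_total (4 * t) 3 with h'' | h''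
      · right; right; left
        rw [clamp_of_ge h, clamp_of_mem ⟨by linarith, by linarith⟩, clamp_of_ge (by linarith),
          clamp_of_le (by linarith)]
        refine ⟨h', h'', by ring, by ring⟩
      · right; right; right
        rw [clamp_of_ge h, clamp_of_ge (by linarith), clamp_of_ge (by linarith),
          clamp_of_mem ⟨by linarith, by linarith⟩]
        refine ⟨h'', by ring, by ring⟩

lemma loopX_mem (t : I) : loopX t ∈ I := by
  rcases loop_cases t.2.1 t.2.2 with h | h | h | h
  · rw [h.2.1]; exact ⟨by linarith [t.2.1], h.1⟩
  · rw [h.2.2.1]; exact ⟨zero_le_one, le_refl _⟩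
  · rw [h.2.2.1]; exact ⟨by linarith, by linarith⟩
  · rw [h.2.1]; exact ⟨le_refl _, zero_le_one⟩

lemma loopY_mem (t : I) : loopY t ∈ I := by
  rcases loop_cases t.2.1 t.2.2 with h | h | h | h
  · rw [h.2.2]; exact ⟨le_refl _, zero_le_one⟩
  · rw [h.2.2.2]; exact ⟨by linarith, by linarith⟩
  · rw [h.2.2.2]; exact ⟨zero_le_one, le_refl _⟩
  · rw [h.2.2]; exact ⟨by linarith [t.2.2], by linarith⟩

/-- The boundary loop of the square. -/
def sqLoop : C(I, I × I) where
  toFun t := (⟨loopX t, loopX_mem t⟩, ⟨loopY t, loopY_mem t⟩)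
  continuous_toFun := by fun_prop

lemma sqLoop_mem (t : I) : sqLoop t ∈ sqBd := by
  rcases loop_cases t.2.1 t.2.2 with h | h | h | h
  · exact Or.inr (Or.inr (Or.inl (Subtype.ext h.2.2)))
  · exact Or.inr (Or.inl (Subtype.ext h.2.2.1))
  · exact Or.inr (Or.inr (Or.inr (Subtype.ext h.2.2.2)))
  · exact Or.inl (Subtype.ext h.2.1)

lemma sqLoop_ext {t : I} {p : I × I} (h1 : loopX t = p.1) (h2 : loopY t = p.2) : sqLoop t = p :=
  Prod.ext (Subtype.ext h1) (Subtype.ext h2)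

lemma sqLoop_zero : sqLoop 0 = (0, 0) := by
  rcases loop_cases (t := 0) le_rfl zero_le_one with h | h | h | h
  · exact sqLoop_ext (by simpa using h.2.1) (by simpa using h.2.2)
  all_goals linarith [h.1]

lemma sqLoop_one : sqLoop 1 = (0, 0) := by
  rcases loop_cases (t := 1) zero_le_one le_rfl with h | h | h | h
  · linarith [h.1]
  · linarith [h.2.1]
  · linarith [h.2.1]
  · exact sqLoop_ext (by simpa using h.2.1) (by simpa using h.2.2)

lemma exists_sqLoop_eq {p : I × I} (hp : p ∈ sqBd) : ∃ t, sqLoop t = p := by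
  obtain ⟨⟨x, hx0, hx1⟩, ⟨y, hy0, hy1⟩⟩ := p
  have key : ∀ t : ℝ, ∀ h0 : 0 ≤ t, ∀ h1 : t ≤ 1, loopX t = x → loopY t = y →
      ∃ t, sqLoop t = (⟨x, hx0, hx1⟩, ⟨y, hy0, hy1⟩) := fun t h0 h1 h2 h3 =>
    ⟨⟨t, h0, h1⟩, sqLoop_ext h2 h3⟩
  rcases hp with h | h | h | h <;> have h := congrArg Subtype.val h <;>
    simp only [Icc.coe_zero, Icc.coe_one] at h
  · refine key (1 - y / 4) (by linarith) (by linarith) ?_ ?_ <;>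
    rcases loop_cases (t := 1 - y / 4) (by linarith) (by linarith) with k | k | k | k <;> linarith
  · refine key ((1 + y) / 4) (by linarith) (by linarith) ?_ ?_ <;>
    rcases loop_cases (t := (1 + y) / 4) (by linarith) (by linarith) with k | k | k | k <;> linarith
  · refine key (x / 4) (by linarith) (by linarith) ?_ ?_ <;>
    rcases loop_cases (t := x / 4) (by linarith) (by linarith) with k | k | k | k <;> linarith
  · refine key ((3 - x) / 4) (by linarith) (by linarith) ?_ ?_ <;>
    rcases loop_cases (t := (3 - x) / 4) (by linarith) (by linarith) with k | k | k | k <;> linarith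

lemma loop_inj_aux {t u : ℝ} (ht0 : 0 ≤ t) (ht1 : t ≤ 1) (hu0 : 0 ≤ u) (hu1 : u ≤ 1)
    (hx : loopX t = loopX u) (hy : loopY t = loopY u) (htu : t ≤ u) :
    t = u ∨ (t = 0 ∧ u = 1) := by
  rcases loop_cases ht0 ht1 with h | h | h | h <;> rcases loop_cases hu0 hu1 with k | k | k | k <;>
  first
  | (left; linarith)
  | (right; constructor <;> linarith)

lemma sqLoop_eq_cases {t u : I} (h : sqLoop t = sqLoop u) :
    t = u ∨ ((t = 0 ∨ t = 1) ∧ (u = 0 ∨ u = 1)) := by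
  have hx : loopX t = loopX u := congrArg (fun p : I × I => (p.1 : ℝ)) h
  have hy : loopY t = loopY u := congrArg (fun p : I × I => (p.2 : ℝ)) h
  rcases le_total (t : ℝ) u with htu | htu
  · rcases loop_inj_aux t.2.1 t.2.2 u.2.1 u.2.2 hx hy htu with h | h
    · exact Or.inl (Subtype.ext h)
    · exact Or.inr ⟨Or.inl (Subtype.ext h.1), Or.inr (Subtype.ext h.2)⟩
  · rcases loop_inj_aux u.2.1 u.2.2 t.2.1 t.2.2 hx.symm hy.symm htu with h | h
    · exact Or.inl (Subtype.ext h.symm)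
    · exact Or.inr ⟨Or.inr (Subtype.ext h.2), Or.inl (Subtype.ext h.1)⟩

lemma half_combo_mem {s x : ℝ} (hs : s ∈ I) (hx : x ∈ I) : 1 / 2 + (1 - s) * (x - 1 / 2) ∈ I := by
  obtain ⟨hs0, hs1⟩ := hs
  obtain ⟨hx0, hx1⟩ := hx
  constructor <;> nlinarith

/-- Polar coordinates on the square. -/
def polar : C(I × I, I × I) where
  toFun p := (⟨1 / 2 + (1 - (p.1 : ℝ)) * (((sqLoop p.2).1 : ℝ) - 1 / 2),
      half_combo_mem p.1.2 (sqLoop p.2).1.2⟩,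
    ⟨1 / 2 + (1 - (p.1 : ℝ)) * (((sqLoop p.2).2 : ℝ) - 1 / 2),
      half_combo_mem p.1.2 (sqLoop p.2).2.2⟩)
  continuous_toFun := by fun_prop

lemma polar_zero (t : I) : polar (0, t) = sqLoop t := by
  refine Prod.ext (Subtype.ext ?_) (Subtype.ext ?_) <;> simp [polar]

/-- The distance to the centre of the square, normalised. -/
def sqRad (p : I × I) : ℝ := max |2 * (p.1 : ℝ) - 1| |2 * (p.2 : ℝ) - 1|

lemma sqRad_le (p : I × I) : sqRad p ≤ 1 := by
  refine max_le ?_ ?_ <;> rw [abs_le] <;> constructor <;>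
    linarith [p.1.2.1, p.1.2.2, p.2.2.1, p.2.2.2]

lemma sqRad_eq_one_iff (p : I × I) : sqRad p = 1 ↔ p ∈ sqBd := by
  constructor
  · intro h
    rcases max_choice |2 * (p.1 : ℝ) - 1| |2 * (p.2 : ℝ) - 1| with k | k <;>
      rw [sqRad, k] at h <;> rcases (abs_eq zero_le_one).1 h with h | h
    · exact Or.inr (Or.inl (Subtype.ext (by rw [Icc.coe_one]; linarith)))
    · exact Or.inl (Subtype.ext (by rw [Icc.coe_zero]; linarith))
    · exact Or.inr (Or.inr (Or.inr (Subtype.ext (by rw [Icc.coe_one]; linarith))))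
    · exact Or.inr (Or.inr (Or.inl (Subtype.ext (by rw [Icc.coe_zero]; linarith))))
  · intro h
    refine le_antisymm (sqRad_le p) ?_
    rcases h with h | h | h | h
    · refine le_max_of_le_left ?_; rw [h]; norm_num
    · refine le_max_of_le_left ?_; rw [h]; norm_num
    · refine le_max_of_le_right ?_; rw [h]; norm_num
    · refine le_max_of_le_right ?_; rw [h]; norm_num

lemma sqRad_polar (p : I × I) : sqRad (polar p) = 1 - p.1 := by
  have h : sqRad (sqLoop p.2) = 1 := (sqRad_eq_one_iff _).2 (sqLoop_mem _)
  have hs : 0 ≤ 1 - (p.1 : ℝ) := by linarith [p.1.2.2]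
  have : sqRad (polar p) = (1 - p.1) * sqRad (sqLoop p.2) := by
    rw [sqRad, sqRad, mul_max_of_nonneg _ _ hs, ← abs_of_nonneg hs, ← abs_mul, ← abs_mul]
    simp only [polar, ContinuousMap.coe_mk]
    congr 2 <;> ring
  rw [this, h, mul_one]

lemma polar_surjective : Function.Surjective polar := by
  intro p
  rcases eq_or_ne (sqRad p) 0 with h | h
  · refine ⟨(1, 0), ?_⟩
    have h1 : |2 * (p.1 : ℝ) - 1| ≤ 0 := h ▸ le_max_left _ _
    have h2 : |2 * (p.2 : ℝ) - 1| ≤ 0 := h ▸ le_max_right _ _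
    have h1 := abs_nonpos_iff.1 h1
    have h2 := abs_nonpos_iff.1 h2
    refine Prod.ext (Subtype.ext ?_) (Subtype.ext ?_) <;> simp [polar] <;> linarith
  · have hpos : 0 < sqRad p := lt_of_le_of_ne (le_max_of_le_left (abs_nonneg _)) h.symm
    have hm : ∀ x : ℝ, |2 * x - 1| ≤ sqRad p → 1 / 2 + (x - 1 / 2) / sqRad p ∈ I := by
      intro x hx
      rw [abs_le] at hx
      have e1 : -(1 / 2) ≤ (x - 1 / 2) / sqRad p := by
        rw [le_div_iff₀ hpos]; linarith
      have e2 : (x - 1 / 2) / sqRad p ≤ 1 / 2 := by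
        rw [div_le_iff₀ hpos]; linarith
      exact ⟨by linarith, by linarith⟩
    set q : I × I := (⟨_, hm p.1 (le_max_left _ _)⟩, ⟨_, hm p.2 (le_max_right _ _)⟩) with hq
    have hqB : q ∈ sqBd := by
      rw [← sqRad_eq_one_iff]
      have : sqRad q = (sqRad p)⁻¹ * sqRad p := by
        conv_rhs => rw [sqRad.eq_1 p, mul_max_of_nonneg _ _ (inv_nonneg.2
          (le_max_of_le_left (abs_nonneg _) : 0 ≤ max |2 * (p.1 : ℝ) - 1| |2 * (p.2 : ℝ) - 1|))]
        rw [← sqRad.eq_1 p, ← abs_of_nonneg (inv_nonneg.2 hpos.le), ← abs_mul, ← abs_mul, sqRad]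
        simp only [hq]
        congr 2 <;> field_simp <;> ring
      rw [this, inv_mul_cancel₀ h]
    obtain ⟨t, ht⟩ := exists_sqLoop_eq hqB
    refine ⟨(⟨1 - sqRad p, by linarith [sqRad_le p], by linarith⟩, t), ?_⟩
    refine Prod.ext (Subtype.ext ?_) (Subtype.ext ?_) <;>
      simp only [polar, ContinuousMap.coe_mk, ht, hq] <;> field_simp <;> ring

/-- A map which is constant along the fibres of polar coordinates descends. -/
lemma exists_polar_descend {X : Type*} [TopologicalSpace X] (G : C(I × I, X)) {x : X}
    (h1 : ∀ t, G (1, t) = x) (h2 : ∀ s, G (s, 0) = G (s, 1)) :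
    ∃ m : C(I × I, X), ∀ p, m (polar p) = G p := by
  have hq : IsQuotientMap polar :=
    IsQuotientMap.of_surjective_continuous polar_surjective polar.continuous
  have hfac : Function.FactorsThrough G polar := by
    rintro ⟨s, t⟩ ⟨s', t'⟩ h
    have hr := congrArg sqRad h
    rw [sqRad_polar, sqRad_polar] at hr
    have hs : s = s' := Subtype.ext (by simpa using hr)
    subst hs
    rcases eq_or_ne s 1 with rfl | hs
    · rw [h1, h1]
    · have hne : 1 - (s : ℝ) ≠ 0 := fun h0 => hs (Subtype.ext (by rw [Icc.coe_one]; linarith))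
      have hl : sqLoop t = sqLoop t' := by
        have e1 := congrArg (fun p : I × I => (p.1 : ℝ)) h
        have e2 := congrArg (fun p : I × I => (p.2 : ℝ)) h
        simp only [polar, ContinuousMap.coe_mk, add_right_inj, mul_eq_mul_left_iff, hne,
          or_false, sub_left_inj] at e1 e2
        exact Prod.ext (Subtype.ext e1) (Subtype.ext e2)
      rcases sqLoop_eq_cases hl with rfl | ⟨rfl | rfl, rfl | rfl⟩
      · rfl
      · rfl
      · exact h2 s
      · exact (h2 s).symm
      · rfl
  exact ⟨hq.lift G hfac, fun p => congrArg (fun k : C(I × I, X) => k p) (hq.lift_comp G hfac)⟩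

end Loop

namespace PlanarCube

variable {n : ℕ}

/-- Uniform local path connectedness of the interior. -/
lemma exists_joinedIn_uniform (D : PlanarCube n) (hn : 3 < n) {ε : ℝ} (hε : 0 < ε) :
    ∃ δ > 0, ∀ y₁ ∈ D.U, ∀ y₂ ∈ D.U, dist y₂ y₁ < δ → JoinedIn (D.U ∩ ball y₁ ε) y₁ y₂ := by
  have hloc : ∀ w ∈ D.K, ∃ d > 0, ∀ y₁ ∈ D.U ∩ ball w d, ∀ y₂ ∈ D.U ∩ ball w d,
      JoinedIn (D.U ∩ ball w (ε / 2)) y₁ y₂ := by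
    rintro w (hw | hw)
    · exact D.exists_joinedIn_ball hn hw (half_pos hε)
    · obtain ⟨d, hd, hb⟩ := Metric.isOpen_iff.1 (D.U_open.inter (isOpen_ball (x := w) (ε := ε / 2)))
        w ⟨hw, mem_ball_self (half_pos hε)⟩
      exact ⟨d, hd, fun y₁ hy₁ y₂ hy₂ => ((convex_ball w d).isPathConnected
        ⟨w, mem_ball_self hd⟩).joinedIn y₁ hy₁.2 y₂ hy₂.2 |>.mono hb⟩
  obtain ⟨δ, hδ, h⟩ := exists_uniform_radius D.isCompact_K hloc (half_pos hε)
  refine ⟨δ, hδ, fun y₁ hy₁ y₂ hy₂ h12 => ?_⟩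
  obtain ⟨w, -, d, hd, hP, hb, hw⟩ := h y₁ (Or.inr hy₁)
  refine (hP y₁ ⟨hy₁, hb (mem_ball_self hδ)⟩ y₂ ⟨hy₂, hb h12⟩).mono fun y hy => ⟨hy.1, ?_⟩
  have h3 := mem_ball.1 hy.2
  rw [mem_ball]
  linarith [dist_triangle y w y₁, dist_comm y₁ w]

end PlanarCube

lemma Good.of_mem_U {n : ℕ} {C D : PlanarCube n} {f : (Fin n → ℝ) → Fin n → ℝ} {ι : Type*}
    {B : Set (I × I)} {m : C(I × I, ↥D.K)} (ν : ι → C(I × I, ↥C.K))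
    (h : ∀ p, (m p : Fin n → ℝ) ∈ D.U) : Good C D f B m ν := fun ε hε =>
  ⟨1, one_pos, fun _ _ => ⟨m, fun p => by rwa [dist_self], fun _ _ => rfl,
    fun p hp => absurd (h p) (D.not_mem_U hp)⟩⟩

namespace IsRelMap

variable {n : ℕ} {C D : PlanarCube n} {f : (Fin n → ℝ) → Fin n → ℝ}

lemma exists_fill_uniform (hf : IsRelMap C D f) (hn : 3 < n) {ε : ℝ} (hε : 0 < ε) :
    ∃ δ > 0, ∀ L : C(I, Fin n → ℝ), L 0 = L 1 → (∀ t, L t ∈ D.U ∩ ball (L 0) δ) →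
      ∃ (G : C(I × I, ↥D.K)) (ν : Unit → C(I × I, ↥C.K)), Good C D f sqBd G ν ∧
        (∀ r, (G r : Fin n → ℝ) ∈ ball (L 0) ε) ∧ (∀ t, (G (0, t) : Fin n → ℝ) = L t) ∧
        (∀ t, (G (1, t) : Fin n → ℝ) = L 0) ∧
        ∀ s, (G (s, 0) : Fin n → ℝ) = L 0 ∧ (G (s, 1) : Fin n → ℝ) = L 0 := by
  have hloc : ∀ w ∈ D.K, ∃ d > 0, ∀ L : C(I, Fin n → ℝ), L 0 = L 1 →
      (∀ t, L t ∈ D.U ∩ ball w d) →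
      ∃ (G : C(I × I, ↥D.K)) (ν : Unit → C(I × I, ↥C.K)), Good C D f sqBd G ν ∧
        (∀ r, (G r : Fin n → ℝ) ∈ ball w (ε / 2)) ∧ (∀ t, (G (0, t) : Fin n → ℝ) = L t) ∧
        (∀ t, (G (1, t) : Fin n → ℝ) = L 0) ∧
        ∀ s, (G (s, 0) : Fin n → ℝ) = L 0 ∧ (G (s, 1) : Fin n → ℝ) = L 0 := by
    rintro w (hw | hw)
    · rw [← hf.image_bd] at hw
      obtain ⟨x₀, hx₀, rfl⟩ := hw
      exact hf.exists_fill hn hx₀ (half_pos hε)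
    · obtain ⟨d, hd, hb⟩ := Metric.isOpen_iff.1 (D.U_open.inter (isOpen_ball (x := w) (ε := ε / 2)))
        w ⟨hw, mem_ball_self (half_pos hε)⟩
      refine ⟨d, hd, fun L hL01 hL => ?_⟩
      set g : I × I → Fin n → ℝ := fun p => (1 - (p.1 : ℝ)) • L p.2 + (p.1 : ℝ) • L 0 with hg
      have hgb : ∀ p, g p ∈ ball w d := fun p => convex_ball w d (hL p.2).2 (hL 0).2
        (by linarith [p.1.2.2]) p.1.2.1 (by ring)
      obtain ⟨c, hc⟩ := C.U_conn.nonempty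
      refine ⟨⟨fun p => ⟨g p, Or.inr (hb (hgb p)).1⟩, by fun_prop⟩,
        fun _ => ContinuousMap.const _ ⟨c, Or.inr hc⟩, Good.of_mem_U _ fun p => (hb (hgb p)).1,
        fun p => (hb (hgb p)).2, fun t => ?_, fun t => ?_, fun s => ⟨?_, ?_⟩⟩
      · simp [hg]
      · simp [hg]
      · simp [hg, ← add_smul]
      · simp [hg, ← hL01, ← add_smul]
  obtain ⟨δ, hδ, h⟩ := exists_uniform_radius D.isCompact_K hloc (half_pos hε)
  refine ⟨δ, hδ, fun L hL01 hL => ?_⟩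
  obtain ⟨w, -, d, hd, hP, hb, hw⟩ := h (L 0) (Or.inr (hL 0).1)
  obtain ⟨G, ν, h1, h2, h3⟩ := hP L hL01 fun t => ⟨(hL t).1, hb (hL t).2⟩
  refine ⟨G, ν, h1, fun r => ?_, h3⟩
  have := h2 r
  rw [mem_ball] at this ⊢
  linarith [dist_triangle (G r : Fin n → ℝ) w (L 0), dist_comm (L 0) w]

/-- Boundary data on a small square extends to a good map. -/
lemma exists_cell (hf : IsRelMap C D f) (hn : 3 < n) {ε : ℝ} (hε : 0 < ε) :
    ∃ δ > 0, ∀ b : C(I × I, Fin n → ℝ), (∀ p ∈ sqBd, b p ∈ D.U ∩ ball (b (0, 0)) δ) →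
      ∃ (m : C(I × I, ↥D.K)) (ν : Unit → C(I × I, ↥C.K)), Good C D f sqBd m ν ∧
        (∀ p, (m p : Fin n → ℝ) ∈ ball (b (0, 0)) ε) ∧
        ∀ p ∈ sqBd, (m p : Fin n → ℝ) = b p := by
  obtain ⟨δ, hδ, hfill⟩ := hf.exists_fill_uniform hn hε
  refine ⟨δ, hδ, fun b hb => ?_⟩
  have hL0 : (b.comp sqLoop) 0 = b (0, 0) := by rw [ContinuousMap.comp_apply, sqLoop_zero]
  have hL1 : (b.comp sqLoop) 1 = b (0, 0) := by rw [ContinuousMap.comp_apply, sqLoop_one]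
  obtain ⟨G, ν, hG, hGb, hG0, hG1, hGs⟩ := hfill (b.comp sqLoop) (hL0.trans hL1.symm) fun t => by
    rw [hL0]; exact hb _ (sqLoop_mem t)
  have hdesc : ∀ G' : C(I × I, ↥D.K), (∀ p ∈ sqBd, G' p = G p) →
      ∃ m : C(I × I, ↥D.K), (∀ p, m (polar p) = G' p) ∧
        ∀ p ∈ sqBd, (m p : Fin n → ℝ) = b p := by
    intro G' hG'
    have e1 : ∀ t, G' (1, t) = G (1, 0) := fun t => by
      rw [hG' _ (Or.inr (Or.inl rfl))]
      exact Subtype.ext ((hG1 t).trans (hG1 0).symm)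
    obtain ⟨m, hm⟩ := exists_polar_descend G' e1 fun s => by
      rw [hG' _ (Or.inr (Or.inr (Or.inl rfl))), hG' _ (Or.inr (Or.inr (Or.inr rfl)))]
      exact Subtype.ext ((hGs s).1.trans (hGs s).2.symm)
    refine ⟨m, hm, fun p hp => ?_⟩
    obtain ⟨t, rfl⟩ := exists_sqLoop_eq hp
    rw [← polar_zero, hm, hG' _ (Or.inl rfl), hG0, polar_zero]
    rfl
  obtain ⟨m, hm, hmb⟩ := hdesc G fun _ _ => rfl
  refine ⟨m, ν, fun ε' hε' => ?_, fun p => ?_, hmb⟩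
  · obtain ⟨δ', hδ', h⟩ := hG ε' hε'
    refine ⟨δ', hδ', fun ν' hν' => ?_⟩
    obtain ⟨G', hd, hB, hmeet⟩ := h ν' hν'
    obtain ⟨m', hm', hmb'⟩ := hdesc G' hB
    refine ⟨m', fun p => ?_, fun p hp => Subtype.ext ((hmb' p hp).trans (hmb p hp).symm),
      fun p hp => ?_⟩
    · obtain ⟨q, rfl⟩ := polar_surjective p
      rw [hm, hm']; exact hd q
    · obtain ⟨q, rfl⟩ := polar_surjective p
      rw [hm'] at hp ⊢
      exact hmeet q hp
  · obtain ⟨q, rfl⟩ := polar_surjective p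
    rw [hm, ← hL0]; exact hGb q

end IsRelMap

section Grid

lemma grid_mem {N i : ℕ} (hi : i < N) (s : I) : ((i : ℝ) + s) / N ∈ I := by
  have hN : (0 : ℝ) < N := by exact_mod_cast (Nat.zero_le i).trans_lt hi
  have : ((i : ℝ) + 1) ≤ N := by exact_mod_cast hi
  exact ⟨div_nonneg (add_nonneg (Nat.cast_nonneg i) s.2.1) hN.le,
    (div_le_one hN).2 (by linarith [s.2.2])⟩

/-- The point of the square with position `p` in cell `(i, j)` of the `N`-grid. -/
def gridPt (N : ℕ) : (Fin N × Fin N) × (I × I) → I × I :=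
  fun q => (⟨_, grid_mem q.1.1.2 q.2.1⟩, ⟨_, grid_mem q.1.2.2 q.2.2⟩)

lemma continuous_gridPt (N : ℕ) : Continuous (gridPt N) := by
  unfold gridPt
  have h : ∀ g : (Fin N × Fin N) → ℝ, Continuous g := fun g => continuous_of_discreteTopology
  have h1 : Continuous fun q : (Fin N × Fin N) × (I × I) => ((q.1.1 : ℕ) : ℝ) :=
    (h fun a => ((a.1 : ℕ) : ℝ)).comp continuous_fst
  have h2 : Continuous fun q : (Fin N × Fin N) × (I × I) => ((q.1.2 : ℕ) : ℝ) :=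
    (h fun a => ((a.2 : ℕ) : ℝ)).comp continuous_fst
  exact ((h1.add (by fun_prop)).div_const _ |>.subtype_mk _).prodMk
    ((h2.add (by fun_prop)).div_const _ |>.subtype_mk _)

lemma exists_grid_coord {N : ℕ} (hN : 0 < N) (x : I) :
    ∃ (i : Fin N) (s : I), ((i : ℝ) + s) / N = x := by
  have hN' : (0 : ℝ) < N := by exact_mod_cast hN
  have h0 : 0 ≤ (N : ℝ) * x := mul_nonneg hN'.le x.2.1
  rcases lt_or_ge ⌊(N : ℝ) * x⌋₊ N with h | h
  · refine ⟨⟨_, h⟩, ⟨(N : ℝ) * x - ⌊(N : ℝ) * x⌋₊, ?_, ?_⟩, ?_⟩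
    · linarith [Nat.floor_le h0]
    · linarith [(Nat.lt_floor_add_one ((N : ℝ) * x)).le]
    · simp only; field_simp; ring
  · have hx1 : (x : ℝ) = 1 := by
      have h1 : (N : ℝ) ≤ N * x := (Nat.le_floor_iff h0).1 h
      have h2 : (1 : ℝ) ≤ x := by
        by_contra hlt
        nlinarith
      exact le_antisymm x.2.2 h2
    refine ⟨⟨N - 1, by omega⟩, 1, ?_⟩
    rw [hx1]
    simp only [Icc.coe_one]
    rw [Nat.cast_sub hN]
    field_simp
    simp

lemma gridPt_surjective {N : ℕ} (hN : 0 < N) : Function.Surjective (gridPt N) := by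
  rintro ⟨x, y⟩
  obtain ⟨i, s, hi⟩ := exists_grid_coord hN x
  obtain ⟨j, t, hj⟩ := exists_grid_coord hN y
  exact ⟨((i, j), (s, t)), Prod.ext (Subtype.ext hi) (Subtype.ext hj)⟩

lemma grid_coord_eq {N i i' : ℕ} {s s' : I} (hN : 0 < N)
    (h : ((i : ℝ) + s) / N = ((i' : ℝ) + s') / N) :
    (i = i' ∧ s = s') ∨ (i' = i + 1 ∧ s = 1 ∧ s' = 0) ∨ (i = i' + 1 ∧ s = 0 ∧ s' = 1) := by
  have hN' : (N : ℝ) ≠ 0 := by exact_mod_cast hN.ne'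
  have h1 : (i : ℝ) + s = i' + s' := (div_left_inj' hN').1 h
  rcases lt_trichotomy i i' with hlt | rfl | hlt
  · have h2 : (i : ℝ) + 1 ≤ i' := by exact_mod_cast hlt
    have h3 : (s : ℝ) = 1 := le_antisymm s.2.2 (by linarith [s'.2.1])
    have h4 : (s' : ℝ) = 0 := le_antisymm (by linarith) s'.2.1
    refine Or.inr (Or.inl ⟨?_, Subtype.ext h3, Subtype.ext h4⟩)
    have : (i' : ℝ) = i + 1 := by linarith
    exact_mod_cast this
  · exact Or.inl ⟨rfl, Subtype.ext (by linarith)⟩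
  · have h2 : (i' : ℝ) + 1 ≤ i := by exact_mod_cast hlt
    have h3 : (s' : ℝ) = 1 := le_antisymm s'.2.2 (by linarith [s.2.1])
    have h4 : (s : ℝ) = 0 := le_antisymm (by linarith) s.2.1
    refine Or.inr (Or.inr ⟨?_, Subtype.ext h4, Subtype.ext h3⟩)
    have : (i : ℝ) = i' + 1 := by linarith
    exact_mod_cast this

/-- Compatible maps on the cells of a grid glue. -/
lemma exists_grid_glue {X : Type*} [TopologicalSpace X] {N : ℕ} (hN : 0 < N)
    (m : ℕ → ℕ → C(I × I, X)) (h1 : ∀ i j t, m i j (1, t) = m (i + 1) j (0, t))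
    (h2 : ∀ i j s, m i j (s, 1) = m i (j + 1) (s, 0)) :
    ∃ M : C(I × I, X), ∀ q : (Fin N × Fin N) × (I × I), M (gridPt N q) = m q.1.1 q.1.2 q.2 := by
  have hq : IsQuotientMap (gridPt N) :=
    IsQuotientMap.of_surjective_continuous (gridPt_surjective hN) (continuous_gridPt N)
  have hcont : Continuous fun q : (Fin N × Fin N) × (I × I) => m q.1.1 q.1.2 q.2 := by
    rw [continuous_prod_of_discrete_left]
    exact fun a => (m a.1 a.2).continuous
  let G : C((Fin N × Fin N) × (I × I), X) := ⟨_, hcont⟩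
  have hfac : Function.FactorsThrough G (gridPt N) := by
    rintro ⟨⟨i, j⟩, s, t⟩ ⟨⟨i', j'⟩, s', t'⟩ h
    have e1 := congrArg (fun p : I × I => (p.1 : ℝ)) h
    have e2 := congrArg (fun p : I × I => (p.2 : ℝ)) h
    have hs : m i j (s, t) = m i' j (s', t) := by
      rcases grid_coord_eq hN e1 with ⟨h, rfl⟩ | ⟨h, rfl, rfl⟩ | ⟨h, rfl, rfl⟩
      · rw [h]
      · rw [h, h1]
      · rw [h, h1]
    have ht : m i' j (s', t) = m i' j' (s', t') := by
      rcases grid_coord_eq hN e2 with ⟨h, rfl⟩ | ⟨h, rfl, rfl⟩ | ⟨h, rfl, rfl⟩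
      · rw [h]
      · rw [h, h2]
      · rw [h, h2]
    exact hs.trans ht
  let Γ : C((Fin N × Fin N) × (I × I), I × I) := ⟨gridPt N, continuous_gridPt N⟩
  have hq' : IsQuotientMap Γ := hq
  exact ⟨hq'.lift G hfac, fun p => congrArg (fun k => k p) (hq'.lift_comp G hfac)⟩

end Grid

lemma exists_pos_forall_lt_of_finite {ι : Type*} [Finite ι] {δ : ι → ℝ} (hδ : ∀ i, 0 < δ i) :
    ∃ d > 0, ∀ i, d < δ i := by
  have h : ∀ᶠ d in 𝓝[>] (0 : ℝ), ∀ i, d < δ i :=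
    eventually_all.2 fun i => (eventually_lt_nhds (hδ i)).filter_mono nhdsWithin_le_nhds
  obtain ⟨d, h1, h2⟩ := (h.and self_mem_nhdsWithin).exists
  exact ⟨d, h2, h1⟩

section Coons

variable {V : Type*} [NormedAddCommGroup V] [NormedSpace ℝ V]

/-- A map of the square with prescribed boundary edges. -/
lemma exists_map_of_edges {a₀₀ a₁₀ a₀₁ a₁₁ : V} (h₀ : Path a₀₀ a₁₀) (h₁ : Path a₀₁ a₁₁)
    (v₀ : Path a₀₀ a₀₁) (v₁ : Path a₁₀ a₁₁) :
    ∃ b : C(I × I, V), (∀ s, b (s, 0) = h₀ s) ∧ (∀ s, b (s, 1) = h₁ s) ∧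
      (∀ t, b (0, t) = v₀ t) ∧ ∀ t, b (1, t) = v₁ t := by
  refine ⟨⟨fun p => (1 - (p.2 : ℝ)) • h₀ p.1 + (p.2 : ℝ) • h₁ p.1 + (1 - (p.1 : ℝ)) • v₀ p.2 +
    (p.1 : ℝ) • v₁ p.2 - ((1 - (p.1 : ℝ)) • (1 - (p.2 : ℝ)) • a₀₀ +
    (p.1 : ℝ) • (1 - (p.2 : ℝ)) • a₁₀ + (1 - (p.1 : ℝ)) • (p.2 : ℝ) • a₀₁ +
    (p.1 : ℝ) • (p.2 : ℝ) • a₁₁), by fun_prop⟩, fun s => ?_, fun s => ?_, fun t => ?_, fun t => ?_⟩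
  · simp
  · simp
  · simp
  · simp

end Coons

namespace PlanarCube

variable {n : ℕ}

lemma exists_dist_lt_of_mem_K (D : PlanarCube n) {x : Fin n → ℝ} (hx : x ∈ D.K) {ε : ℝ}
    (hε : 0 < ε) : ∃ y ∈ D.U, dist y x < ε := by
  have h : x ∈ closure D.U := hx.elim (fun h => D.subset_closure_U h) fun h => subset_closure h
  obtain ⟨y, hy, h⟩ := Metric.mem_closure_iff.1 h ε hε
  exact ⟨y, hy, by rwa [dist_comm]⟩

end PlanarCube

namespace IsRelMap

variable {n : ℕ} {C D : PlanarCube n} {f : (Fin n → ℝ) → Fin n → ℝ}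

/-- Good maps are dense. -/
lemma exists_good_approx (hf : IsRelMap C D f) (hn : 3 < n) (μ : C(I × I, ↥D.K)) {ε : ℝ}
    (hε : 0 < ε) : ∃ (N : ℕ) (M : C(I × I, ↥D.K)) (ν : Fin N × Fin N → C(I × I, ↥C.K)),
      (∀ p, dist (μ p) (M p) < ε) ∧ Good C D f ∅ M ν := by
  obtain ⟨δ₂, hδ₂, hcell⟩ := hf.exists_cell hn (half_pos hε)
  obtain ⟨δ₁, hδ₁, hjoin⟩ := D.exists_joinedIn_uniform hn (ε := δ₂ / 4) (by linarith)
  obtain ⟨κ, hκ, hκ1, hκ2, hκ3⟩ : ∃ κ > 0, 3 * κ ≤ δ₁ ∧ 12 * κ ≤ δ₂ ∧ 4 * κ ≤ ε :=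
    ⟨min (δ₁ / 3) (min (δ₂ / 12) (ε / 4)), by positivity,
      by linarith [min_le_left (δ₁ / 3) (min (δ₂ / 12) (ε / 4))],
      by linarith [min_le_right (δ₁ / 3) (min (δ₂ / 12) (ε / 4)), min_le_left (δ₂ / 12) (ε / 4)],
      by linarith [min_le_right (δ₁ / 3) (min (δ₂ / 12) (ε / 4)), min_le_right (δ₂ / 12) (ε / 4)]⟩
  obtain ⟨η, hη, hu⟩ := Metric.uniformContinuous_iff.1
    (CompactSpace.uniformContinuous_of_continuous μ.continuous) κ hκ
  obtain ⟨N₀, hN₀⟩ := exists_nat_one_div_lt hη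
  set N := N₀ + 1 with hNdef
  have hN : 0 < N := Nat.succ_pos _
  have hNr : (0 : ℝ) < N := by exact_mod_cast hN
  have hNη : 1 / (N : ℝ) < η := by rw [hNdef]; push_cast; exact hN₀
  set g : ℕ → I := fun i => projIcc 0 1 zero_le_one ((i : ℝ) / N) with hg
  have hg1 : ∀ i, dist (g i) (g (i + 1)) < η := by
    intro i
    refine lt_of_le_of_lt ((LipschitzWith.projIcc zero_le_one).dist_le_mul _ _) ?_
    rw [Real.dist_eq]
    have : (i : ℝ) / N - ((i + 1 : ℕ) : ℝ) / N = -(1 / N) := by push_cast; field_simp; ring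
    rw [this, abs_neg, abs_of_pos (by positivity)]
    simpa using hNη
  have hdens : ∀ i j : ℕ, ∃ y ∈ D.U, dist y (μ (g i, g j) : Fin n → ℝ) < κ := fun i j =>
    D.exists_dist_lt_of_mem_K (μ (g i, g j)).2 hκ
  choose a haU ha using hdens
  have hadj : ∀ i j i' j', dist ((g i, g j) : I × I) (g i', g j') < η →
      dist (a i' j') (a i j) < 3 * κ := by
    intro i j i' j' h
    have h1 := hu h
    rw [Subtype.dist_eq] at h1
    have h2 := dist_triangle4 (a i' j') (μ (g i', g j') : Fin n → ℝ) (μ (g i, g j)) (a i j)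
    linarith [ha i j, ha i' j', dist_comm (μ (g i', g j') : Fin n → ℝ) (μ (g i, g j)),
      dist_comm (μ (g i, g j) : Fin n → ℝ) (a i j)]
  have hadjH : ∀ i j, dist (a (i + 1) j) (a i j) < 3 * κ := fun i j =>
    hadj _ _ _ _ (by rw [Prod.dist_eq]; exact max_lt (hg1 i) (by simpa using hη))
  have hadjV : ∀ i j, dist (a i (j + 1)) (a i j) < 3 * κ := fun i j =>
    hadj _ _ _ _ (by rw [Prod.dist_eq]; exact max_lt (by simpa using hη) (hg1 j))
  have hH : ∀ i j, ∃ γ : Path (a i j) (a (i + 1) j), ∀ t, γ t ∈ D.U ∩ ball (a i j) (δ₂ / 4) :=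
    fun i j => hjoin _ (haU i j) _ (haU (i + 1) j) ((hadjH i j).trans_le hκ1)
  have hV : ∀ i j, ∃ γ : Path (a i j) (a i (j + 1)), ∀ t, γ t ∈ D.U ∩ ball (a i j) (δ₂ / 4) :=
    fun i j => hjoin _ (haU i j) _ (haU i (j + 1)) ((hadjV i j).trans_le hκ1)
  choose h hh using hH
  choose v hv using hV
  choose b hb0 hb1 hb2 hb3 using fun i j =>
    exists_map_of_edges (h i j) (h i (j + 1)) (v i j) (v (i + 1) j)
  have hb00 : ∀ i j, b i j (0, 0) = a i j := fun i j => by rw [hb0]; exact (h i j).source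
  have hbB : ∀ i j, ∀ p ∈ sqBd, b i j p ∈ D.U ∩ ball (b i j (0, 0)) δ₂ := by
    rintro i j ⟨s, t⟩ hp
    rw [hb00]
    rcases hp with hp | hp | hp | hp <;> simp only at hp <;> subst hp
    · rw [hb2]
      exact ⟨(hv i j t).1, ball_subset_ball (by linarith) (hv i j t).2⟩
    · rw [hb3]
      refine ⟨(hv (i + 1) j t).1, ?_⟩
      have h1 := mem_ball.1 (hv (i + 1) j t).2
      rw [mem_ball]
      linarith [dist_triangle (v (i + 1) j t) (a (i + 1) j) (a i j), hadjH i j]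
    · rw [hb0]
      exact ⟨(hh i j s).1, ball_subset_ball (by linarith) (hh i j s).2⟩
    · rw [hb1]
      refine ⟨(hh i (j + 1) s).1, ?_⟩
      have h1 := mem_ball.1 (hh i (j + 1) s).2
      rw [mem_ball]
      linarith [dist_triangle (h i (j + 1) s) (a i (j + 1)) (a i j), hadjV i j]
  choose m ν hm hmb hmB using fun i j => hcell (b i j) (hbB i j)
  have hglue : ∀ m' : ℕ → ℕ → C(I × I, ↥D.K), (∀ i j, ∀ p ∈ sqBd, m' i j p = m i j p) →
      ∃ M : C(I × I, ↥D.K), ∀ q : (Fin N × Fin N) × (I × I),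
        M (gridPt N q) = m' q.1.1 q.1.2 q.2 := by
    intro m' hm'
    refine exists_grid_glue hN m' (fun i j t => ?_) fun i j s => ?_
    · rw [hm' _ _ _ (Or.inr (Or.inl rfl)), hm' _ _ _ (Or.inl rfl)]
      apply Subtype.ext
      rw [hmB _ _ _ (Or.inr (Or.inl rfl)), hmB _ _ _ (Or.inl rfl), hb3, hb2]
    · rw [hm' _ _ _ (Or.inr (Or.inr (Or.inr rfl))), hm' _ _ _ (Or.inr (Or.inr (Or.inl rfl)))]
      apply Subtype.ext
      rw [hmB _ _ _ (Or.inr (Or.inr (Or.inr rfl))), hmB _ _ _ (Or.inr (Or.inr (Or.inl rfl))),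
        hb1, hb0]
  obtain ⟨M, hM⟩ := hglue m fun _ _ _ _ => rfl
  refine ⟨N, M, fun c => ν c.1 c.2 (), fun p => ?_, ?_⟩
  · obtain ⟨⟨⟨i, j⟩, s, t⟩, rfl⟩ := gridPt_surjective hN p
    have hgi : ∀ (i : Fin N) (s : I), dist (⟨_, grid_mem i.2 s⟩ : I) (g i) < η := by
      intro i s
      have h1 := grid_mem i.2 0
      have h2 : g i = ⟨_, h1⟩ := by
        rw [hg]
        simp only [Icc.coe_zero, add_zero] at h1 ⊢
        exact projIcc_of_mem _ h1
      rw [h2, Subtype.dist_eq, Real.dist_eq]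
      have : ((i : ℕ) + (s : ℝ)) / N - ((i : ℕ) + ((0 : I) : ℝ)) / N = s / N := by
        rw [Icc.coe_zero]; ring
      rw [this, abs_of_nonneg (div_nonneg s.2.1 hNr.le)]
      exact ((div_le_div_iff_of_pos_right hNr).2 s.2.2).trans_lt hNη
    have h1 := hu (a := gridPt N ((i, j), s, t)) (b := (g i, g j))
      (by rw [Prod.dist_eq]; exact max_lt (hgi i s) (hgi j t))
    rw [hM, Subtype.dist_eq]
    rw [Subtype.dist_eq] at h1
    have h2 := mem_ball.1 (hmb i j (s, t))
    rw [hb00] at h2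
    have h3 := dist_triangle4 (μ (gridPt N ((i, j), s, t)) : Fin n → ℝ) (μ (g i, g j)) (a i j)
      (m i j (s, t))
    have h4 := ha i j
    rw [dist_comm] at h2 h4
    linarith
  · intro ε' hε'
    choose δ hδ hgood using fun c : Fin N × Fin N => hm c.1 c.2 ε' hε'
    obtain ⟨d, hd, hdδ⟩ := exists_pos_forall_lt_of_finite hδ
    refine ⟨d, hd, fun ν' hν' => ?_⟩
    have hex : ∀ i j : ℕ, ∃ m' : C(I × I, ↥D.K), (∀ p ∈ sqBd, m' p = m i j p) ∧
        ∀ (hi : i < N) (hj : j < N), (∀ p, dist (m i j p) (m' p) < ε') ∧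
          ∀ p, (m' p : Fin n → ℝ) ∈ range D.e →
            ∃ q, (m' p : Fin n → ℝ) = f (ν' (⟨i, hi⟩, ⟨j, hj⟩) q) := by
      intro i j
      by_cases hij : i < N ∧ j < N
      · obtain ⟨m', h1, h2, h3⟩ := hgood (⟨i, hij.1⟩, ⟨j, hij.2⟩)
          (fun _ => ν' (⟨i, hij.1⟩, ⟨j, hij.2⟩)) fun _ p => (hν' _ p).trans (hdδ _)
        exact ⟨m', h2, fun hi hj => ⟨h1, fun p hp => (h3 p hp).choose_spec⟩⟩
      · exact ⟨m i j, fun _ _ => rfl, fun hi hj => absurd ⟨hi, hj⟩ hij⟩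
    choose m' hm'B hm' using hex
    obtain ⟨M', hM'⟩ := hglue m' hm'B
    refine ⟨M', fun p => ?_, by simp, fun p hp => ?_⟩
    · obtain ⟨⟨⟨i, j⟩, r⟩, rfl⟩ := gridPt_surjective hN p
      rw [hM, hM']
      exact (hm' i j i.2 j.2).1 r
    · obtain ⟨⟨⟨i, j⟩, r⟩, rfl⟩ := gridPt_surjective hN p
      rw [hM'] at hp ⊢
      exact ⟨(i, j), (hm' i j i.2 j.2).2 r hp⟩

end IsRelMap

section FamilyDDP

variable {X : Type*} [MetricSpace X]

/-- The pairs of singular disks with disjoint images. -/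
def disjointPairs (X : Type*) [MetricSpace X] : Set (C(I × I, X) × C(I × I, X)) :=
  {a | ∀ p q, a.1 p ≠ a.2 q}

lemma isOpen_disjointPairs : IsOpen (disjointPairs X) := by
  have hc : IsClosed {z : (C(I × I, X) × C(I × I, X)) × ((I × I) × (I × I)) |
      z.1.1 z.2.1 = z.1.2 z.2.2} := isClosed_eq (by fun_prop) (by fun_prop)
  have := (isClosedMap_fst_of_compactSpace _ hc).isOpen_compl
  convert this using 1
  ext a
  simp [disjointPairs]

lemma DisjointDisksProperty.dense_disjointPairs (h : DisjointDisksProperty X) :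
    Dense (disjointPairs X) := by
  intro a
  rw [Metric.mem_closure_iff]
  intro ε hε
  obtain ⟨b, c, hb, hc, hbc⟩ := h a.1 a.2 ε hε
  refine ⟨(b, c), fun p q hpq => ?_, ?_⟩
  · have : b p ∈ range b ∩ range c := ⟨⟨p, rfl⟩, ⟨q, hpq.symm⟩⟩
    rw [hbc] at this
    exact this
  · rw [Prod.dist_eq]
    exact max_lt ((ContinuousMap.dist_lt_iff hε).2 hb) ((ContinuousMap.dist_lt_iff hε).2 hc)

lemma DisjointDisksProperty.exists_families [CompactSpace X] (h : DisjointDisksProperty X)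
    {ι κ : Type*} [Fintype ι] [Fintype κ] (ν₁ : ι → C(I × I, X)) (ν₂ : κ → C(I × I, X)) {δ : ℝ}
    (hδ : 0 < δ) : ∃ (ν₁' : ι → C(I × I, X)) (ν₂' : κ → C(I × I, X)),
      (∀ i p, dist (ν₁ i p) (ν₁' i p) < δ) ∧ (∀ j p, dist (ν₂ j p) (ν₂' j p) < δ) ∧
        ∀ i j p q, ν₁' i p ≠ ν₂' j q := by
  have hproj : ∀ c : ι × κ, IsOpenMap
      (Prod.map (Function.eval c.1) (Function.eval c.2) :
        (ι → C(I × I, X)) × (κ → C(I × I, X)) → C(I × I, X) × C(I × I, X)) :=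
    fun c => (isOpenMap_eval c.1).prodMap (isOpenMap_eval c.2)
  have hcont : ∀ c : ι × κ, Continuous
      (Prod.map (Function.eval c.1) (Function.eval c.2) :
        (ι → C(I × I, X)) × (κ → C(I × I, X)) → C(I × I, X) × C(I × I, X)) :=
    fun c => (continuous_apply c.1).prodMap (continuous_apply c.2)
  have hd := dense_iInter_of_isOpen (fun c => isOpen_disjointPairs.preimage (hcont c))
    fun c => h.dense_disjointPairs.preimage (hproj c)
  obtain ⟨z, hz, hzd⟩ := Metric.mem_closure_iff.1 (hd (ν₁, ν₂)) δ hδ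
  rw [Prod.dist_eq, max_lt_iff, dist_pi_lt_iff hδ, dist_pi_lt_iff hδ] at hzd
  refine ⟨z.1, z.2, fun i => (ContinuousMap.dist_lt_iff hδ).1 (hzd.1 i),
    fun j => (ContinuousMap.dist_lt_iff hδ).1 (hzd.2 j), fun i j => ?_⟩
  exact mem_iInter.1 hz (i, j)

end FamilyDDP

lemma exists_contDiff_square_approx {n : ℕ} {m : I × I → Fin n → ℝ} (hm : Continuous m) {ε : ℝ}
    (hε : 0 < ε) : ∃ g : ℝ × ℝ → Fin n → ℝ, ContDiff ℝ 1 g ∧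
      ∀ p : I × I, dist (m p) (g (p.1, p.2)) < ε := by
  obtain ⟨g, hg, hgd, -⟩ := Continuous.exists_contDiff_approx 1
    (f := fun x : ℝ × ℝ => m (projIcc 0 1 zero_le_one x.1, projIcc 0 1 zero_le_one x.2))
    (ε := fun _ => ε) (hm.comp ((continuous_projIcc.comp continuous_fst).prodMk
      (continuous_projIcc.comp continuous_snd))) continuous_const fun _ => hε
  refine ⟨g, hg, fun p => ?_⟩
  have := hgd (p.1, p.2)
  rw [dist_comm]
  simpa using this

namespace PlanarCube

variable {n : ℕ}

/-- Singular disks whose images do not meet in the boundary can be made disjoint. -/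
lemma exists_disjoint_approx (D : PlanarCube n) (hn : 4 < n) (m₁ m₂ : C(I × I, ↥D.K))
    (h : ∀ p q, (m₁ p : Fin n → ℝ) = m₂ q → (m₁ p : Fin n → ℝ) ∉ range D.e) {ε : ℝ}
    (hε : 0 < ε) : ∃ m₁' m₂' : C(I × I, ↥D.K), (∀ p, dist (m₁ p) (m₁' p) < ε) ∧
      (∀ p, dist (m₂ p) (m₂' p) < ε) ∧ ∀ p q, m₁' p ≠ m₂' q := by
  have hne : (range D.e).Nonempty := by
    have : Nonempty (sphere (0 : EuclideanSpace ℝ (Fin n)) 1) := by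
      have : Nontrivial (EuclideanSpace ℝ (Fin n)) := by
        have : Nonempty (Fin n) := ⟨⟨0, by omega⟩⟩
        infer_instance
      exact (NormedSpace.sphere_nonempty.2 zero_le_one).to_subtype
    exact range_nonempty _
  obtain ⟨c, hc, hF⟩ : ∃ c > 0, ∀ p q,
      c ≤ dist (m₁ p : Fin n → ℝ) (m₂ q) + infDist (m₁ p : Fin n → ℝ) (range D.e) := by
    obtain ⟨z, -, hz⟩ := (isCompact_univ (X := (I × I) × (I × I))).exists_isMinOn univ_nonempty
      (f := fun z => dist (m₁ z.1 : Fin n → ℝ) (m₂ z.2) +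
        infDist (m₁ z.1 : Fin n → ℝ) (range D.e))
      (by
        have := continuous_infDist_pt (range D.e)
        have h1 : Continuous fun z : (I × I) × (I × I) => (m₁ z.1 : Fin n → ℝ) := by fun_prop
        have h2 : Continuous fun z : (I × I) × (I × I) => (m₂ z.2 : Fin n → ℝ) := by fun_prop
        exact ((h1.dist h2).add (this.comp h1)).continuousOn)
    refine ⟨_, ?_, fun p q => hz (mem_univ (p, q))⟩
    have h1 : 0 ≤ dist (m₁ z.1 : Fin n → ℝ) (m₂ z.2) := dist_nonneg
    have h2 : 0 ≤ infDist (m₁ z.1 : Fin n → ℝ) (range D.e) := infDist_nonneg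
    refine lt_of_le_of_ne (add_nonneg h1 h2) fun h3 => ?_
    refine h z.1 z.2 (dist_le_zero.1 (by linarith)) ?_
    rw [D.isCompact_range.isClosed.mem_iff_infDist_zero hne]
    linarith
  set η := c / 4 with hη_def
  have hη : 0 < η := by positivity
  set d := min (η / 4) (ε / 2) with hd_def
  have hd : 0 < d := lt_min (by positivity) (by positivity)
  have hdη : d ≤ η / 4 := min_le_left _ _
  have hdε : d ≤ ε / 2 := min_le_right _ _
  obtain ⟨g₁, hg₁, hgd₁⟩ := exists_contDiff_square_approx (m := fun p => (m₁ p : Fin n → ℝ))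
    (by fun_prop) hd
  obtain ⟨g, hg, hgd⟩ := exists_contDiff_square_approx (m := fun p => (m₂ p : Fin n → ℝ))
    (by fun_prop) (half_pos hd)
  have hdense : Dense (range fun z : (ℝ × ℝ) × (ℝ × ℝ) => g₁ z.1 - g z.2)ᶜ :=
    ContDiff.dense_compl_range_of_finrank_lt_finrank
      ((hg₁.comp contDiff_fst).sub (hg.comp contDiff_snd)) (by simpa using hn)
  obtain ⟨v, hv, hvd⟩ := Metric.mem_closure_iff.1 (hdense 0) (d / 2) (half_pos hd)
  have hgd₂ : ∀ p : I × I, dist (m₂ p : Fin n → ℝ) (g (p.1, p.2) + v) < d := fun p => by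
    have h1 := dist_triangle (m₂ p : Fin n → ℝ) (g (p.1, p.2)) (g (p.1, p.2) + v)
    have h2 := hgd p
    rw [dist_self_add_right] at h1
    rw [dist_zero_left] at hvd
    linarith
  have key : ∀ (m : C(I × I, ↥D.K)) (G : I × I → Fin n → ℝ), Continuous G →
      (∀ p, dist (m p : Fin n → ℝ) (G p) < d) → ∃ m' : C(I × I, ↥D.K),
        (∀ p, dist (m p) (m' p) ≤ d) ∧
        ∀ p, 2 * η ≤ infDist (m p : Fin n → ℝ) (range D.e) → (m' p : Fin n → ℝ) = G p := by
    intro m G hG hmG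
    set χ : I × I → ℝ := fun p => clamp (infDist (m p : Fin n → ℝ) (range D.e) / η - 1) with hχ
    have hχc : Continuous χ := by
      have h0 := continuous_infDist_pt (range D.e)
      have h1 : Continuous fun p : I × I => (m p : Fin n → ℝ) := by fun_prop
      exact (((h0.comp h1).div_const η).sub continuous_const).clamp
    set φ : I × I → Fin n → ℝ := fun p => m p + χ p • (G p - m p) with hφ
    have hφd : ∀ p, dist (m p : Fin n → ℝ) (φ p) ≤ d := fun p => by
      have h1 := hmG p
      rw [hφ, dist_self_add_right, norm_smul, Real.norm_eq_abs,
        abs_of_nonneg (clamp_mem _).1, ← dist_eq_norm, dist_comm]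
      exact (mul_le_of_le_one_left dist_nonneg (clamp_mem _).2).trans h1.le
    have hφK : ∀ p, φ p ∈ D.K := by
      intro p
      rcases le_or_gt (infDist (m p : Fin n → ℝ) (range D.e)) η with h1 | h1
      · have : χ p = 0 := clamp_of_le (by
          have := (div_le_one hη).2 h1
          linarith)
        rw [hφ]
        simp only [this, zero_smul, add_zero]
        exact (m p).2
      · right
        refine D.mem_U_of_dist (x := m p) ?_ ((hφd p).trans_lt (by linarith))
        refine (m p).2.resolve_left fun h2 => ?_
        rw [infDist_zero_of_mem h2] at h1
        linarith
    have hm : Continuous fun p : I × I => (m p : Fin n → ℝ) := by fun_prop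
    refine ⟨⟨fun p => ⟨φ p, hφK p⟩, (hm.add (hχc.smul (hG.sub hm))).subtype_mk _⟩,
      fun p => hφd p, fun p hp => ?_⟩
    have : χ p = 1 := clamp_of_ge (by
      have := (le_div_iff₀ hη).2 hp
      linarith)
    change φ p = G p
    rw [hφ]
    simp [this]
  obtain ⟨m₁', h₁, h₁'⟩ := key m₁ (fun p => g₁ (p.1, p.2))
    (hg₁.continuous.comp (by fun_prop)) hgd₁
  obtain ⟨m₂', h₂, h₂'⟩ := key m₂ (fun p => g (p.1, p.2) + v)
    ((hg.continuous.comp (by fun_prop)).add continuous_const) hgd₂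
  refine ⟨m₁', m₂', fun p => (h₁ p).trans_lt (by linarith), fun p => (h₂ p).trans_lt (by linarith),
    fun p q hpq => ?_⟩
  have e1 : dist (m₁ p : Fin n → ℝ) (m₁' p) ≤ d := h₁ p
  have e2 : dist (m₂ q : Fin n → ℝ) (m₂' q) ≤ d := h₂ q
  rw [← hpq] at e2
  have e3 := dist_triangle_right (m₁ p : Fin n → ℝ) (m₂ q) (m₁' p)
  have e4 := hF p q
  have e5 := infDist_le_infDist_add_dist (s := range D.e) (x := (m₁ p : Fin n → ℝ)) (y := m₂ q)
  have e6 := h₁' p (by linarith)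
  have e7 := h₂' q (by linarith)
  rw [← hpq, e6] at e7
  exact hv ⟨((p.1, p.2), (q.1, q.2)), by simp [e7]⟩

end PlanarCube

/-- Relative maps transport the disjoint disks property in dimension at least five. -/
lemma IsRelMap.disjointDisksProperty {n : ℕ} {C D : PlanarCube n} {f : (Fin n → ℝ) → Fin n → ℝ}
    (hf : IsRelMap C D f) (hn : 4 < n) (hC : DisjointDisksProperty ↥C.K) :
    DisjointDisksProperty ↥D.K := by
  have : CompactSpace ↥C.K := isCompact_iff_compactSpace.1 C.isCompact_K
  intro μ₁ μ₂ ε hε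
  have hε3 : 0 < ε / 3 := by positivity
  obtain ⟨N₁, M₁, ν₁, hM₁, hG₁⟩ := hf.exists_good_approx (by omega) μ₁ hε3
  obtain ⟨N₂, M₂, ν₂, hM₂, hG₂⟩ := hf.exists_good_approx (by omega) μ₂ hε3
  obtain ⟨δ₁, hδ₁, H₁⟩ := hG₁ _ hε3
  obtain ⟨δ₂, hδ₂, H₂⟩ := hG₂ _ hε3
  obtain ⟨ν₁', ν₂', hν₁, hν₂, hν⟩ := hC.exists_families ν₁ ν₂ (lt_min hδ₁ hδ₂)
  obtain ⟨m₁, hm₁, -, hb₁⟩ := H₁ ν₁' fun i p => (hν₁ i p).trans_le (min_le_left _ _)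
  obtain ⟨m₂, hm₂, -, hb₂⟩ := H₂ ν₂' fun i p => (hν₂ i p).trans_le (min_le_right _ _)
  obtain ⟨φ₁, φ₂, hφ₁, hφ₂, hφ⟩ := D.exists_disjoint_approx hn m₁ m₂ (fun p q hpq hp => by
    obtain ⟨i, a, ha⟩ := hb₁ p hp
    obtain ⟨j, b, hb⟩ := hb₂ q (hpq ▸ hp)
    have hbd : ∀ x : ↥C.K, f x ∈ range D.e → (x : Fin n → ℝ) ∈ range C.e := fun x hx =>
      x.2.resolve_right fun hU => D.not_mem_U hx (hf.mapsTo_U _ hU)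
    refine hν i j a b (Subtype.ext (hf.injOn_bd (hbd _ (ha ▸ hp)) (hbd _ (hb ▸ hpq ▸ hp)) ?_))
    rw [← ha, ← hb, hpq]) hε3
  refine ⟨φ₁, φ₂, fun p => ?_, fun p => ?_, ?_⟩
  · linarith [dist_triangle4 (μ₁ p) (M₁ p) (m₁ p) (φ₁ p), hM₁ p, hm₁ p, hφ₁ p]
  · linarith [dist_triangle4 (μ₂ p) (M₂ p) (m₂ p) (φ₂ p), hM₂ p, hm₂ p, hφ₂ p]
  · rw [← disjoint_iff_inter_eq_empty, disjoint_range_iff]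
    exact hφ

/-- In dimension at most four, no crumpled cube has the disjoint disks property. -/
lemma PlanarCube.not_disjointDisksProperty {n : ℕ} (C : PlanarCube n) (hn : n ≤ 4) :
    ¬ DisjointDisksProperty ↥C.K := by
  intro h
  obtain ⟨x₀, hx₀⟩ := C.U_conn.nonempty
  obtain ⟨r, hr, hrU⟩ := Metric.nhds_basis_closedBall.mem_iff.1 (C.U_open.mem_nhds hx₀)
  set a : I × I → Fin n → ℝ := fun p j =>
    if (j : ℕ) = 0 then 2 * (p.1 : ℝ) - 1 else if (j : ℕ) = 1 then 2 * (p.2 : ℝ) - 1 else 0 with ha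
  set b : I × I → Fin n → ℝ := fun p j =>
    if (j : ℕ) = 2 then 1 - 2 * (p.1 : ℝ) else if (j : ℕ) = 3 then 1 - 2 * (p.2 : ℝ) else 0 with hb
  have hac : Continuous a := continuous_pi fun j => by
    simp only [ha]; split_ifs <;> fun_prop
  have hbc : Continuous b := continuous_pi fun j => by
    simp only [hb]; split_ifs <;> fun_prop
  have hI : ∀ t : I, |2 * (t : ℝ) - 1| ≤ 1 := fun t => abs_le.2 ⟨by linarith [t.2.1], by linarith [t.2.2]⟩
  have hI' : ∀ t : I, |1 - 2 * (t : ℝ)| ≤ 1 := fun t => by rw [abs_sub_comm]; exact hI t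
  have haK : ∀ p, x₀ + r • a p ∈ C.K := fun p => by
    refine Or.inr (hrU ?_)
    rw [mem_closedBall, dist_self_add_left, norm_smul, Real.norm_eq_abs, abs_of_pos hr]
    refine mul_le_of_le_one_right hr.le ((pi_norm_le_iff_of_nonneg zero_le_one).2 fun j => ?_)
    simp only [ha, Real.norm_eq_abs]
    split_ifs
    exacts [hI _, hI _, by simp]
  have hbK : ∀ p, x₀ + r • b p ∈ C.K := fun p => by
    refine Or.inr (hrU ?_)
    rw [mem_closedBall, dist_self_add_left, norm_smul, Real.norm_eq_abs, abs_of_pos hr]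
    refine mul_le_of_le_one_right hr.le ((pi_norm_le_iff_of_nonneg zero_le_one).2 fun j => ?_)
    simp only [hb, Real.norm_eq_abs]
    split_ifs
    exacts [hI' _, hI' _, by simp]
  obtain ⟨α, β, hα, hβ, hdisj⟩ := h
    ⟨fun p => ⟨_, haK p⟩, (continuous_const.add (hac.const_smul r)).subtype_mk _⟩
    ⟨fun p => ⟨_, hbK p⟩, (continuous_const.add (hbc.const_smul r)).subtype_mk _⟩ (r / 2)
    (half_pos hr)
  set pr : ℝ → I := fun t => projIcc 0 1 zero_le_one ((t + 1) / 2) with hpr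
  have hprc : Continuous pr := continuous_projIcc.comp (by fun_prop)
  have hpr1 : ∀ t, |t| ≤ 1 → 2 * (pr t : ℝ) - 1 = t := fun t ht => by
    have ht' := abs_le.1 ht
    rw [hpr]
    simp only
    rw [projIcc_of_mem _ ⟨by linarith, by linarith⟩]
    ring
  set co : ℕ → (Fin n → ℝ) → ℝ := fun k s => if hk : k < n then s ⟨k, hk⟩ else 0 with hco
  have hcoc : ∀ k, Continuous (co k) := fun k => by
    simp only [hco]; split_ifs <;> fun_prop
  set P : (Fin n → ℝ) → I × I := fun s => (pr (co 0 s), pr (co 1 s)) with hP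
  set Q : (Fin n → ℝ) → I × I := fun s => (pr (co 2 s), pr (co 3 s)) with hQ
  have hPc : Continuous P := (hprc.comp (hcoc 0)).prodMk (hprc.comp (hcoc 1))
  have hQc : Continuous Q := (hprc.comp (hcoc 2)).prodMk (hprc.comp (hcoc 3))
  have hab : ∀ s : Fin n → ℝ, ‖s‖ ≤ 1 → a (P s) - b (Q s) = s := fun s hs => by
    have hk : ∀ j : Fin n, 2 * (pr (s j) : ℝ) - 1 = s j := fun j =>
      hpr1 _ ((norm_le_pi_norm s j).trans hs)
    funext j
    obtain ⟨k, hkn⟩ := j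
    have := hk ⟨k, hkn⟩
    have hk4 : k < 4 := by omega
    interval_cases k <;> simp [ha, hb, hP, hQ, hco, hkn] <;> linarith
  set g : (Fin n → ℝ) → Fin n → ℝ := fun s => r⁻¹ • ((α (P s) : Fin n → ℝ) - β (Q s)) with hg
  have hgc : Continuous g := by
    have h1 : Continuous fun s => (α (P s) : Fin n → ℝ) := by fun_prop
    have h2 : Continuous fun s => (β (Q s) : Fin n → ℝ) := by fun_prop
    exact (h1.sub h2).const_smul r⁻¹
  have h1 : mdeg (fun x : Fin n → ℝ => x - 0) (ball 0 1) = 1 :=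
    mdeg_id_sub isOpen_ball (mem_ball_self one_pos)
  rw [mdeg_rouche (g' := g) (by fun_prop) hgc isBounded_ball, mdeg_eq_zero hgc isBounded_ball] at h1
  · exact zero_ne_one h1
  · intro s _ hs
    have h2 : (α (P s) : Fin n → ℝ) = β (Q s) :=
      sub_eq_zero.1 ((smul_eq_zero.1 hs).resolve_left (inv_ne_zero hr.ne'))
    have h3 : α (P s) ∈ range α ∩ range β := ⟨⟨_, rfl⟩, ⟨Q s, (Subtype.ext h2).symm⟩⟩
    rw [hdisj] at h3
    exact h3
  · intro s hs
    have hs1 : ‖s‖ = 1 := by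
      have hs' := frontier_ball_subset_sphere hs
      simpa using hs'
    rw [sub_zero, hs1]
    have hA : dist (x₀ + r • a (P s)) (α (P s) : Fin n → ℝ) < r / 2 := hα (P s)
    have hB : dist (x₀ + r • b (Q s)) (β (Q s) : Fin n → ℝ) < r / 2 := hβ (Q s)
    rw [dist_eq_norm] at hA hB
    have h4 : s - g s = r⁻¹ • ((x₀ + r • a (P s) - α (P s)) - (x₀ + r • b (Q s) - β (Q s))) := by
      have h5 : (x₀ + r • a (P s) - α (P s)) - (x₀ + r • b (Q s) - β (Q s)) =
          r • (a (P s) - b (Q s)) - ((α (P s) : Fin n → ℝ) - β (Q s)) := by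
        rw [smul_sub]; abel
      rw [h5, hab s hs1.le, smul_sub, inv_smul_smul₀ hr.ne']
    rw [h4, norm_smul, norm_inv, Real.norm_eq_abs, abs_of_pos hr, inv_mul_lt_iff₀ hr, mul_one]
    exact (norm_sub_le _ _).trans_lt (by linarith)

/-- Stereographic projection from `q`, as a pair of maps between ambient spaces. -/
lemma exists_puncture (n : ℕ) {q : Amb n} (hq : q ∈ Sph n) :
    ∃ (φ : Amb n → Fin n → ℝ) (ψ : (Fin n → ℝ) → Amb n), ContinuousOn φ (Sph n \ {q}) ∧
      Continuous ψ ∧ (∀ y, ψ y ∈ Sph n \ {q}) ∧ (∀ y, φ (ψ y) = y) ∧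
      ∀ x ∈ Sph n \ {q}, ψ (φ x) = x := by
  classical
  have : Fact (Module.finrank ℝ (Amb n) = n + 1) := ⟨by simp⟩
  set s := stereographic' n (⟨q, hq⟩ : sphere (0 : Amb n) 1) with hs
  set τ : (Fin n → ℝ) ≃ₜ EuclideanSpace ℝ (Fin n) :=
    (EuclideanSpace.equiv (Fin n) ℝ).symm.toHomeomorph
  have hsrc : s.source = {⟨q, hq⟩}ᶜ := stereographic'_source _
  have htgt : s.target = univ := stereographic'_target _
  have hmem : ∀ y, s.symm (τ y) ∈ s.source := fun y => s.map_target (by rw [htgt]; trivial)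
  refine ⟨fun x => if hx : x ∈ Sph n then τ.symm (s ⟨x, hx⟩) else 0, fun y => s.symm (τ y),
    ?_, ?_, fun y => ⟨(s.symm (τ y)).2, fun h => ?_⟩, fun y => ?_, fun x hx => ?_⟩
  · rw [continuousOn_iff_continuous_domRestrict]
    have h1 : Continuous fun x : ↥(Sph n \ {q}) => s ⟨x, x.2.1⟩ :=
      s.continuousOn.comp_continuous (by fun_prop) fun x => by
        rw [hsrc]
        exact fun h => x.2.2 (congrArg Subtype.val h)
    refine (τ.symm.continuous.comp h1).congr fun x => ?_
    simp only [domRestrict_apply, Function.comp]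
    rw [dif_pos x.2.1]
  · refine continuous_subtype_val.comp (s.continuousOn_symm.comp_continuous τ.continuous ?_)
    intro y
    rw [htgt]
    trivial
  · have h1 := hmem y
    rw [hsrc] at h1
    exact h1 (Subtype.ext h)
  · have h1 : ((s.symm (τ y) : sphere (0 : Amb n) 1) : Amb n) ∈ Sph n := (s.symm (τ y)).2
    simp only
    rw [dif_pos h1]
    have h2 : s (s.symm (τ y)) = τ y := s.right_inv (by rw [htgt]; trivial)
    exact (congrArg τ.symm h2).trans (τ.symm_apply_apply y)
  · simp only
    rw [dif_pos hx.1, τ.apply_symm_apply, s.left_inv]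
    rw [hsrc]
    exact fun h => hx.2 (congrArg Subtype.val h)

namespace CrumpledCube

lemma carrier_subset {n : ℕ} (C : CrumpledCube n) : C.carrier ⊆ Sph n := by
  obtain ⟨x, -, h⟩ := C.int_component
  refine union_subset C.bd_subset_sphere ?_
  rw [h]
  exact (connectedComponentIn_subset _ _).trans sdiff_subset

lemma int_subset {n : ℕ} (C : CrumpledCube n) : C.int ⊆ Sph n \ C.bd := by
  obtain ⟨x, -, h⟩ := C.int_component
  rw [h]
  exact connectedComponentIn_subset _ _

lemma isConnected_int {n : ℕ} (C : CrumpledCube n) : IsConnected C.int := by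
  obtain ⟨x, hx, h⟩ := C.int_component
  rw [h]
  exact isConnected_connectedComponentIn_iff.2 hx

/-- A parametrization of the boundary, with the dimension in successor form. -/
lemma exists_param {m : ℕ} (C : CrumpledCube (m + 1)) :
    ∃ e : sphere (0 : EuclideanSpace ℝ (Fin (m + 1))) 1 → Amb (m + 1),
      Continuous e ∧ Function.Injective e ∧ range e = C.bd :=
  C.exists_embedding

/-- A crumpled cube misses a neighborhood of some point of the sphere. -/
lemma exists_far_point {m : ℕ} (C : CrumpledCube (m + 1)) :
    ∃ q ∈ Sph (m + 1), ∃ O : Set (Amb (m + 1)), IsOpen O ∧ q ∈ O ∧ Disjoint O C.carrier := by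
  obtain ⟨e, he, hinj, hrange⟩ := C.exists_param
  obtain ⟨x₀, hx₀⟩ := C.isConnected_int.nonempty
  have hx₀S := C.int_subset hx₀
  obtain ⟨φ, ψ, hφ, hψ, hψm, hφψ, hψφ⟩ := exists_puncture (m + 1) hx₀S.1
  have hem : ∀ s, e s ∈ Sph (m + 1) \ {x₀} := fun s => by
    have h1 : e s ∈ C.bd := hrange ▸ mem_range_self s
    exact ⟨C.bd_subset_sphere h1, fun h => hx₀S.2 (h ▸ h1)⟩
  set e' : sphere (0 : EuclideanSpace ℝ (Fin (m + 1))) 1 → Fin (m + 1) → ℝ := fun s => φ (e s)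
    with he'
  have he'c : Continuous e' := hφ.comp_continuous he hem
  have he'i : Function.Injective e' := fun s t hst => hinj (by
    rw [← hψφ _ (hem s), ← hψφ _ (hem t)]; exact congrArg ψ hst)
  obtain ⟨w, hw, R, hR⟩ := exists_not_joinedIn_far e' he'c he'i
  have hF : IsOpen (range e')ᶜ := (isCompact_range he'c).isClosed.isOpen_compl
  set V := connectedComponentIn (range e')ᶜ w with hV
  have hVo : IsOpen V := hF.connectedComponentIn
  have hwV : w ∈ V := mem_connectedComponentIn hw
  have hVF : V ⊆ (range e')ᶜ := connectedComponentIn_subset _ _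
  have hVc : IsConnected V := isConnected_connectedComponentIn_iff.2 hw
  have hVb : Bornology.IsBounded V := by
    refine isBounded_iff_forall_norm_le.2 ⟨R, fun y hy => ?_⟩
    by_contra hcon
    exact hR y (not_le.1 hcon)
      (((hVo.isConnected_iff_isPathConnected.1 hVc).joinedIn w hwV y hy).mono hVF)
  have hVcl : IsCompact (closure V) := hVb.isCompact_closure
  have hbd : ∀ y ∈ closure V, y ∉ V → ψ y ∈ C.bd := fun y hy hyV => by
    have h1 : y ∈ frontier V := by rw [hVo.frontier_eq]; exact ⟨hy, hyV⟩
    obtain ⟨s, rfl⟩ := not_not.1 (frontier_connectedComponentIn_subset hF w h1).2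
    rw [he', hψφ _ (hem s), ← hrange]
    exact mem_range_self s
  obtain ⟨O, hO, hOV⟩ := continuousOn_iff'.1 hφ V hVo
  have hOmem : ∀ x ∈ Sph (m + 1) \ {x₀}, x ∈ O ↔ φ x ∈ V := fun x hx => by
    have h1 := Set.ext_iff.1 hOV x
    simp only [mem_inter_iff, hx, and_true, mem_preimage] at h1
    exact h1.symm
  set u := O ∩ {x₀}ᶜ with hu
  have huo : IsOpen u := hO.inter isOpen_compl_singleton
  have huV : ∀ x ∈ Sph (m + 1), x ∈ u → φ x ∈ V ∧ ψ (φ x) = x := fun x hx hxu =>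
    ⟨(hOmem x ⟨hx, hxu.2⟩).1 hxu.1, hψφ x ⟨hx, hxu.2⟩⟩
  refine ⟨ψ w, (hψm w).1, u, huo, ⟨(hOmem _ (hψm w)).2 (by rwa [hφψ]), (hψm w).2⟩, ?_⟩
  rw [disjoint_left]
  rintro x hxu (hx | hx)
  · obtain ⟨s, rfl⟩ := hrange ▸ hx
    exact hVF (huV _ (C.bd_subset_sphere hx) hxu).1 ⟨s, rfl⟩
  · have hcover : C.int ⊆ u ∪ (ψ '' closure V)ᶜ := fun z hz => by
      by_cases hzc : z ∈ ψ '' closure V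
      · obtain ⟨y, hy, rfl⟩ := hzc
        by_cases hyV : y ∈ V
        · exact Or.inl ⟨(hOmem _ (hψm y)).2 (by rwa [hφψ]), (hψm y).2⟩
        · exact absurd (hbd y hy hyV) (C.int_subset hz).2
      · exact Or.inr hzc
    have hx₀V : x₀ ∉ ψ '' closure V := by
      rintro ⟨y, -, hy⟩
      exact (hψm y).2 hy
    obtain ⟨y, hy, hyu, hyv⟩ := C.isConnected_int.isPreconnected u (ψ '' closure V)ᶜ huo
      (hVcl.image hψ).isClosed.isOpen_compl hcover ⟨x, hx, hxu⟩ ⟨x₀, hx₀, hx₀V⟩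
    have h1 := huV y (C.int_subset hy).1 hyu
    exact hyv ⟨φ y, subset_closure h1.1, h1.2⟩

/-- A planar cube homeomorphic to a given crumpled cube. -/
structure PlanarModel {n : ℕ} (C : CrumpledCube n) where
  P : PlanarCube n
  g : ↥P.K ≃ₜ ↥C.carrier
  mem_bd_iff : ∀ y, ((g y : ↥C.carrier) : Amb n) ∈ C.bd ↔ (y : Fin n → ℝ) ∈ range P.e

lemma nonempty_planarModel {m : ℕ} (C : CrumpledCube (m + 1)) : Nonempty C.PlanarModel := by
  obtain ⟨q, hq, O, hO, hqO, hOC⟩ := C.exists_far_point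
  obtain ⟨e, he, hinj, hrange⟩ := C.exists_param
  obtain ⟨φ, ψ, hφ, hψ, hψm, hφψ, hψφ⟩ := exists_puncture (m + 1) hq
  have hCm : C.carrier ⊆ Sph (m + 1) \ {q} := fun x hx =>
    ⟨C.carrier_subset hx, fun h => disjoint_left.1 hOC (h ▸ hqO) hx⟩
  have hem : ∀ s, e s ∈ C.carrier := fun s => Or.inl (hrange ▸ mem_range_self s)
  set e' : sphere (0 : EuclideanSpace ℝ (Fin (m + 1))) 1 → Fin (m + 1) → ℝ := fun s => φ (e s)
    with he'
  have he'c : Continuous e' := hφ.comp_continuous he fun s => hCm (hem s)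
  have he'i : Function.Injective e' := fun s t hst => hinj (by
    rw [← hψφ _ (hCm (hem s)), ← hψφ _ (hCm (hem t))]; exact congrArg ψ hst)
  have hbd : ∀ y, y ∈ range e' ↔ ψ y ∈ C.bd := fun y => by
    constructor
    · rintro ⟨s, rfl⟩
      rw [he', hψφ _ (hCm (hem s)), ← hrange]
      exact mem_range_self s
    · intro h
      rw [← hrange] at h
      obtain ⟨s, hs⟩ := h
      exact ⟨s, by rw [he']; simp only; rw [hs, hφψ]⟩
  have hF : IsOpen (range e')ᶜ := (isCompact_range he'c).isClosed.isOpen_compl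
  set U := φ '' C.int with hU
  have hintC : C.int ⊆ C.carrier := subset_union_right
  have hUmem : ∀ y, y ∈ U ↔ ψ y ∈ C.int := fun y => by
    constructor
    · rintro ⟨x, hx, rfl⟩
      rwa [hψφ x (hCm (hintC hx))]
    · exact fun h => ⟨_, h, hφψ y⟩
  have hUconn : IsConnected U :=
    C.isConnected_int.image _ (hφ.mono (hintC.trans hCm))
  have hUF : U ⊆ (range e')ᶜ := fun y hy hy' =>
    (C.int_subset ((hUmem y).1 hy)).2 ((hbd y).1 hy')
  obtain ⟨x, hx, hxint⟩ := C.int_component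
  have hxi : x ∈ C.int := by rw [hxint]; exact mem_connectedComponentIn hx
  have hUeq : U = connectedComponentIn (range e')ᶜ (φ x) := by
    refine subset_antisymm
      (hUconn.isPreconnected.subset_connectedComponentIn ⟨x, hxi, rfl⟩ hUF) fun y hy => ?_
    rw [hUmem, hxint]
    refine (isPreconnected_connectedComponentIn.image ψ hψ.continuousOn).subset_connectedComponentIn
      (x := x) ⟨φ x, mem_connectedComponentIn (hUF ⟨x, hxi, rfl⟩), hψφ x (hCm (hintC hxi))⟩
      ?_ ⟨y, hy, rfl⟩
    rintro _ ⟨z, hz, rfl⟩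
    exact ⟨(hψm z).1, fun h => connectedComponentIn_subset _ _ hz ((hbd z).2 h)⟩
  have hUb : Bornology.IsBounded U := by
    have h1 : IsCompact (Sph (m + 1) \ O) := (isCompact_sphere _ _).diff hO
    refine (h1.image_of_continuousOn (hφ.mono fun y hy => ⟨hy.1, ?_⟩)).isBounded.subset
      (image_mono fun y hy => ⟨(C.int_subset hy).1, fun h => disjoint_left.1 hOC h (hintC hy)⟩)
    exact fun h => hy.2 (h ▸ hqO)
  let P : PlanarCube (m + 1) :=
    { e := e', U := U, e_cont := he'c, e_inj := he'i
      U_open := hUeq ▸ hF.connectedComponentIn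
      U_bdd := hUb, U_conn := hUconn
      U_disj := disjoint_left.2 hUF
      U_frontier := fun y hy => by
        rw [hUeq] at hy
        exact not_not.1 (frontier_connectedComponentIn_subset hF _ hy).2 }
  have hK : ∀ y, y ∈ P.K ↔ ψ y ∈ C.carrier := fun y => or_congr (hbd y) (hUmem y)
  have hφK : ∀ x ∈ C.carrier, φ x ∈ P.K := fun x hx => by rwa [hK, hψφ x (hCm hx)]
  exact ⟨{
    P := P
    g :=
      { toFun := fun y => ⟨ψ y, (hK y).1 y.2⟩
        invFun := fun x => ⟨φ x, hφK x x.2⟩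
        left_inv := fun y => Subtype.ext (hφψ y)
        right_inv := fun x => Subtype.ext (hψφ x (hCm x.2))
        continuous_toFun := (hψ.comp continuous_subtype_val).subtype_mk _
        continuous_invFun := ((hφ.mono hCm).comp_continuous continuous_subtype_val
          fun x => x.2).subtype_mk _ }
    mem_bd_iff := fun y => (hbd y).symm }⟩

end CrumpledCube

lemma DisjointDisksProperty.of_homeomorph {X Y : Type*} [MetricSpace X] [MetricSpace Y]
    [CompactSpace X] (g : X ≃ₜ Y) (h : DisjointDisksProperty X) : DisjointDisksProperty Y := by
  intro μ₁ μ₂ ε hε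
  obtain ⟨δ, hδ, hu⟩ := Metric.uniformContinuous_iff.1
    (CompactSpace.uniformContinuous_of_continuous g.continuous) ε hε
  obtain ⟨α, β, hα, hβ, hαβ⟩ := h ((g.symm : C(Y, X)).comp μ₁) ((g.symm : C(Y, X)).comp μ₂) δ hδ
  refine ⟨(g : C(X, Y)).comp α, (g : C(X, Y)).comp β, fun p => ?_, fun p => ?_, ?_⟩
  · simpa using hu (hα p)
  · simpa using hu (hβ p)
  · rw [← disjoint_iff_inter_eq_empty, disjoint_range_iff] at hαβ ⊢
    exact fun p q hpq => hαβ p q (g.injective hpq)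

/-- An associated map induces a relative map between planar models. -/
lemma IsAssociatedMap.exists_isRelMap {n : ℕ} {C D : CrumpledCube n} {h : ↥C.bd ≃ₜ ↥D.bd}
    {f : ↥C.carrier → ↥D.carrier} (hf : IsAssociatedMap C D h f) (A : C.PlanarModel)
    (B : D.PlanarModel) : ∃ F, IsRelMap A.P B.P F := by
  obtain ⟨hfc, hfh, hfbd⟩ := hf
  set F₀ : C(↥A.P.K, ↥B.P.K) := ⟨fun y => B.g.symm (f (A.g y)), by fun_prop⟩ with hF₀
  obtain ⟨F, hF⟩ := ContinuousMap.exists_restrict_eq A.P.isCompact_K.isClosed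
    (⟨fun y => (F₀ y : Fin n → ℝ), by fun_prop⟩ : C(↥A.P.K, Fin n → ℝ))
  have hFK : ∀ y : ↥A.P.K, F y = F₀ y := fun y => congrArg (fun k => k y) hF
  have hgF : ∀ y : ↥A.P.K, B.g (F₀ y) = f (A.g y) := fun y => B.g.apply_symm_apply _
  have hbd : ∀ y : ↥A.P.K, (F₀ y : Fin n → ℝ) ∈ range B.P.e ↔ (y : Fin n → ℝ) ∈ range A.P.e := by
    intro y
    rw [← B.mem_bd_iff, ← A.mem_bd_iff, hgF, hfbd]
  refine ⟨F, F.continuous, fun x hx => ?_, ?_, ?_⟩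
  · have hxK : x ∈ A.P.K := Or.inr hx
    have h1 := hFK ⟨x, hxK⟩
    simp only at h1
    rw [h1]
    exact (F₀ ⟨x, hxK⟩).2.resolve_left fun h2 => A.P.not_mem_U ((hbd _).1 h2) hx
  · ext z
    constructor
    · rintro ⟨x, hx, rfl⟩
      rw [hFK ⟨x, Or.inl hx⟩]
      exact (hbd _).2 hx
    · intro hz
      have h1 := (B.mem_bd_iff ⟨z, Or.inl hz⟩).2 hz
      set c := h.symm ⟨_, h1⟩ with hc
      set y := A.g.symm ⟨c, C.bd_subset_carrier c.2⟩ with hy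
      have hAy : A.g y = ⟨c, C.bd_subset_carrier c.2⟩ := A.g.apply_symm_apply _
      refine ⟨y, (A.mem_bd_iff y).1 (by rw [hAy]; exact c.2), ?_⟩
      rw [hFK]
      have h2 : F₀ y = ⟨z, Or.inl hz⟩ := by
        apply B.g.injective
        rw [hgF]
        apply Subtype.ext
        rw [hfh _ (by rw [hAy]; exact c.2)]
        have h3 : (⟨(A.g y : Amb n), by rw [hAy]; exact c.2⟩ : ↥C.bd) = c :=
          Subtype.ext (congrArg (fun a : ↥C.carrier => (a : Amb n)) hAy)
        rw [h3, hc, h.apply_symm_apply]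
      rw [h2]
  · intro x hx y hy hxy
    rw [hFK ⟨x, Or.inl hx⟩, hFK ⟨y, Or.inl hy⟩] at hxy
    have h1 := congrArg B.g (Subtype.ext hxy)
    rw [hgF, hgF] at h1
    have h2 := (A.mem_bd_iff ⟨x, Or.inl hx⟩).2 hx
    have h3 := (A.mem_bd_iff ⟨y, Or.inl hy⟩).2 hy
    have h4 := congrArg (Subtype.val) h1
    rw [hfh _ h2, hfh _ h3] at h4
    have h5 := congrArg Subtype.val (h.injective (Subtype.ext h4))
    exact congrArg Subtype.val (A.g.injective (Subtype.ext h5))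

/-- **Corollary 3.4.** If `(C,D,h) ∈ 𝒲_n` and `C` has the Disjoint Disks Property,
then so does `D`. -/
theorem stmt6 (n : ℕ) (hn : 2 ≤ n) (C D : CrumpledCube n) (h : ↥C.bd ≃ₜ ↥D.bd)
    (hW : MemW C D h) (hC : DisjointDisksProperty ↥C.carrier) :
    DisjointDisksProperty ↥D.carrier := by
  obtain ⟨m, rfl⟩ := Nat.exists_eq_add_of_le' (one_le_two.trans hn)
  obtain ⟨A⟩ := C.nonempty_planarModel
  obtain ⟨B⟩ := D.nonempty_planarModel
  have : CompactSpace ↥A.P.K := isCompact_iff_compactSpace.1 A.P.isCompact_K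
  have : CompactSpace ↥B.P.K := isCompact_iff_compactSpace.1 B.P.isCompact_K
  have : CompactSpace ↥C.carrier := A.g.compactSpace
  have hA : DisjointDisksProperty ↥A.P.K := hC.of_homeomorph A.g.symm
  rcases le_or_gt (m + 1) 4 with h4 | h4
  · exact absurd hA (A.P.not_disjointDisksProperty h4)
  · obtain ⟨f, hf⟩ := hW
    obtain ⟨F, hF⟩ := hf.exists_isRelMap A B
    exact (hF.disjointDisksProperty h4 hA).of_homeomorph B.g
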